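/- The Mordell conjecture (Faltings's theorem) for hyperelliptic curves: let K be a number field and let f be a polynomial with coefficients in K that is squarefree and of degree at least 5. Then the set of pairs (x, y) ∈ K × K with y² = f(x) is finite. -/

import Mathlib

set_option linter.unusedSectionVars false
set_option linter.style.longLine false
namespace Mord
open Height NumberField Height.AdmissibleAbsValues

/-- `Pl u v`: `v` is archimedean if `u = true`, nonarchimedean if `u = false`. -/
def Pl {K : Type*} [Field K] [NumberField K] (u : Bool) (v : AbsoluteValue K ℝ) : Prop :=
  if u then v ∈ (archAbsVal : Multiset (AbsoluteValue K ℝ)) else v ∈ (nonarchAbsVal : Set (AbsoluteValue K ℝ))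

/-- constant which is trivial at nonarchimedean places -/
def cst (u : Bool) (C : ℝ) : ℝ := if u then C else 1

section
variable {K : Type*} [Field K] [NumberField K]

lemma pl_true {v : AbsoluteValue K ℝ} : Pl true v ↔ v ∈ (archAbsVal : Multiset (AbsoluteValue K ℝ)) := by simp [Pl]
lemma pl_false {v : AbsoluteValue K ℝ} : Pl false v ↔ v ∈ (nonarchAbsVal : Set (AbsoluteValue K ℝ)) := by simp [Pl]

lemma iSup_abv_pos {ι : Type*} [Finite ι] {x : ι → K} (hx : x ≠ 0) (v : AbsoluteValue K ℝ) :
    0 < ⨆ i, v (x i) := by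
  obtain ⟨i, hi⟩ : ∃ j, x j ≠ 0 := Function.ne_iff.mp hx
  exact (v.pos hi).trans_le (Finite.le_ciSup (fun i => v (x i)) i)

lemma finsupp_iSup {ι : Type*} [Finite ι] {x : ι → K} (hx : x ≠ 0) :
    (fun v : (nonarchAbsVal : Set (AbsoluteValue K ℝ)) ↦ ⨆ i, v.val (x i)).HasFiniteMulSupport := by
  have : Nonempty {j // x j ≠ 0} := nonempty_subtype.mpr <| Function.ne_iff.mp hx
  suffices (fun v : (nonarchAbsVal : Set (AbsoluteValue K ℝ)) ↦ ⨆ i : {j // x j ≠ 0}, v.val (x i)).HasFiniteMulSupport by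
    convert! this with v
    obtain ⟨i, hi⟩ : ∃ j, x j ≠ 0 := Function.ne_iff.mp hx
    have : Nonempty ι := .intro i
    refine le_antisymm (ciSup_le fun j ↦ ?_) (ciSup_le fun ⟨j, hj⟩ ↦ Finite.le_ciSup_of_le j le_rfl)
    rcases eq_or_ne (x j) 0 with h | h
    · rw [h, v.val.map_zero]
      exact Real.iSup_nonneg' ⟨⟨i, hi⟩, v.val.nonneg ..⟩
    · exact Finite.le_ciSup_of_le ⟨j, h⟩ le_rfl
  fun_prop (disch := grind)

theorem logHeight_le_of_local {ι ι' : Type*} [Finite ι] [Finite ι'] {x : ι → K} {y : ι' → K}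
    (hx : x ≠ 0) (hy : y ≠ 0) {C : ℝ} (hC : 1 ≤ C)
    (h : ∀ u v, Pl u v → ∀ i, v (x i) ≤ cst u C * ⨆ j, v (y j)) :
    logHeight x ≤ logHeight y + totalWeight K * Real.log C := by
  have hne : Nonempty ι := ⟨(Function.ne_iff.mp hx).choose⟩
  have key : mulHeight x ≤ C ^ totalWeight K * mulHeight y := by
    rw [Height.mulHeight_eq hx, Height.mulHeight_eq hy, ← mul_assoc]
    have h1 : ((archAbsVal (K := K)).map fun v ↦ ⨆ i, v (x i)).prod ≤
        C ^ totalWeight K * ((archAbsVal (K := K)).map fun v ↦ ⨆ i, v (y i)).prod := by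
      have : C ^ totalWeight K = ((archAbsVal (K := K)).map fun _ ↦ C).prod := by
        simp [totalWeight]
      rw [this, ← Multiset.prod_map_mul]
      apply Multiset.prod_map_le_prod_map₀
      · intro v _
        exact (iSup_abv_pos hx v).le
      · intro v hv
        exact ciSup_le fun i => by simpa [cst] using h true v (pl_true.2 hv) i
    have h2 : (∏ᶠ v : (nonarchAbsVal : Set (AbsoluteValue K ℝ)), ⨆ i, v.val (x i)) ≤
        ∏ᶠ v : (nonarchAbsVal : Set (AbsoluteValue K ℝ)), ⨆ i, v.val (y i) := by
      refine finprod_le_finprod (finsupp_iSup hx) (fun v => (iSup_abv_pos hx v.1).le) (finsupp_iSup hy) ?_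
      intro v
      exact ciSup_le fun i => by simpa [cst] using h false v.1 (pl_false.2 v.2) i
    refine mul_le_mul h1 h2 ?_ ?_
    · exact finprod_nonneg fun v => (iSup_abv_pos hx v.1).le
    · refine mul_nonneg (by positivity) (Multiset.prod_nonneg ?_)
      simp only [Multiset.mem_map]
      rintro _ ⟨v, _, rfl⟩
      exact (iSup_abv_pos hy v).le
  have := Real.log_le_log (mulHeight_pos x) key
  rw [Real.log_mul (by positivity) (mulHeight_ne_zero y), Real.log_pow] at this
  simp only [logHeight]
  linarith

lemma pl_nonarch {v : AbsoluteValue K ℝ} (h : Pl false v) : IsNonarchimedean v :=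
  isNonarchimedean v (pl_false.1 h)

lemma cst_one_le {u : Bool} {C : ℝ} (h : 1 ≤ C) : 1 ≤ cst u C := by
  unfold cst; split <;> simp [h]
lemma cst_mul (u : Bool) (C D : ℝ) : cst u (C * D) = cst u C * cst u D := by
  unfold cst; split <;> simp
lemma cst_pow (u : Bool) (C : ℝ) (n : ℕ) : cst u (C ^ n) = cst u C ^ n := by
  unfold cst; split <;> simp
lemma cst_mono (u : Bool) {C D : ℝ} (h : C ≤ D) : cst u C ≤ cst u D := by
  unfold cst; split <;> simp [h]

/-- `T`-integrality -/
lemma pl_false_integral {v : AbsoluteValue K ℝ} (h : Pl false v) (x : 𝓞 K) : v (x : K) ≤ 1 := by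
  have h' : IsFinitePlace v := pl_false.1 h
  obtain ⟨w, rfl⟩ := (isFinitePlace_iff v).1 h'
  have h1 := FinitePlace.norm_embedding_eq w (x : K)
  have h2 := FinitePlace.norm_le_one K w.maximalIdeal x
  calc w.val (x : K) = w (x : K) := rfl
    _ ≤ 1 := by rw [← h1]; exact h2

lemma integral_of_pl {x : K} (h : ∀ v, Pl false v → v x ≤ 1) : ∃ y : 𝓞 K, (y : K) = x := by
  refine IsDedekindDomain.HeightOneSpectrum.mem_integers_of_valuation_le_one (R := 𝓞 K) K x fun p => ?_
  have h1 := h (FinitePlace.mk p).val (pl_false.2 (FinitePlace.isFinitePlace _))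
  have h3 : (FinitePlace.mk p).val x = ‖FinitePlace.embedding p x‖ := rfl
  rw [h3, FinitePlace.norm_embedding'] at h1
  have h2 : WithZeroMulInt.toNNReal (HeightOneSpectrum.absNorm_ne_zero p) (p.valuation K x) ≤ 1 := by
    exact_mod_cast h1
  rw [← map_one (WithZeroMulInt.toNNReal (HeightOneSpectrum.absNorm_ne_zero p))] at h2
  exact (WithZeroMulInt.toNNReal_strictMono (HeightOneSpectrum.one_lt_absNorm_nnreal p)).le_iff_le.1 h2

lemma pl_true_iff {v : AbsoluteValue K ℝ} : Pl true v ↔ ∃ φ : K →+* ℂ, ∀ x, v x = ‖φ x‖ := by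
  rw [pl_true]
  constructor
  · intro h
    have h' : IsInfinitePlace v := mem_multisetInfinitePlace.1 h
    obtain ⟨φ, rfl⟩ := h'
    exact ⟨φ, fun x => rfl⟩
  · rintro ⟨φ, h⟩
    refine mem_multisetInfinitePlace.2 ⟨φ, ?_⟩
    ext x
    exact (h x).symm

variable (K) in
theorem siegel : ∃ c : ℝ, 1 ≤ c ∧ ∀ (α β : Type) [Fintype α] [Fintype β] (a : α → β → K) (A : ℝ),
    1 ≤ A → (∀ u v, Pl u v → ∀ i j, v (a i j) ≤ cst u A) → Fintype.card α < Fintype.card β →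
    ∃ ξ : β → K, ξ ≠ 0 ∧ (∀ i, ∑ j, a i j * ξ j = 0) ∧ ∀ u v, Pl u v → ∀ j, v (ξ j) ≤
      cst u (c * (c * Fintype.card β * A) ^
        ((Fintype.card α : ℝ) / (Fintype.card β - Fintype.card α))) := by
  classical
  obtain ⟨c, hc⟩ : ∃ c : ℝ, ∀ (α β : Type) [Fintype α] [Fintype β] (a : Matrix α β (𝓞 K)) (A : ℝ),
      (∀ i j, house (a i j : K) ≤ A) → a ≠ 0 → 0 < Fintype.card α → 
      Fintype.card α < Fintype.card β → ∃ ξ : β → 𝓞 K, ξ ≠ 0 ∧ a.mulVec ξ = 0 ∧ 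
      ∀ l, house (ξ l : K) ≤ c * ((c * Fintype.card β * A) ^
        ((Fintype.card α : ℝ) / (Fintype.card β - Fintype.card α))) := by
    refine ⟨?_, ?_⟩
    swap
    intro α β _ _ a A habs ha hp hpq
    exact house.exists_ne_zero_int_vec_house_le K a ha hp hpq rfl habs rfl
  refine ⟨max |c| 1, le_max_right _ _, fun α β _ _ a A hA h hpq => ?_⟩
  have hq : 1 ≤ Fintype.card β := by omega
  have hq' : (1:ℝ) ≤ Fintype.card β := by exact_mod_cast hq
  have hpq' : (Fintype.card α : ℝ) < Fintype.card β := by exact_mod_cast hpq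
  have he : 0 ≤ (Fintype.card α : ℝ) / (Fintype.card β - Fintype.card α) :=
    div_nonneg (by positivity) (by linarith)
  set e := (Fintype.card α : ℝ) / (Fintype.card β - Fintype.card α)
  have hm : 1 ≤ max |c| 1 := le_max_right _ _
  have hbase : 1 ≤ max |c| 1 * Fintype.card β * A :=
    one_le_mul_of_one_le_of_one_le (one_le_mul_of_one_le_of_one_le hm hq') hA
  have hbig : 1 ≤ max |c| 1 * (max |c| 1 * Fintype.card β * A) ^ e :=
    one_le_mul_of_one_le_of_one_le hm (Real.one_le_rpow hbase he)
  choose b hb using fun i j => integral_of_pl (x := a i j) (fun v hv => by simpa [cst] using h false v hv i j)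
  by_cases hz : Matrix.of b = 0
  · have hbe : Nonempty β := Fintype.card_pos_iff.1 hq
    refine ⟨fun _ => 1, ?_, ?_, ?_⟩
    · intro h0
      have := congrFun h0 hbe.some
      simp at this
    · intro i
      refine Finset.sum_eq_zero fun j _ => ?_
      have : b i j = 0 := congrFun (congrFun hz i) j
      rw [← hb i j, this]; simp
    · intro u v _ j
      simpa using cst_one_le hbig
  by_cases hp : Fintype.card α = 0
  · have hem : IsEmpty α := Fintype.card_eq_zero_iff.1 hp
    exact absurd (Subsingleton.elim _ _) hz
  have hh : ∀ i j, house (((Matrix.of b : Matrix α β (𝓞 K)) i j : 𝓞 K) : K) ≤ A := by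
    intro i j
    rw [Matrix.of_apply, hb i j, house_eq_sup']
    have : (Finset.univ.sup' Finset.univ_nonempty fun φ : K →+* ℂ => ‖φ (a i j)‖₊) ≤ A.toNNReal := by
      refine Finset.sup'_le _ _ fun φ _ => ?_
      rw [← NNReal.coe_le_coe, Real.coe_toNNReal _ (by linarith), coe_nnnorm]
      have := h true (NumberField.place φ) (pl_true_iff.2 ⟨φ, fun x => rfl⟩) i j
      simpa [cst] using this
    rw [← NNReal.coe_le_coe, Real.coe_toNNReal _ (by linarith)] at this
    exact this
  obtain ⟨ξ, h1, h2, h3⟩ := hc α β (Matrix.of b) A hh hz (Nat.pos_of_ne_zero hp) hpq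
  · refine ⟨fun j => ξ j, ?_, ?_, ?_⟩
    · intro h0
      apply h1
      funext j
      have := congrFun h0 j
      simpa using this
    · intro i
      have := congrArg (algebraMap (𝓞 K) K) (congrFun h2 i)
      simp only [Matrix.mulVec, dotProduct, map_sum, map_mul, Pi.zero_apply, map_zero, Matrix.of_apply] at this
      rw [← this]
      exact Finset.sum_congr rfl fun j _ => by rw [← hb i j]
    · intro u v hv j
      cases u
      · simpa [cst] using pl_false_integral hv (ξ j)
      · obtain ⟨φ, hφ⟩ := pl_true_iff.1 hv
        rw [hφ]
        refine (norm_embedding_le_house _ φ).trans ((h3 j).trans ?_)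
        simp only [cst, if_true]
        refine (le_abs_self _).trans ?_
        rw [abs_mul]
        have hA0 : |A| = A := abs_of_nonneg (by linarith)
        gcongr
        · exact le_max_left _ _
        · refine (Real.abs_rpow_le_abs_rpow _ _).trans ?_
          rw [abs_mul, abs_mul, hA0, Nat.abs_cast]
          gcongr
          exact le_max_left _ _
end

end Mord

set_option linter.unusedSectionVars false
set_option linter.style.longLine false

namespace Mord
open scoped ENNReal

noncomputable section

def oadd (u : Bool) (a b : ℝ≥0∞) : ℝ≥0∞ := if u then a + b else max a b
def osum (u : Bool) {ι : Type*} (f : ι → ℝ≥0∞) : ℝ≥0∞ := if u then ∑' i, f i else ⨆ i, f i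
/-- constants in `ℝ≥0∞` trivial at nonarchimedean places -/
def ecst (u : Bool) (C : ℝ≥0∞) : ℝ≥0∞ := if u then C else 1

section osum
variable {u : Bool} {ι κ : Type*}

lemma oadd_mono {a b c d : ℝ≥0∞} (h : a ≤ c) (h' : b ≤ d) : oadd u a b ≤ oadd u c d := by
  unfold oadd; split
  · exact add_le_add h h'
  · exact max_le_max h h'

lemma osum_mono {f g : ι → ℝ≥0∞} (h : ∀ i, f i ≤ g i) : osum u f ≤ osum u g := by
  unfold osum; split
  · exact ENNReal.tsum_le_tsum h
  · exact iSup_mono h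

lemma le_osum (f : ι → ℝ≥0∞) (i : ι) : f i ≤ osum u f := by
  unfold osum; split
  · exact ENNReal.le_tsum i
  · exact le_iSup f i

lemma osum_mul_left (a : ℝ≥0∞) (f : ι → ℝ≥0∞) : osum u (fun i => a * f i) = a * osum u f := by
  unfold osum; split
  · exact ENNReal.tsum_mul_left
  · rw [ENNReal.mul_iSup]

lemma osum_mul_right (a : ℝ≥0∞) (f : ι → ℝ≥0∞) : osum u (fun i => f i * a) = osum u f * a := by
  simp_rw [mul_comm _ a]; exact osum_mul_left a f

lemma osum_sigma {κ : ι → Type*} (f : (Σ i, κ i) → ℝ≥0∞) :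
    osum u f = osum u fun i => osum u fun k => f ⟨i, k⟩ := by
  unfold osum; split
  · exact ENNReal.tsum_sigma' f
  · exact iSup_sigma

lemma osum_prod (f : ι × κ → ℝ≥0∞) : osum u f = osum u fun i => osum u fun k => f (i, k) := by
  unfold osum; split
  · exact ENNReal.tsum_prod' (f := f)
  · exact iSup_prod

lemma osum_equiv (e : ι ≃ κ) (f : κ → ℝ≥0∞) : osum u (fun i => f (e i)) = osum u f := by
  unfold osum; split
  · exact e.tsum_eq f
  · exact e.iSup_comp (g := f)

lemma osum_inj {e : ι → κ} (he : Function.Injective e) (f : κ → ℝ≥0∞) :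
    osum u (fun i => f (e i)) ≤ osum u f := by
  unfold osum; split
  · exact ENNReal.tsum_comp_le_tsum_of_injective he f
  · exact iSup_comp_le f e

lemma osum_oadd_le (f g : ι → ℝ≥0∞) :
    osum u (fun i => oadd u (f i) (g i)) ≤ oadd u (osum u f) (osum u g) := by
  unfold osum oadd; split
  · exact ENNReal.tsum_add.le
  · simp only [iSup_le_iff, max_le_iff]
    intro i
    exact ⟨le_max_of_le_left (le_iSup f i), le_max_of_le_right (le_iSup g i)⟩

lemma osum_zero : osum u (fun _ : ι => 0) = 0 := by
  unfold osum; split <;> simp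

lemma osum_le_single (i : ι) (f : ι → ℝ≥0∞) (h : ∀ j, j ≠ i → f j = 0) : osum u f ≤ f i := by
  unfold osum; split
  · rw [tsum_eq_single i h]
  · refine iSup_le fun j => ?_
    by_cases hj : j = i
    · rw [hj]
    · rw [h j hj]; exact zero_le

lemma osum_fintype_le [Fintype ι] (f : ι → ℝ≥0∞) (B : ℝ≥0∞) (h : ∀ i, f i ≤ B) :
    osum u f ≤ ecst u (Fintype.card ι) * B := by
  unfold osum ecst; split
  · rw [tsum_fintype]
    refine (Finset.sum_le_card_nsmul _ _ B fun i _ => h i).trans ?_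
    simp
  · simpa using h
end osum

structure SubNorm (u : Bool) (A : Type*) [CommRing A] where
  toFun : A → ℝ≥0∞
  zero' : toFun 0 = 0
  one' : toFun 1 ≤ 1
  add' : ∀ a b, toFun (a + b) ≤ oadd u (toFun a) (toFun b)
  mul' : ∀ a b, toFun (a * b) ≤ toFun a * toFun b
  neg' : ∀ a, toFun (-a) = toFun a

instance {u : Bool} {A : Type*} [CommRing A] : CoeFun (SubNorm u A) (fun _ => A → ℝ≥0∞) := ⟨SubNorm.toFun⟩

namespace SubNorm
variable {u : Bool} {A B : Type*} [CommRing A] [CommRing B] (ν : SubNorm u A)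

lemma sub_le (a b : A) : ν (a - b) ≤ oadd u (ν a) (ν b) := by
  rw [sub_eq_add_neg]; simpa [ν.neg'] using ν.add' a (-b)

lemma pow_le (a : A) (n : ℕ) : ν (a ^ n) ≤ ν a ^ n := by
  induction n with
  | zero => simpa using ν.one'
  | succ n ih => rw [pow_succ, pow_succ]; exact (ν.mul' _ _).trans (mul_le_mul' ih le_rfl)

lemma sum_le {ι : Type*} (s : Finset ι) (f : ι → A) :
    ν (∑ i ∈ s, f i) ≤ osum u (fun i : s => ν (f i)) := by
  classical
  have h1 : u = true → ∀ s : Finset ι, ν (∑ i ∈ s, f i) ≤ ∑ i ∈ s, ν (f i) := by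
    intro hu s
    induction s using Finset.induction_on with
    | empty => simp [ν.zero']
    | insert a s ha ih =>
      rw [Finset.sum_insert ha, Finset.sum_insert ha]
      have := ν.add' (f a) (∑ i ∈ s, f i)
      rw [oadd, if_pos hu] at this
      exact this.trans (by gcongr)
  have h2 : u = false → ∀ s : Finset ι, ν (∑ i ∈ s, f i) ≤ s.sup (fun i => ν (f i)) := by
    intro hu s
    induction s using Finset.induction_on with
    | empty => simp [ν.zero']
    | insert a s ha ih =>
      rw [Finset.sum_insert ha, Finset.sup_insert]
      have := ν.add' (f a) (∑ i ∈ s, f i)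
      rw [oadd, if_neg (by simp [hu])] at this
      exact this.trans (max_le_max le_rfl ih)
  rcases Bool.eq_false_or_eq_true u with hu | hu
  ·
    refine (h1 hu s).trans ?_
    rw [osum, if_pos hu, tsum_fintype, Finset.sum_coe_sort s (fun i => ν (f i))]
  ·
    refine (h2 hu s).trans ?_
    rw [osum, if_neg (by simp [hu])]
    exact Finset.sup_le fun i hi => le_iSup (fun i : s => ν (f i)) ⟨i, hi⟩

lemma sum_le_card {ι : Type*} (s : Finset ι) (f : ι → A) (B : ℝ≥0∞) (h : ∀ i ∈ s, ν (f i) ≤ B) :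
    ν (∑ i ∈ s, f i) ≤ ecst u s.card * B := by
  refine (ν.sum_le s f).trans ((osum_fintype_le (ι := s) _ B fun i => h i i.2).trans ?_)
  simp

/-- pull back along a ring hom -/
def comap (φ : B →+* A) : SubNorm u B where
  toFun b := ν (φ b)
  zero' := by simp [ν.zero']
  one' := by simpa using ν.one'
  add' a b := by simpa using ν.add' _ _
  mul' a b := by simpa using ν.mul' _ _
  neg' a := by simp [ν.neg']

/-- Gauss type norms on power series -/
def ps (r : ℝ≥0∞) : SubNorm u (PowerSeries A) where
  toFun f := osum u fun k => ν (PowerSeries.coeff k f) * r ^ k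
  zero' := by simp [ν.zero', osum_zero]
  one' := by
    refine (osum_le_single 0 _ ?_).trans ?_
    · intro j hj; simp [PowerSeries.coeff_one, hj, ν.zero']
    · simpa using ν.one'
  add' f g := by
    refine le_trans (osum_mono fun k => ?_) (osum_oadd_le _ _)
    rw [map_add]
    refine (mul_le_mul' (ν.add' _ _) le_rfl).trans ?_
    unfold oadd; split
    · rw [add_mul]
    · rw [max_mul_of_nonneg]; exact zero_le
  mul' f g := by
    rw [← osum_mul_right]
    simp_rw [← osum_mul_left]
    rw [← osum_prod (u := u) (fun p : ℕ × ℕ => ν (PowerSeries.coeff p.1 f) * r ^ p.1 *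
      (ν (PowerSeries.coeff p.2 g) * r ^ p.2)),
      ← osum_equiv (Finset.HasAntidiagonal.sigmaAntidiagonalEquivProd), osum_sigma]
    refine osum_mono fun n => ?_
    rw [PowerSeries.coeff_mul]
    refine (mul_le_mul' (ν.sum_le _ _) le_rfl).trans ?_
    rw [← osum_mul_right]
    refine osum_mono fun p => ?_
    have hp := Finset.HasAntidiagonal.mem_antidiagonal.1 p.2
    simp only [Finset.HasAntidiagonal.sigmaAntidiagonalEquivProd_apply]
    refine (mul_le_mul' (ν.mul' _ _) le_rfl).trans ?_
    have hp2 : r ^ n = r ^ p.1.1 * r ^ p.1.2 := by rw [← pow_add]; exact congrArg _ hp.symm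
    rw [hp2]
    apply le_of_eq; ring
  neg' f := by simp [ν.neg']

def poly (r : ℝ≥0∞) : SubNorm u (Polynomial A) := (ν.ps r).comap Polynomial.coeToPowerSeries.ringHom

lemma ps_apply (r : ℝ≥0∞) (f : PowerSeries A) : ν.ps r f = osum u fun k => ν (PowerSeries.coeff k f) * r ^ k := rfl

lemma poly_apply (r : ℝ≥0∞) (p : Polynomial A) : ν.poly r p = osum u fun k => ν (p.coeff k) * r ^ k := by
  show (ν.ps r) (Polynomial.coeToPowerSeries.ringHom p) = _
  rw [ps_apply]
  simp

lemma coeff_le_ps (r : ℝ≥0∞) (f : PowerSeries A) (k : ℕ) : ν (PowerSeries.coeff k f) * r ^ k ≤ ν.ps r f :=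
  le_osum (fun k => ν (PowerSeries.coeff k f) * r ^ k) k

lemma coeff_le_poly (r : ℝ≥0∞) (p : Polynomial A) (k : ℕ) : ν (p.coeff k) * r ^ k ≤ ν.poly r p := by
  rw [poly_apply]; exact le_osum (fun k => ν (p.coeff k) * r ^ k) k

lemma coeff_le_poly_one (p : Polynomial A) (k : ℕ) : ν (p.coeff k) ≤ ν.poly 1 p := by
  simpa using ν.coeff_le_poly 1 p k

lemma poly_C (r : ℝ≥0∞) (a : A) : ν.poly r (Polynomial.C a) ≤ ν a := by
  rw [poly_apply]
  refine (osum_le_single 0 _ ?_).trans ?_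
  · intro j hj; simp [Polynomial.coeff_C, hj, ν.zero']
  · simp

lemma poly_X (r : ℝ≥0∞) : ν.poly r Polynomial.X ≤ r := by
  rw [poly_apply]
  refine (osum_le_single 1 _ ?_).trans ?_
  · intro j hj; simp [Polynomial.coeff_X, hj.symm, ν.zero']
  · simpa using mul_le_mul' ν.one' (le_refl r)

lemma ps_C (r : ℝ≥0∞) (a : A) : ν.ps r (PowerSeries.C a) ≤ ν a := by
  rw [ps_apply]
  refine (osum_le_single 0 _ ?_).trans ?_
  · intro j hj; simp [PowerSeries.coeff_C, hj, ν.zero']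
  · simp

lemma ps_X (r : ℝ≥0∞) : ν.ps r PowerSeries.X ≤ r := by
  rw [ps_apply]
  refine (osum_le_single 1 _ ?_).trans ?_
  · intro j hj; simp [PowerSeries.coeff_X, hj, ν.zero']
  · simpa using mul_le_mul' ν.one' (le_refl r)

lemma eval₂_le (φ : B →+* A) (x : A) (p : Polynomial B) :
    ν (p.eval₂ φ x) ≤ (ν.comap φ).poly (ν x) p := by
  rw [Polynomial.eval₂_eq_sum, Polynomial.sum, poly_apply]
  refine (ν.sum_le _ _).trans ?_
  refine le_trans (osum_mono fun k => (ν.mul' _ _).trans (mul_le_mul' le_rfl (ν.pow_le _ _))) ?_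
  exact osum_inj (e := fun k : p.support => (k : ℕ)) Subtype.val_injective
    (fun k => ν (φ (p.coeff k)) * ν x ^ k)

lemma poly_mono {ν ν' : SubNorm u A} (h : ∀ a, ν a ≤ ν' a) (r : ℝ≥0∞) (p : Polynomial A) :
    ν.poly r p ≤ ν'.poly r p := by
  rw [poly_apply, poly_apply]
  exact osum_mono fun k => mul_le_mul' (h _) le_rfl

lemma poly_radius {n : ℕ} {r R : ℝ≥0∞} (hr : r ≤ R) (hR : 1 ≤ R) (p : Polynomial A)
    (hp : p.natDegree ≤ n) : ν.poly r p ≤ R ^ n * ν.poly 1 p := by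
  rw [poly_apply, poly_apply, ← osum_mul_left]
  refine osum_mono fun k => ?_
  by_cases hk : k ≤ n
  · rw [one_pow, mul_one, mul_comm]
    gcongr
  · rw [Polynomial.coeff_eq_zero_of_natDegree_lt (by omega), ν.zero']; simp

end SubNorm

/-- the subnorm of an absolute value -/
def absN {K : Type*} [Field K] (u : Bool) (v : AbsoluteValue K ℝ) (h : u = false → IsNonarchimedean v) :
    SubNorm u K where
  toFun x := ENNReal.ofReal (v x)
  zero' := by simp
  one' := by simp
  add' a b := by
    cases u
    · simp only [oadd]
      simpa [ENNReal.ofReal_max] using ENNReal.ofReal_le_ofReal (h rfl a b)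
    · simp only [oadd, if_true]
      rw [← ENNReal.ofReal_add (v.nonneg _) (v.nonneg _)]
      exact ENNReal.ofReal_le_ofReal (v.add_le a b)
  mul' a b := by rw [map_mul, ENNReal.ofReal_mul (v.nonneg _)]
  neg' a := by simp

def plN {K : Type*} [Field K] [NumberField K] {u : Bool} {v : AbsoluteValue K ℝ} (h : Pl u v) : SubNorm u K :=
  absN u v (by rintro rfl; exact pl_nonarch h)

lemma plN_apply {K : Type*} [Field K] [NumberField K] {u : Bool} {v : AbsoluteValue K ℝ} (h : Pl u v) (x : K) :
    plN h x = ENNReal.ofReal (v x) := rfl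

lemma ecst_mono {u : Bool} {a b : ℝ≥0∞} (h : a ≤ b) : ecst u a ≤ ecst u b := by
  unfold ecst; split <;> simp [h]
lemma ecst_mul (u : Bool) (a b : ℝ≥0∞) : ecst u (a * b) = ecst u a * ecst u b := by
  unfold ecst; split <;> simp
lemma ecst_pow (u : Bool) (a : ℝ≥0∞) (n : ℕ) : ecst u (a ^ n) = ecst u a ^ n := by
  unfold ecst; split <;> simp
lemma one_le_ecst {u : Bool} {a : ℝ≥0∞} (h : 1 ≤ a) : 1 ≤ ecst u a := by
  unfold ecst; split <;> simp [h]
lemma ecst_ofReal (u : Bool) (C : ℝ) : ecst u (ENNReal.ofReal C) = ENNReal.ofReal (cst u C) := by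
  unfold ecst cst; split <;> simp
lemma oadd_le {u : Bool} {a b c : ℝ≥0∞} (h : a ≤ c) (h' : b ≤ c) : oadd u a b ≤ ecst u 2 * c := by
  unfold oadd ecst; split
  · rw [two_mul]; exact add_le_add h h'
  · simp [h, h']
lemma oadd_le' {u : Bool} {x y a b c : ℝ≥0∞} (h : x ≤ ecst u a * c) (h' : y ≤ ecst u b * c) :
    oadd u x y ≤ ecst u (a + b) * c := by
  unfold oadd; unfold ecst at *; split
  · simp_all; rw [add_mul]; exact add_le_add h h'
  · simp_all
end

end Mord

set_option linter.unusedSectionVars false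
set_option linter.style.longLine false

namespace Mord
open scoped ENNReal
open Polynomial

noncomputable section

/-- bivariate polynomials, inner variable `z1 = C X`, outer variable `z2 = X` -/
abbrev P2 (K : Type*) [Field K] := Polynomial (Polynomial K)

section
variable {K : Type*} [Field K]

/-- weighted degree at most `n` -/
def Wt (a b n : ℤ) (p : P2 K) : Prop := ∀ i j : ℕ, n < a * i + b * j → (p.coeff j).coeff i = 0

namespace Wt
variable {a b m n : ℤ} {p q : P2 K}
lemma zero : Wt a b n (0 : P2 K) := fun i j _ => by simp
lemma mono (h : Wt a b n p) (hm : n ≤ m) : Wt a b m p := fun i j hij => h i j (by omega)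
lemma add (h : Wt a b n p) (h' : Wt a b n q) : Wt a b n (p + q) := fun i j hij => by
  simp [h i j hij, h' i j hij]
lemma sub (h : Wt a b n p) (h' : Wt a b n q) : Wt a b n (p - q) := fun i j hij => by
  simp [h i j hij, h' i j hij]
lemma neg (h : Wt a b n p) : Wt a b n (-p) := fun i j hij => by simp [h i j hij]
lemma sum {ι : Type*} (s : Finset ι) (f : ι → P2 K) (h : ∀ i ∈ s, Wt a b n (f i)) :
    Wt a b n (∑ i ∈ s, f i) := by
  classical
  induction s using Finset.induction_on with
  | empty => simpa using zero
  | insert x s hx ih =>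
    rw [Finset.sum_insert hx]
    exact add (h x (by simp)) (ih fun i hi => h i (by simp [hi]))
lemma mul (h : Wt a b n p) (h' : Wt a b m q) : Wt a b (n + m) (p * q) := fun i j hij => by
  rw [coeff_mul, finsetSum_coeff]
  refine Finset.sum_eq_zero fun x hx => ?_
  rw [coeff_mul]
  refine Finset.sum_eq_zero fun y hy => ?_
  have hx' := Finset.HasAntidiagonal.mem_antidiagonal.1 hx
  have hy' := Finset.HasAntidiagonal.mem_antidiagonal.1 hy
  by_cases h1 : n < a * y.1 + b * x.1
  · rw [h _ _ h1, zero_mul]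
  · rw [h' _ _ ?_, mul_zero]
    rw [← hx', ← hy'] at hij
    push_cast at hij
    linarith
lemma one : Wt a b 0 (1 : P2 K) := fun i j hij => by
  rw [coeff_one]
  split_ifs with h
  · subst h; rw [coeff_one]
    split_ifs with h'
    · subst h'; simp at hij
    · rfl
  · simp
lemma pow (h : Wt a b n p) (k : ℕ) : Wt a b (k * n) (p ^ k) := by
  induction k with
  | zero => simpa using one
  | succ k ih => rw [pow_succ]; exact (ih.mul h).mono (by push_cast; linarith)
lemma z1 : Wt a b a (C X : P2 K) := fun i j hij => by
  rw [coeff_C]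
  split_ifs with h
  · subst h; rw [coeff_X]
    split_ifs with h'
    · subst h'; simp at hij
    · rfl
  · simp
lemma z2 : Wt a b b (X : P2 K) := fun i j hij => by
  rw [coeff_X]
  split_ifs with h
  · subst h; rw [coeff_one]
    split_ifs with h'
    · subst h'; simp at hij
    · rfl
  · simp
lemma const (c : K) : Wt a b 0 (C (C c) : P2 K) := fun i j hij => by
  rw [coeff_C]
  split_ifs with h
  · subst h; rw [coeff_C]
    split_ifs with h'
    · subst h'; simp at hij
    · rfl
  · simp
lemma cmul (c : K) (h : Wt a b n p) : Wt a b n (C (C c) * p) := by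
  simpa using (const (a := a) (b := b) c).mul h
end Wt

lemma natDegree_of_Wt {n : ℕ} {p : P2 K} (h : Wt 0 1 n p) : p.natDegree ≤ n := by
  rw [natDegree_le_iff_coeff_eq_zero]
  intro j hj
  ext i
  rw [coeff_zero]
  exact h i j (by push_cast; omega)

lemma Wt_of_natDegree {n : ℕ} {p : P2 K} (h : p.natDegree ≤ n) : Wt 0 1 n p := by
  intro i j hij
  have : p.coeff j = 0 := coeff_eq_zero_of_natDegree_lt (by omega)
  rw [this]; simp

lemma Wt_monomial (i j : ℕ) (a b : ℤ) : Wt a b (a * i + b * j) ((C X : P2 K) ^ i * X ^ j) := by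
  have := ((Wt.z1 (K := K) (a := a) (b := b)).pow i).mul ((Wt.z2 (K := K) (a := a) (b := b)).pow j)
  exact this.mono (by linarith)

/-- substitution `z2 ↦ z2 + s(z1)` -/
def tau (s : K[X]) : P2 K →+* P2 K := eval₂RingHom C (X + C s)

lemma tau_C (s c : K[X]) : tau s (C c) = C c := by simp [tau]
lemma tau_X (s : K[X]) : tau s X = X + C s := by simp [tau]
lemma tau_tau (s : K[X]) (p : P2 K) : tau (-s) (tau s p) = p := by
  have : (tau (-s)).comp (tau s) = RingHom.id _ := by
    ext <;> simp [tau]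
  exact congrArg (fun f : P2 K →+* P2 K => f p) this
lemma tau_tau' (s : K[X]) (p : P2 K) : tau s (tau (-s) p) = p := by
  simpa using tau_tau (-s) p

lemma tau_Wt {n : ℤ} {p : P2 K} (h : Wt 1 1 n p) (c : K) : Wt 1 1 n (tau (C c * X) p) := by
  have : tau (C c * X) p = ∑ j ∈ p.support, C (p.coeff j) * (X + C (C c * X)) ^ j := by
    simp [tau, eval₂_eq_sum, Polynomial.sum]
  rw [this]
  refine Wt.sum _ _ fun j _ => ?_
  have h1 : Wt 1 1 (n - j) (C (p.coeff j) : P2 K) := by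
    intro i k hik
    rw [coeff_C]
    split_ifs with hk
    · subst hk; exact h i j (by push_cast at hik; linarith)
    · simp
  have h2 : Wt 1 1 1 (X + C (C c * X) : P2 K) := by
    refine Wt.z2.add ?_
    rw [C_mul]
    exact Wt.z1.cmul c
  exact (h1.mul (h2.pow j)).mono (by linarith)

lemma natDegree_tau_le (s : K[X]) (p : P2 K) : (tau s p).natDegree ≤ p.natDegree := by
  have : tau s p = p.comp (X + C s) := by simp [tau, comp]
  rw [this]
  refine natDegree_comp_le.trans ?_
  rw [natDegree_X_add_C, mul_one]

lemma tau_sub (c : ℕ) (p : P2 K) : tau X ((X - C X) ^ c * p) = X ^ c * tau X p := by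
  simp [tau_X, tau_C]

lemma dvd_iff_tau (c : ℕ) (p : P2 K) : (X - C X : P2 K) ^ c ∣ p ↔ X ^ c ∣ tau X p := by
  constructor
  · rintro ⟨q, rfl⟩
    exact ⟨tau X q, tau_sub c q⟩
  · rintro ⟨q, hq⟩
    refine ⟨tau (-X) q, ?_⟩
    have := congrArg (tau (-X)) hq
    rw [tau_tau] at this
    rw [this]
    simp [tau_X, sub_eq_add_neg]

/-- degree in z1 drops when dividing by z2 - z1 -/
lemma Wt10_of_sub {n : ℤ} {p : P2 K} (h : Wt 1 0 n ((X - C X) * p)) : Wt 1 0 (n - 1) p := by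
  obtain ⟨B, hB⟩ : ∃ B : ℕ, ∀ i j : ℕ, B ≤ i → (p.coeff j).coeff i = 0 := by
    refine ⟨(p.support.sup fun j => (p.coeff j).natDegree) + 1, fun i j hi => ?_⟩
    by_cases hj : j ∈ p.support
    · apply coeff_eq_zero_of_natDegree_lt
      have := Finset.le_sup (f := fun j => (p.coeff j).natDegree) hj
      omega
    · rw [notMem_support_iff.1 hj]; simp
  have key : ∀ k i : ℕ, B ≤ i + k → n - 1 < i → ∀ j, (p.coeff j).coeff i = 0 := by
    intro k
    induction k with
    | zero => intro i hi _ j; exact hB i j hi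
    | succ k ih =>
      intro i hi hn j
      have h1 := h (i + 1) j (by push_cast; linarith)
      rw [sub_mul, coeff_sub, coeff_sub, coeff_C_mul, coeff_X_mul] at h1
      have h2 : ((X * p).coeff j).coeff (i + 1) = 0 := by
        cases j with
        | zero => simp
        | succ j => rw [coeff_X_mul]; exact ih (i + 1) (by omega) (by push_cast; linarith) j
      rw [h2, zero_sub, neg_eq_zero] at h1
      exact h1
  intro i j hij
  exact key B i (by omega) (by linarith) j

lemma Wt01_of_sub {n : ℤ} {p : P2 K} (h : Wt 0 1 n ((X - C X) * p)) : Wt 0 1 (n - 1) p := by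
  obtain ⟨B, hB⟩ : ∃ B : ℕ, ∀ j : ℕ, B ≤ j → p.coeff j = 0 :=
    ⟨p.natDegree + 1, fun j hj => coeff_eq_zero_of_natDegree_lt (by omega)⟩
  have key : ∀ k j : ℕ, B ≤ j + k → n - 1 < j → p.coeff j = 0 := by
    intro k
    induction k with
    | zero => intro i hi _; exact hB i hi
    | succ k ih =>
      intro j hi hn
      have h3 := ih (j + 1) (by omega) (by push_cast; linarith)
      ext i
      have h1 := h i (j + 1) (by push_cast; linarith)
      rw [sub_mul, coeff_sub, coeff_sub, coeff_C_mul, coeff_X_mul, h3] at h1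
      simpa using h1
  intro i j hij
  rw [key B j (by omega) (by linarith)]; simp

lemma Wt10_of_sub_pow {n : ℤ} (d : ℕ) {p : P2 K} (h : Wt 1 0 n ((X - C X) ^ d * p)) : Wt 1 0 (n - d) p := by
  induction d generalizing n with
  | zero => simpa using h
  | succ d ih =>
    rw [pow_succ', mul_assoc] at h
    exact (ih (Wt10_of_sub h)).mono (by push_cast; linarith)

lemma Wt01_of_sub_pow {n : ℤ} (d : ℕ) {p : P2 K} (h : Wt 0 1 n ((X - C X) ^ d * p)) : Wt 0 1 (n - d) p := by
  induction d generalizing n with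
  | zero => simpa using h
  | succ d ih =>
    rw [pow_succ', mul_assoc] at h
    exact (ih (Wt01_of_sub h)).mono (by push_cast; linarith)
end

section norm
variable {K : Type*} [Field K] {u : Bool} (ν : SubNorm u K)

/-- coefficient norm on bivariate polynomials -/
def N2 : SubNorm u (P2 K) := (ν.poly 1).poly 1

lemma N2_coeff (p : P2 K) (i j : ℕ) : ν ((p.coeff j).coeff i) ≤ N2 ν p :=
  (ν.coeff_le_poly_one _ _).trans ((ν.poly 1).coeff_le_poly_one _ _)

lemma N2_z1 : N2 ν (C X) ≤ 1 := ((ν.poly 1).poly_C _ _).trans (ν.poly_X 1)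
lemma N2_z2 : N2 ν X ≤ 1 := (ν.poly 1).poly_X 1
lemma N2_const (c : K) : N2 ν (C (C c)) ≤ ν c := ((ν.poly 1).poly_C _ _).trans (ν.poly_C 1 _)

lemma N2_tau {n : ℕ} {p : P2 K} (hp : p.natDegree ≤ n) {s : K[X]} (hs : ν.poly 1 s ≤ 1) :
    N2 ν (tau s p) ≤ ecst u 2 ^ n * N2 ν p := by
  have h1 : N2 ν (X + C s) ≤ ecst u 2 := by
    refine ((N2 ν).add' _ _).trans ?_
    refine (oadd_le (u := u) (N2_z2 ν) (c := 1) (((ν.poly 1).poly_C 1 s).trans hs)).trans ?_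
    simp
  refine ((N2 ν).eval₂_le C (X + C s) p).trans ?_
  refine le_trans (SubNorm.poly_mono (ν' := ν.poly 1) (fun a => (ν.poly 1).poly_C 1 a) _ _) ?_
  exact (ν.poly 1).poly_radius h1 (one_le_ecst (by norm_num)) p hp

lemma poly_X_neg : ν.poly 1 (-X) ≤ 1 := by
  rw [SubNorm.neg']; exact ν.poly_X 1

lemma N2_Xpow_mul (c : ℕ) (p : P2 K) : N2 ν p ≤ N2 ν (X ^ c * p) := by
  unfold N2
  rw [SubNorm.poly_apply, SubNorm.poly_apply]
  refine le_trans ?_ (osum_inj (e := fun k => k + c) (fun a b h => by simpa using h) _)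
  refine osum_mono fun k => ?_
  rw [coeff_X_pow_mul]; simp

/-- division by `(z2 - z1)^c` -/
lemma N2_div (c n : ℕ) (p : P2 K) (h : ((X - C X : P2 K) ^ c * p).natDegree ≤ n) :
    N2 ν p ≤ ecst u 4 ^ n * N2 ν ((X - C X : P2 K) ^ c * p) := by
  have hp : p.natDegree ≤ n := by
    refine le_trans ?_ h
    by_cases hp0 : p = 0
    · simp [hp0]
    rw [((monic_X_sub_C _).pow c).natDegree_mul' hp0]
    omega
  have h1 : N2 ν p ≤ ecst u 2 ^ n * N2 ν (tau X p) := by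
    conv_lhs => rw [← tau_tau X p]
    exact N2_tau ν ((natDegree_tau_le _ _).trans hp) (poly_X_neg ν)
  have h2 : N2 ν (tau X p) ≤ ecst u 2 ^ n * N2 ν ((X - C X : P2 K) ^ c * p) := by
    refine (N2_Xpow_mul ν c _).trans ?_
    rw [← tau_sub]
    exact N2_tau ν h (ν.poly_X 1)
  refine h1.trans ((mul_le_mul' le_rfl h2).trans ?_)
  rw [← mul_assoc, ← mul_pow, ← ecst_mul]
  norm_num
end norm
end
end Mord

set_option linter.unusedSectionVars false
set_option linter.style.longLine false

namespace Mord
open scoped ENNReal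
open Polynomial

noncomputable section

abbrev Q4 (K : Type*) [Field K] := Fin 4 → P2 K

section
variable {K : Type*} [Field K] (F : K[X])

abbrev F1 : P2 K := C F
abbrev F2 : P2 K := F.map C

lemma F1_Wt {F : K[X]} (hF : F.natDegree ≤ 6) {a b : ℤ} (ha : 0 ≤ a) : Wt a b (6 * a) (F1 F) := by
  intro i j hij
  rw [coeff_C]
  split_ifs with h
  · subst h
    apply coeff_eq_zero_of_natDegree_lt
    by_contra hcon
    have : (i : ℤ) ≤ 6 := by omega
    simp at hij
    nlinarith
  · simp

lemma F2_Wt {F : K[X]} (hF : F.natDegree ≤ 6) {a b : ℤ} (hb : 0 ≤ b) : Wt a b (6 * b) (F2 F) := by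
  intro i j hij
  rw [coeff_map, coeff_C]
  split_ifs with h
  · subst h
    apply coeff_eq_zero_of_natDegree_lt
    by_contra hcon
    have : (j : ℤ) ≤ 6 := by omega
    simp at hij
    nlinarith
  · simp

lemma F2_sub_F1 : ∃ Φ : P2 K, F2 F - F1 F = (X - C X) * Φ := by
  have : (X - C X : P2 K) ∣ F2 F - F1 F := by
    rw [dvd_iff_isRoot, IsRoot.def, eval_sub, eval_C]
    have : eval X (F2 F) = F := by
      rw [eval_map, ← algebraMap_eq, ← aeval_def, aeval_X_left_apply]
    rw [this, sub_self]
  exact this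

/-- multiplication by `y1 + y2` -/
def T : Q4 K →ₗ[P2 K] Q4 K where
  toFun G := ![G 1 * F1 F + G 2 * F2 F, G 0 + G 3 * F2 F, G 0 + G 3 * F1 F, G 1 + G 2]
  map_add' G H := by
    ext i : 1
    fin_cases i <;> simp <;> ring
  map_smul' c G := by
    ext i : 1
    fin_cases i <;> simp <;> ring

/-- multiplication by `y1` -/
def Y1 : Q4 K →ₗ[P2 K] Q4 K where
  toFun G := ![G 1 * F1 F, G 0, G 3 * F1 F, G 2]
  map_add' G H := by
    ext i : 1
    fin_cases i <;> simp <;> ring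
  map_smul' c G := by
    ext i : 1
    fin_cases i <;> simp <;> ring

/-- multiplication by `y1 z2^3 + y2 z1^3` -/
def T' : Q4 K →ₗ[P2 K] Q4 K := ((C X : P2 K) ^ 3) • T F + ((X : P2 K) ^ 3 - (C X) ^ 3) • Y1 F

lemma T'_def (G : Q4 K) : T' F G = ((C X : P2 K) ^ 3) • T F G + ((X : P2 K) ^ 3 - (C X) ^ 3) • Y1 F G := rfl

lemma T_Y1 (G : Q4 K) : T F (Y1 F G) = Y1 F (T F G) := by
  ext i : 1
  fin_cases i <;> simp [T, Y1] <;> ring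

lemma T_T' (G : Q4 K) : T F (T' F G) = T' F (T F G) := by
  simp [T', T_Y1]

lemma Y1_T' (G : Q4 K) : Y1 F (T' F G) = T' F (Y1 F G) := by
  simp [T', T_Y1]

def QW (a b n : ℤ) (G : Q4 K) : Prop :=
  Wt a b n (G 0) ∧ Wt a b (n - 3 * a) (G 1) ∧ Wt a b (n - 3 * b) (G 2) ∧ Wt a b (n - 3 * a - 3 * b) (G 3)

lemma QW_mono {a b n m : ℤ} {G : Q4 K} (h : QW a b n G) (hm : n ≤ m) : QW a b m G :=
  ⟨h.1.mono hm, h.2.1.mono (by linarith), h.2.2.1.mono (by linarith), h.2.2.2.mono (by linarith)⟩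

variable {F} (hF : F.natDegree ≤ 6)
include hF

lemma QW_T {a b n : ℤ} (ha : 0 ≤ a) (hb : 0 ≤ b) (ha' : a ≤ 1) (hb' : b ≤ 1) {G : Q4 K}
    (h : QW a b n G) : QW a b (n + 3) (T F G) := by
  obtain ⟨h0, h1, h2, h3⟩ := h
  have hF1 := F1_Wt hF (b := b) ha
  have hF2 := F2_Wt hF (a := a) hb
  refine ⟨?_, ?_, ?_, ?_⟩
  · exact ((h1.mul hF1).mono (by linarith)).add ((h2.mul hF2).mono (by linarith))
  · exact ((h0).mono (by linarith)).add ((h3.mul hF2).mono (by linarith))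
  · exact ((h0).mono (by linarith)).add ((h3.mul hF1).mono (by linarith))
  · exact ((h1).mono (by linarith)).add ((h2).mono (by linarith))

lemma QW_Tpow {a b n : ℤ} (ha : 0 ≤ a) (hb : 0 ≤ b) (ha' : a ≤ 1) (hb' : b ≤ 1) {G : Q4 K}
    (h : QW a b n G) (k : ℕ) : QW a b (n + 3 * k) ((T F ^ k) G) := by
  induction k with
  | zero => simpa using h
  | succ k ih =>
    rw [pow_succ', Module.End.mul_apply]
    exact QW_mono (QW_T hF ha hb ha' hb' ih) (by push_cast; linarith)

omit hF in
lemma T'_apply (G : Q4 K) : T' F G = ![G 1 * F1 F * X ^ 3 + G 2 * F2 F * C X ^ 3,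
    G 0 * X ^ 3 + G 3 * F2 F * C X ^ 3, G 0 * C X ^ 3 + G 3 * F1 F * X ^ 3, G 1 * C X ^ 3 + G 2 * X ^ 3] := by
  ext i : 1
  fin_cases i <;> simp [T', T, Y1] <;> ring

lemma QW_T' {a b n : ℤ} (ha : 0 ≤ a) (hb : 0 ≤ b) {G : Q4 K}
    (h : QW a b n G) : QW a b (n + 3 * (a + b)) (T' F G) := by
  obtain ⟨h0, h1, h2, h3⟩ := h
  have hF1 := F1_Wt hF (b := b) ha
  have hF2 := F2_Wt hF (a := a) hb
  have hX1 := (Wt.z1 (K := K) (a := a) (b := b)).pow 3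
  have hX2 := (Wt.z2 (K := K) (a := a) (b := b)).pow 3
  rw [T'_apply]
  refine ⟨?_, ?_, ?_, ?_⟩
  · exact (((h1.mul hF1).mul hX2).mono (by push_cast; linarith)).add (((h2.mul hF2).mul hX1).mono (by push_cast; linarith))
  · exact ((h0.mul hX2).mono (by push_cast; linarith)).add (((h3.mul hF2).mul hX1).mono (by push_cast; linarith))
  · exact ((h0.mul hX1).mono (by push_cast; linarith)).add (((h3.mul hF1).mul hX2).mono (by push_cast; linarith))
  · exact ((h1.mul hX1).mono (by push_cast; linarith)).add ((h2.mul hX2).mono (by push_cast; linarith))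

lemma QW_T'pow {a b n : ℤ} (ha : 0 ≤ a) (hb : 0 ≤ b) {G : Q4 K}
    (h : QW a b n G) (k : ℕ) : QW a b (n + 3 * (a + b) * k) ((T' F ^ k) G) := by
  induction k with
  | zero => simpa using h
  | succ k ih =>
    rw [pow_succ', Module.End.mul_apply]
    exact QW_mono (QW_T' hF ha hb ih) (by push_cast; linarith)
omit hF

/-- divisibility by `(z2-z1)^k` -/
def Dv (k : ℕ) (G : Q4 K) : Prop := ∃ H : Q4 K, G = ((X - C X : P2 K) ^ k) • H

lemma Dv_step (k : ℕ) (G : Q4 K) (h : Dv k G)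
    (h0 : (tau X (G 0 + G 3 * F1 F)).coeff k = 0) (h1 : (tau X (G 1 + G 2)).coeff k = 0) :
    Dv (k + 1) (T F G) := by
  obtain ⟨H, rfl⟩ := h
  obtain ⟨Φ, hΦ⟩ := F2_sub_F1 F
  have key : ∀ p : P2 K, (tau X ((X - C X) ^ k * p)).coeff k = 0 → (X - C X : P2 K) ∣ p := by
    intro p hp
    rw [tau_sub, coeff_X_pow_mul'] at hp
    have := dvd_iff_tau 1 p
    rw [pow_one, pow_one] at this
    rw [this, X_dvd_iff]
    simpa using hp
  obtain ⟨q0, hq0⟩ := key (H 0 + H 3 * F1 F) (by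
    rw [← h0]; congr 2; simp; ring)
  obtain ⟨q1, hq1⟩ := key (H 1 + H 2) (by
    rw [← h1]; congr 2; simp; ring)
  refine ⟨![q1 * F1 F + H 2 * Φ, q0 + H 3 * Φ, q0, q1], ?_⟩
  rw [map_smul, pow_succ, mul_smul]
  congr 1
  have hF2 : F2 F = F1 F + (X - C X) * Φ := by rw [← hΦ]; ring
  ext i : 1
  fin_cases i
  · simp only [T, LinearMap.coe_mk, AddHom.coe_mk, Fin.zero_eta, Matrix.cons_val_zero, Pi.smul_apply, smul_eq_mul]
    rw [hF2]; linear_combination (F1 F) * hq1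
  · simp only [T, LinearMap.coe_mk, AddHom.coe_mk, Fin.mk_one, Matrix.cons_val_one, Matrix.cons_val_zero, Pi.smul_apply, smul_eq_mul]
    rw [hF2]; linear_combination hq0
  · simpa [T] using hq0
  · simpa [T] using hq1

lemma Dv_T' (d : ℕ) (G : Q4 K) (h : ∀ k ≤ d, Dv k ((T F ^ k) G)) :
    ∀ i j : ℕ, i + j ≤ d → Dv (i + j) ((T' F ^ i) ((T F ^ j) G)) := by
  intro i
  induction i with
  | zero => intro j hj; simpa using h j (by omega)
  | succ i ih =>
    intro j hj
    obtain ⟨A, hA⟩ := ih (j + 1) (by omega)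
    obtain ⟨B, hB⟩ := ih j (by omega)
    have hTT : ∀ (n : ℕ) (H : Q4 K), T F ((T' F ^ n) H) = (T' F ^ n) (T F H) := by
      intro n H
      have : Commute (T F) (T' F ^ n) := Commute.pow_right (LinearMap.ext fun H => T_T' F H) n
      exact congrArg (fun f : Q4 K →ₗ[P2 K] Q4 K => f H) this.eq
    refine ⟨(C X : P2 K) ^ 3 • A + (X ^ 2 + X * C X + C X ^ 2 : P2 K) • Y1 F B, ?_⟩
    have h1 : (T' F ^ (i + 1)) ((T F ^ j) G) = (C X : P2 K) ^ 3 • (T' F ^ i) ((T F ^ (j + 1)) G)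
        + ((X : P2 K) ^ 3 - C X ^ 3) • Y1 F ((T' F ^ i) ((T F ^ j) G)) := by
      rw [pow_succ', Module.End.mul_apply]
      rw [T'_def, hTT, pow_succ' (T F) j, Module.End.mul_apply]
    rw [h1, hA, hB, map_smul]
    rw [smul_add, smul_smul, smul_smul, smul_smul, smul_smul]
    congr 2
    · ring
    · ring
end

section norm
variable {K : Type*} [Field K] {F : K[X]} {u : Bool} (ν : SubNorm u K)

def QN (G : Q4 K) : ℝ≥0∞ := ⨆ i, N2 ν (G i)
lemma le_QN (G : Q4 K) (i : Fin 4) : N2 ν (G i) ≤ QN ν G := le_iSup (fun i => N2 ν (G i)) i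

variable {CF : ℝ≥0∞} (hC : 1 ≤ CF) (hF : ν.poly 1 F ≤ ecst u CF)
include hC hF

lemma N2_F1 : N2 ν (F1 F) ≤ ecst u CF := ((ν.poly 1).poly_C 1 F).trans hF
lemma N2_F2 : N2 ν (F2 F) ≤ ecst u CF := by
  refine le_trans ?_ hF
  unfold N2
  rw [SubNorm.poly_apply, SubNorm.poly_apply]
  refine osum_mono fun k => ?_
  rw [coeff_map]
  exact mul_le_mul' (ν.poly_C 1 _) le_rfl

omit hF in
lemma QN_aux {p q r s : P2 K} {B : ℝ≥0∞} (hp : N2 ν p ≤ B) (hr : N2 ν r ≤ B) (hq : N2 ν q ≤ ecst u CF)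
    (hs : N2 ν s ≤ ecst u CF) : N2 ν (p * q + r * s) ≤ ecst u (2 * CF) * B := by
  refine ((N2 ν).add' _ _).trans ?_
  rw [ecst_mul, mul_assoc]
  apply oadd_le
  · refine ((N2 ν).mul' _ _).trans ?_
    rw [mul_comm]; exact mul_le_mul' hq hp
  · refine ((N2 ν).mul' _ _).trans ?_
    rw [mul_comm]; exact mul_le_mul' hs hr

lemma QN_T (G : Q4 K) : QN ν (T F G) ≤ ecst u (2 * CF) * QN ν G := by
  have h1 : N2 ν 1 ≤ ecst u CF := ((N2 ν).one').trans (one_le_ecst hC)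
  refine iSup_le fun i => ?_
  have a := fun i => le_QN ν G i
  have f1 := N2_F1 ν hC hF
  have f2 := N2_F2 ν hC hF
  fin_cases i
  · exact QN_aux ν hC (a 1) (a 2) f1 f2
  · simpa [T] using QN_aux ν hC (a 0) (a 3) h1 f2
  · simpa [T] using QN_aux ν hC (a 0) (a 3) h1 f1
  · simpa [T] using QN_aux ν hC (a 1) (a 2) h1 h1

lemma QN_T' (G : Q4 K) : QN ν (T' F G) ≤ ecst u (2 * CF) * QN ν G := by
  have z13 : N2 ν (C X ^ 3) ≤ 1 := ((N2 ν).pow_le _ _).trans (pow_le_one' (N2_z1 ν) 3)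
  have z23 : N2 ν (X ^ 3) ≤ 1 := ((N2 ν).pow_le _ _).trans (pow_le_one' (N2_z2 ν) 3)
  have h1 := z13.trans (one_le_ecst (u := u) hC)
  have h2 := z23.trans (one_le_ecst (u := u) hC)
  have f1 := N2_F1 ν hC hF
  have f2 := N2_F2 ν hC hF
  have h3 : ∀ {p q : P2 K}, N2 ν p ≤ ecst u CF → N2 ν q ≤ 1 → N2 ν (p * q) ≤ ecst u CF := by
    intro p q hp hq
    refine ((N2 ν).mul' _ _).trans ?_
    simpa using mul_le_mul' hp hq
  refine iSup_le fun i => ?_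
  have a := fun i => le_QN ν G i
  rw [T'_apply]
  fin_cases i
  · simpa [mul_assoc] using QN_aux ν hC (a 1) (a 2) (h3 f1 z23) (h3 f2 z13)
  · simpa [mul_assoc] using QN_aux ν hC (a 0) (a 3) h2 (h3 f2 z13)
  · simpa [mul_assoc] using QN_aux ν hC (a 0) (a 3) h1 (h3 f1 z23)
  · simpa [mul_assoc] using QN_aux ν hC (a 1) (a 2) h1 h2

lemma QN_Tpow (G : Q4 K) (k : ℕ) : QN ν ((T F ^ k) G) ≤ ecst u (2 * CF) ^ k * QN ν G := by
  induction k with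
  | zero => simp
  | succ k ih =>
    rw [pow_succ', Module.End.mul_apply, pow_succ', mul_assoc]
    exact (QN_T ν hC hF _).trans (mul_le_mul' le_rfl ih)

lemma QN_T'pow (G : Q4 K) (k : ℕ) : QN ν ((T' F ^ k) G) ≤ ecst u (2 * CF) ^ k * QN ν G := by
  induction k with
  | zero => simp
  | succ k ih =>
    rw [pow_succ', Module.End.mul_apply, pow_succ', mul_assoc]
    exact (QN_T' ν hC hF _).trans (mul_le_mul' le_rfl ih)
end norm
end
end Mord

set_option linter.unusedSectionVars false
set_option linter.style.longLine false

namespace Mord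
open scoped ENNReal
open Polynomial

noncomputable section

section
variable {K : Type*} [Field K] (F : K[X])

def Lf (r : Fin 4) (k n : ℕ) (G : Q4 K) : K := ((tau X ((T F ^ (k+1)) G r)).coeff k).coeff n

lemma Lf_sum {β : Type} [Fintype β] (r : Fin 4) (k n : ℕ) (ξ : β → K) (e : β → Q4 K) :
    Lf F r k n (∑ b, (C (C (ξ b)) : P2 K) • e b) = ∑ b, Lf F r k n (e b) * ξ b := by
  unfold Lf
  rw [map_sum, Finset.sum_apply, map_sum, finsetSum_coeff, finsetSum_coeff]
  refine Finset.sum_congr rfl fun b _ => ?_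
  rw [map_smul, Pi.smul_apply, smul_eq_mul, map_mul, tau_C, coeff_C_mul, coeff_C_mul, mul_comm]

abbrev n1 (m1 : ℕ) : Fin 4 → ℕ := ![m1+1, m1-2, m1+1, m1-2]
abbrev n2 (m2 : ℕ) : Fin 4 → ℕ := ![m2+1, m2+1, m2-2, m2-2]
abbrev Bt (m1 m2 : ℕ) : Type := Σ e : Fin 4, Fin (n1 m1 e) × Fin (n2 m2 e)
abbrev At (M d : ℕ) : Type := Σ k : Fin d, (Fin (M + 2 * k + 1) ⊕ Fin (M + 2 * k - 2))

lemma card_Bt {m1 m2 : ℕ} (h1 : 2 ≤ m1) (h2 : 2 ≤ m2) :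
    Fintype.card (Bt m1 m2) = (2 * m1 - 1) * (2 * m2 - 1) := by
  obtain ⟨a, rfl⟩ := Nat.exists_eq_add_of_le h1
  obtain ⟨b, rfl⟩ := Nat.exists_eq_add_of_le h2
  rw [Fintype.card_sigma, Fin.sum_univ_four]
  simp only [n1, n2, Fintype.card_prod, Fintype.card_fin]
  have e1 : 2 * (2 + a) - 1 = 2 * a + 3 := by omega
  have e2 : 2 * (2 + b) - 1 = 2 * b + 3 := by omega
  have e3 : 2 + a - 2 = a := by omega
  have e4 : 2 + b - 2 = b := by omega
  simp [e1, e2, e3, e4]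
  ring

lemma card_At {M d : ℕ} (h : 2 ≤ M) : Fintype.card (At M d) + 3 * d = 2 * d * M + 2 * d ^ 2 := by
  rw [Fintype.card_sigma]
  simp only [Fintype.card_sum, Fintype.card_fin]
  rw [Fin.sum_univ_eq_sum_range (fun k => (M + 2 * k + 1) + (M + 2 * k - 2))]
  induction d with
  | zero => simp
  | succ d ih =>
    rw [Finset.sum_range_succ]
    obtain ⟨a, rfl⟩ := Nat.exists_eq_add_of_le h
    have : 2 + a + 2 * d - 2 = a + 2 * d := by omega
    rw [this]
    ring_nf at ih ⊢
    omega

def mon {m1 m2 : ℕ} (b : Bt m1 m2) : Q4 K := Pi.single b.1 ((C X : P2 K) ^ (b.2.1 : ℕ) * X ^ (b.2.2 : ℕ))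

lemma coeff_mon (c : K) (i j i' j' : ℕ) : ((C (C c) * ((C X : P2 K) ^ i * X ^ j)).coeff j').coeff i' =
    if i = i' ∧ j = j' then c else 0 := by
  rw [coeff_C_mul, coeff_C_mul, ← C_pow, coeff_C_mul, coeff_X_pow]
  by_cases hj : j = j'
  · subst hj; simp [coeff_X_pow, eq_comm]
  · have : ¬ j' = j := fun h => hj h.symm
    simp [hj, this]

lemma coeff_G {m1 m2 : ℕ} (ξ : Bt m1 m2 → K) (b : Bt m1 m2) :
    (((∑ b, (C (C (ξ b)) : P2 K) • (mon b : Q4 K)) b.1).coeff b.2.2).coeff b.2.1 = ξ b := by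
  rw [Finset.sum_apply, finsetSum_coeff, finsetSum_coeff, Finset.sum_eq_single b]
  · rw [Pi.smul_apply, mon, Pi.single_eq_same, smul_eq_mul, coeff_mon]; simp
  · rintro ⟨e', i', j'⟩ _ hne
    obtain ⟨e, i, j⟩ := b
    rw [Pi.smul_apply, mon, smul_eq_mul]
    by_cases he : e' = e
    · subst he
      rw [Pi.single_eq_same, coeff_mon]
      simp only
      rw [if_neg]
      rintro ⟨h1, h2⟩
      exact hne (by rw [Fin.ext h1, Fin.ext h2])
    · simp only
      rw [Pi.single_eq_of_ne (fun h => he h.symm)]; simp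
  · simp

lemma QW_zero (a b n : ℤ) : QW a b n (0 : Q4 K) := ⟨Wt.zero, Wt.zero, Wt.zero, Wt.zero⟩
lemma QW_add {a b n : ℤ} {G H : Q4 K} (h : QW a b n G) (h' : QW a b n H) : QW a b n (G + H) :=
  ⟨h.1.add h'.1, h.2.1.add h'.2.1, h.2.2.1.add h'.2.2.1, h.2.2.2.add h'.2.2.2⟩
lemma QW_sum {a b n : ℤ} {β : Type} (s : Finset β) (ξ : β → K) (e : β → Q4 K)
    (h : ∀ x, QW a b n (e x)) : QW a b n (∑ x ∈ s, (C (C (ξ x)) : P2 K) • e x) := by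
  classical
  induction s using Finset.induction_on with
  | empty => simpa using QW_zero a b n
  | insert x s hx ih =>
    rw [Finset.sum_insert hx]
    refine QW_add ?_ ih
    have := h x
    exact ⟨this.1.cmul _, this.2.1.cmul _, this.2.2.1.cmul _, this.2.2.2.cmul _⟩

lemma QW_mon (m1 m2 : ℕ) (a c : ℤ) (ha : 0 ≤ a) (hc : 0 ≤ c) (b : Bt m1 m2) :
    QW a c (a * m1 + c * m2) (mon b : Q4 K) := by
  obtain ⟨e, i, j⟩ := b
  have key := Wt_monomial (K := K) i j a c
  have hi := i.2
  have hj := j.2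
  unfold mon QW
  have up : ∀ (x y : ℤ), (i : ℤ) ≤ x → (j : ℤ) ≤ y → a * i + c * j ≤ a * x + c * y := by
    intro x y hx hy
    nlinarith
  fin_cases e
  all_goals
    simp only [n1, n2] at hi hj
    simp at hi hj
    refine ⟨?_, ?_, ?_, ?_⟩ <;> simp <;> try exact Wt.zero
  · exact key.mono (up _ _ (by omega) (by omega))
  · exact key.mono ((up (m1 - 3) m2 (by omega) (by omega)).trans (by linarith))
  · exact key.mono ((up m1 (m2 - 3) (by omega) (by omega)).trans (by linarith))
  · exact key.mono ((up (m1 - 3) (m2 - 3) (by omega) (by omega)).trans (by linarith))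

lemma Dv_of_Lf (hF : F.natDegree ≤ 6) {m1 m2 d : ℕ} {G : Q4 K} (hW : QW 1 1 (m1 + m2) G)
    (h2 : ∀ (k : Fin d) (n : Fin (m1 + m2 + 2 * k + 1)), Lf F 2 k n G = 0)
    (h3 : ∀ (k : Fin d) (n : Fin (m1 + m2 + 2 * k - 2)), Lf F 3 k n G = 0) :
    ∀ k ≤ d, Dv k ((T F ^ k) G) := by
  intro k
  induction k with
  | zero => intro _; exact ⟨G, by simp⟩
  | succ k ih =>
    intro hk
    have := QW_Tpow hF (by norm_num) (by norm_num) le_rfl le_rfl hW (k + 1)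
    obtain ⟨_, _, w2, w3⟩ := this
    have t2 := tau_Wt w2 1
    have t3 := tau_Wt w3 1
    rw [C_1, one_mul] at t2 t3
    have e2 : (tau X ((T F ^ (k+1)) G 2)).coeff k = 0 := by
      ext n
      by_cases hn : n < m1 + m2 + 2 * k + 1
      · exact h2 ⟨k, hk⟩ ⟨n, hn⟩
      · exact t2 n k (by push_cast; omega)
    have e3 : (tau X ((T F ^ (k+1)) G 3)).coeff k = 0 := by
      ext n
      by_cases hn : n < m1 + m2 + 2 * k - 2
      · exact h3 ⟨k, hk⟩ ⟨n, hn⟩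
      · exact t3 n k (by push_cast; omega)
    rw [pow_succ', Module.End.mul_apply] at e2 e3 ⊢
    exact Dv_step k _ (ih (by omega)) e2 e3

end

section
variable {K : Type*} [Field K] [NumberField K] (F : K[X])

/-- uniform bound on the coefficients -/
def Bd (F : K[X]) (CF : ℕ) : Prop := 1 ≤ CF ∧ ∀ (u : Bool) (v : AbsoluteValue K ℝ) (h : Pl u v), (plN h).poly 1 F ≤ ecst u CF

lemma QN_mon {u : Bool} (ν : SubNorm u K) {m1 m2 : ℕ} (b : Bt m1 m2) : QN ν (mon b : Q4 K) ≤ 1 := by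
  refine iSup_le fun i => ?_
  unfold mon
  by_cases h : i = b.1
  · subst h
    rw [Pi.single_eq_same]
    refine ((N2 ν).mul' _ _).trans ?_
    exact mul_le_one' (((N2 ν).pow_le _ _).trans (pow_le_one' (N2_z1 ν) _))
      (((N2 ν).pow_le _ _).trans (pow_le_one' (N2_z2 ν) _))
  · rw [Pi.single_eq_of_ne h, SubNorm.zero']; simp

lemma Lf_le (hF : F.natDegree ≤ 6) {CF : ℕ} (hB : Bd F CF) {u : Bool} {v : AbsoluteValue K ℝ} (h : Pl u v)
    {m1 m2 d : ℕ} (b : Bt m1 m2) (r : Fin 4) (hr : 2 ≤ r) (k : Fin d) (n : ℕ) :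
    v (Lf F r k n (mon b)) ≤ cst u ((2 ^ (m2 + 3 * d) * (2 * CF) ^ d : ℕ) : ℝ) := by
  have hC : (1 : ℝ≥0∞) ≤ CF := by exact_mod_cast hB.1
  have hk := k.2
  have hW := QW_Tpow hF (le_refl (0:ℤ)) (by norm_num) (by norm_num) le_rfl (QW_mon (K := K) m1 m2 0 1 le_rfl (by norm_num) b) (k + 1)
  obtain ⟨_, _, w2, w3⟩ := hW
  have hdeg : ((T F ^ ((k:ℕ) + 1)) (mon b) r).natDegree ≤ m2 + 3 * d := by
    apply natDegree_of_Wt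
    have : r = 2 ∨ r = 3 := by revert hr; revert r; decide
    rcases this with rfl | rfl
    · exact w2.mono (by push_cast; omega)
    · exact w3.mono (by push_cast; omega)
  have h1 : plN h (Lf F r k n (mon b)) ≤ ecst u ((2 ^ (m2 + 3 * d) * (2 * CF) ^ d : ℕ)) := by
    unfold Lf
    refine (N2_coeff (plN h) _ _ _).trans ((N2_tau _ hdeg (SubNorm.poly_X _ 1)).trans ?_)
    push_cast
    rw [ecst_mul, ecst_pow, ecst_pow]
    refine mul_le_mul' le_rfl ?_
    refine (le_QN _ _ r).trans ((QN_Tpow _ hC (hB.2 u v h) _ _).trans ?_)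
    refine (mul_le_mul' le_rfl (QN_mon _ b)).trans ?_
    rw [mul_one]
    exact pow_le_pow_right' (one_le_ecst (by exact_mod_cast (show 1 ≤ 2 * CF by have := hB.1; omega))) (by omega)
  rw [plN_apply, ← ENNReal.ofReal_natCast, ecst_ofReal] at h1
  rwa [ENNReal.ofReal_le_ofReal_iff] at h1
  refine zero_le_one.trans (cst_one_le ?_)
  exact_mod_cast Nat.one_le_iff_ne_zero.2 (by have := hB.1; positivity)

theorem aux_exists (hF : F.natDegree ≤ 6) {CF : ℕ} (hB : Bd F CF) : ∃ c : ℝ, 1 ≤ c ∧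
    ∀ m1 m2 d p q : ℕ, 2 ≤ m1 → 2 ≤ m2 → p + 3 * d = 2 * d * (m1 + m2) + 2 * d ^ 2 →
    q = (2 * m1 - 1) * (2 * m2 - 1) → p < q → ∃ G : Q4 K, G ≠ 0 ∧ QW 1 0 m1 G ∧ QW 0 1 m2 G ∧
    (∀ k ≤ d, Dv k ((T F ^ k) G)) ∧ ∀ u v (h : Pl u v), QN (plN h) G ≤
      ecst u (ENNReal.ofReal (q * (c * (c * q * ((2 ^ (m2 + 3 * d) * (2 * CF) ^ d : ℕ) : ℝ)) ^ ((p : ℝ) / (q - p))))) := by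
  obtain ⟨c, hc, H⟩ := siegel K
  refine ⟨c, hc, ?_⟩
  intro m1 m2 d p q h1 h2 hp hq hpq
  have cA : Fintype.card (At (m1 + m2) d) = p := by
    have := card_At (M := m1 + m2) (d := d) (by omega); omega
  have cB : Fintype.card (Bt m1 m2) = q := by rw [card_Bt h1 h2, hq]
  obtain ⟨ξ, hξ, hz, hb⟩ := H (At (m1 + m2) d) (Bt m1 m2)
    (fun a b => Sum.elim (fun n => Lf F 2 a.1 (n : Fin _) (mon b)) (fun n => Lf F 3 a.1 (n : Fin _) (mon b)) a.2)
    ((2 ^ (m2 + 3 * d) * (2 * CF) ^ d : ℕ) : ℝ)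
    (by exact_mod_cast Nat.one_le_iff_ne_zero.2 (by have := hB.1; positivity))
    (by
      rintro u v h ⟨k, n | n⟩ b
      · exact Lf_le F hF hB h b 2 le_rfl k n
      · exact Lf_le F hF hB h b 3 (by decide) k n) (by rw [cA, cB]; exact hpq)
  rw [cA, cB] at hb
  refine ⟨∑ b, (C (C (ξ b)) : P2 K) • mon b, ?_, ?_, ?_, ?_, ?_⟩
  · intro h0
    apply hξ
    ext b
    rw [← coeff_G ξ b, h0]; simp
  · exact QW_sum _ _ _ fun b => by simpa using QW_mon (K := K) m1 m2 1 0 (by norm_num) le_rfl b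
  · exact QW_sum _ _ _ fun b => by simpa using QW_mon (K := K) m1 m2 0 1 le_rfl (by norm_num) b
  · refine Dv_of_Lf F hF (m1 := m1) (m2 := m2)
      (QW_sum _ _ _ fun b => by simpa using QW_mon (K := K) m1 m2 1 1 (by norm_num) (by norm_num) b) ?_ ?_
    · intro k n
      rw [Lf_sum]
      exact hz ⟨k, Sum.inl n⟩
    · intro k n
      rw [Lf_sum]
      exact hz ⟨k, Sum.inr n⟩
  · intro u v h
    refine iSup_le fun i => ?_
    rw [Finset.sum_apply]
    refine ((N2 (plN h)).sum_le_card _ _ (ecst u (ENNReal.ofReal ((c * (c * q * ((2 ^ (m2 + 3 * d) * (2 * CF) ^ d : ℕ) : ℝ)) ^ ((p : ℝ) / (q - p)))))) ?_).trans ?_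
    · intro b _
      rw [Pi.smul_apply, smul_eq_mul]
      refine ((N2 (plN h)).mul' _ _).trans ?_
      refine (mul_le_mul' (N2_const _ _) ((le_QN _ _ i).trans (QN_mon _ b))).trans ?_
      rw [mul_one, plN_apply, ecst_ofReal]
      exact ENNReal.ofReal_le_ofReal (hb u v h b)
    · rw [Finset.card_univ, cB, ENNReal.ofReal_mul (p := (q : ℝ)) (by positivity), ecst_mul u (ENNReal.ofReal q), ENNReal.ofReal_natCast]
end
end
end Mord

set_option linter.unusedSectionVars false
set_option linter.style.longLine false

namespace Mord
open scoped ENNReal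
open Polynomial

noncomputable section

section
variable {K : Type*} [Field K] (F : K[X])

def na (G : Q4 K) : P2 K := G 0 ^ 2 + G 1 ^ 2 * F1 F - F2 F * (G 2 ^ 2 + G 3 ^ 2 * F1 F)
def nb (G : Q4 K) : P2 K := 2 * (G 0 * G 1 - F2 F * (G 2 * G 3))
def Nm (G : Q4 K) : P2 K := na F G ^ 2 - F1 F * nb F G ^ 2

lemma Nm_T (G : Q4 K) : Nm F (T F G) = Nm F G * (F2 F - F1 F) ^ 2 := by
  simp [Nm, na, nb, T]; ring

lemma Nm_smul (c : P2 K) (G : Q4 K) : Nm F (c • G) = c ^ 4 * Nm F G := by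
  simp [Nm, na, nb]; ring

lemma Nm_Tpow (k : ℕ) (G : Q4 K) : Nm F ((T F ^ k) G) = Nm F G * (F2 F - F1 F) ^ (2 * k) := by
  induction k with
  | zero => simp
  | succ k ih => rw [pow_succ', Module.End.mul_apply, Nm_T, ih]; ring

lemma sq_F1_eq {F F' : K[X]} {r : K} (h : F = (X - C r) * F') (hr : F'.eval r ≠ 0) {a b : P2 K}
    (hab : a ^ 2 = F1 F * b ^ 2) : a = 0 ∧ b = 0 := by
  have hF' : F' ≠ 0 := by rintro rfl; simp at hr
  have hF : F ≠ 0 := by rw [h]; exact mul_ne_zero (X_sub_C_ne_zero r) hF'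
  by_cases hb : b = 0
  · subst hb; simp at hab; exact ⟨hab, rfl⟩
  exfalso
  have ha : a ≠ 0 := by rintro rfl; simp at hab; tauto
  have hl := congrArg leadingCoeff hab
  rw [leadingCoeff_mul, leadingCoeff_pow, leadingCoeff_pow, leadingCoeff_C] at hl
  have hm := congrArg (rootMultiplicity r) hl
  have hla := leadingCoeff_ne_zero.2 ha
  have hlb := leadingCoeff_ne_zero.2 hb
  have e : rootMultiplicity r F = 1 := by
    rw [h, rootMultiplicity_mul (by rwa [← h]), rootMultiplicity_X_sub_C_self,
      rootMultiplicity_eq_zero (by exact hr)]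
  rw [pow_two, pow_two, rootMultiplicity_mul (mul_ne_zero hla hla), rootMultiplicity_mul (mul_ne_zero hF (mul_ne_zero hlb hlb)),
    rootMultiplicity_mul (mul_ne_zero hlb hlb), e] at hm
  omega

lemma Nm_ne_zero [CharZero K] {F F' : K[X]} {r : K} (h : F = (X - C r) * F') (hr : F'.eval r ≠ 0) {G : Q4 K}
    (hG : G ≠ 0) : Nm F G ≠ 0 := by
  intro h0
  obtain ⟨ha, hb⟩ := sq_F1_eq h hr (sub_eq_zero.1 h0)
  have hF' : F' ≠ 0 := by rintro rfl; simp at hr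
  have hF : F ≠ 0 := by rw [h]; exact mul_ne_zero (X_sub_C_ne_zero r) hF'
  have hb : G 0 * G 1 = F2 F * (G 2 * G 3) := by
    rw [nb, mul_eq_zero] at hb
    rcases hb with hb | hb
    · exact absurd hb two_ne_zero
    · exact sub_eq_zero.1 hb
  have ha : G 0 ^ 2 + G 1 ^ 2 * F1 F = F2 F * (G 2 ^ 2 + G 3 ^ 2 * F1 F) := sub_eq_zero.1 ha
  set π : P2 K := X - C (C r) with hπ
  have hp : Prime π := prime_X_sub_C _
  have hF2 : F2 F = π * F2 F' := by rw [F2, h]; simp [hπ, F2]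
  have hn : ¬ π ∣ F2 F' := by
    rw [hπ, dvd_iff_isRoot, IsRoot.def, F2, eval_map, eval₂_at_apply, C_eq_zero]; exact hr
  have hn1 : ¬ π ∣ F1 F := by
    rw [hπ, dvd_iff_isRoot, IsRoot.def, F1, eval_C]; exact hF
  have sm : ∀ x y : P2 K, π ∣ x * y → π ∣ x ^ 2 + y ^ 2 * F1 F → π ∣ x ∧ π ∣ y := by
    intro x y h1 h2
    rcases hp.dvd_or_dvd h1 with hx | hy
    · refine ⟨hx, ?_⟩
      have : π ∣ y ^ 2 * F1 F := (dvd_add_right (dvd_pow hx two_ne_zero)).1 h2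
      rcases hp.dvd_or_dvd this with h | h
      · exact hp.dvd_of_dvd_pow h
      · exact absurd h hn1
    · refine ⟨?_, hy⟩
      have : π ∣ x ^ 2 := (dvd_add_left ((dvd_pow hy two_ne_zero).mul_right _)).1 h2
      exact hp.dvd_of_dvd_pow this
  have key : ∀ n : ℕ, ∀ w x y z : P2 K, w * x = F2 F * (y * z) →
      w ^ 2 + x ^ 2 * F1 F = F2 F * (y ^ 2 + z ^ 2 * F1 F) →
      π ^ n ∣ w ∧ π ^ n ∣ x ∧ π ^ n ∣ y ∧ π ^ n ∣ z := by
    intro n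
    induction n with
    | zero => intros; simp
    | succ n ih =>
      intro w x y z h1 h2
      obtain ⟨⟨w', rfl⟩, ⟨x', rfl⟩⟩ := sm w x (by rw [h1, hF2, mul_assoc]; exact dvd_mul_right _ _)
        (by rw [h2, hF2, mul_assoc]; exact dvd_mul_right _ _)
      have e1 : π * (w' * x') = F2 F' * (y * z) := by
        apply mul_left_cancel₀ hp.ne_zero
        rw [hF2] at h1; linear_combination h1
      have e2 : π * (w' ^ 2 + x' ^ 2 * F1 F) = F2 F' * (y ^ 2 + z ^ 2 * F1 F) := by
        apply mul_left_cancel₀ hp.ne_zero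
        rw [hF2] at h2; linear_combination h2
      obtain ⟨⟨y', rfl⟩, ⟨z', rfl⟩⟩ := sm y z
        ((hp.dvd_or_dvd (Dvd.intro _ e1)).resolve_left hn)
        ((hp.dvd_or_dvd (Dvd.intro _ e2)).resolve_left hn)
      have f1 : w' * x' = F2 F * (y' * z') := by
        apply mul_left_cancel₀ hp.ne_zero
        rw [hF2]; linear_combination e1
      have f2 : w' ^ 2 + x' ^ 2 * F1 F = F2 F * (y' ^ 2 + z' ^ 2 * F1 F) := by
        apply mul_left_cancel₀ hp.ne_zero
        rw [hF2]; linear_combination e2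
      obtain ⟨k1, k2, k3, k4⟩ := ih _ _ _ _ f1 f2
      rw [pow_succ']
      exact ⟨mul_dvd_mul_left _ k1, mul_dvd_mul_left _ k2, mul_dvd_mul_left _ k3, mul_dvd_mul_left _ k4⟩
  have z : ∀ g : P2 K, (∀ n, π ^ n ∣ g) → g = 0 := by
    intro g hg
    by_contra hne
    have := natDegree_le_of_dvd (hg (g.natDegree + 1)) hne
    rw [natDegree_pow, hπ, natDegree_X_sub_C] at this
    omega
  apply hG
  have k := fun n => key n _ _ _ _ hb ha
  ext i : 1
  fin_cases i
  · exact z _ fun n => (k n).1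
  · exact z _ fun n => (k n).2.1
  · exact z _ fun n => (k n).2.2.1
  · exact z _ fun n => (k n).2.2.2

lemma eps_dvd_Nm [CharZero K] {F : K[X]} (hdeg : 0 < F.natDegree) {d : ℕ} {G : Q4 K} (h : Dv d ((T F ^ d) G)) :
    (X - C X : P2 K) ^ (2 * d) ∣ Nm F G := by
  obtain ⟨H, hH⟩ := h
  obtain ⟨Φ, hΦ⟩ := F2_sub_F1 F
  have hp : Prime (X - C X : P2 K) := prime_X_sub_C _
  have hn : ¬ (X - C X : P2 K) ∣ Φ := by
    intro hd
    rw [dvd_iff_isRoot, IsRoot.def] at hd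
    have h1 := congrArg (fun p => eval X (derivative p)) hΦ
    simp only [derivative_mul, derivative_sub, derivative_X, derivative_C, eval_add, eval_mul, eval_sub, eval_X, eval_C,
      sub_self, zero_mul, add_zero, hd, F2, F1, derivative_map, sub_zero, mul_zero] at h1
    rw [eval_map, ← algebraMap_eq, ← aeval_def, aeval_X_left_apply] at h1
    have := derivative_eq_zero.1 h1
    omega
  have h1 := Nm_Tpow F d G
  rw [hH, Nm_smul, hΦ] at h1
  have h2 : Nm F G * Φ ^ (2 * d) = (X - C X) ^ (2 * d) * Nm F H := by
    apply mul_left_cancel₀ (pow_ne_zero (2 * d) hp.ne_zero)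
    rw [mul_pow] at h1
    linear_combination -h1
  exact hp.pow_dvd_of_dvd_mul_right _ (fun h => hn (hp.dvd_of_dvd_pow h)) ⟨_, h2⟩

lemma Nm_Wt {F : K[X]} (hF : F.natDegree ≤ 6) {a b n : ℤ} (ha : 0 ≤ a) (hb : 0 ≤ b) {G : Q4 K} (h : QW a b n G) :
    Wt a b (4 * n) (Nm F G) := by
  obtain ⟨h0, h1, h2, h3⟩ := h
  have hF1 := F1_Wt hF (b := b) ha
  have hF2 := F2_Wt hF (a := a) hb
  have hna : Wt a b (2 * n) (na F G) := by
    refine Wt.sub (Wt.add ?_ ?_) ((hF2.mul (m := 2 * n - 6 * b) (Wt.add ?_ ?_)).mono (by linarith))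
    · exact (h0.pow 2).mono (by push_cast; linarith)
    · exact ((h1.pow 2).mul hF1).mono (by push_cast; linarith)
    · exact (h2.pow 2).mono (by push_cast; linarith)
    · exact ((h3.pow 2).mul hF1).mono (by push_cast; linarith)
  have hnb : Wt a b (2 * n - 3 * a) (nb F G) := by
    have : Wt a b (2 * n - 3 * a) (G 0 * G 1 - F2 F * (G 2 * G 3)) := by
      refine Wt.sub ?_ ?_
      · exact (h0.mul h1).mono (by linarith)
      · exact (hF2.mul (h2.mul h3)).mono (by linarith)
    unfold nb
    rw [two_mul (G 0 * G 1 - _)]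
    exact this.add this
  exact Wt.sub ((hna.pow 2).mono (by push_cast; linarith)) ((hF1.mul (hnb.pow 2)).mono (by push_cast; linarith))

end

section norm
variable {K : Type*} [Field K] {F : K[X]} {u : Bool} (ν : SubNorm u K)
variable {CF : ℝ≥0∞} (hC : 1 ≤ CF) (hF : ν.poly 1 F ≤ ecst u CF)
include hC hF

lemma Nm_norm (G : Q4 K) : N2 ν (Nm F G) ≤ ecst u (32 * CF ^ 5) * QN ν G ^ 4 := by
  set Q := QN ν G
  have a := fun i => le_QN ν G i
  have f1 := N2_F1 ν hC hF
  have f2 := N2_F2 ν hC hF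
  have mm : ∀ {x y : P2 K} {A B : ℝ≥0∞}, N2 ν x ≤ A → N2 ν y ≤ B → N2 ν (x * y) ≤ A * B :=
    fun hx hy => ((N2 ν).mul' _ _).trans (mul_le_mul' hx hy)
  have sq : ∀ i, N2 ν (G i ^ 2) ≤ Q ^ 2 := fun i => ((N2 ν).pow_le _ _).trans (by gcongr; exact a i)
  have e1 : ∀ {n m : ℕ}, n ≤ m → ecst u CF ^ n ≤ ecst u CF ^ m := fun h => pow_le_pow_right' (one_le_ecst hC) h
  have two : ∀ i j, N2 ν (G i ^ 2 + G j ^ 2 * F1 F) ≤ ecst u 2 * (ecst u CF * Q ^ 2) := by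
    intro i j
    refine ((N2 ν).add' _ _).trans (oadd_le ?_ ?_)
    · refine (sq i).trans ?_
      calc Q ^ 2 = 1 * Q ^ 2 := by rw [one_mul]
        _ ≤ _ := mul_le_mul' (one_le_ecst hC) le_rfl
    · rw [mul_comm]; exact mm f1 (sq j)
  have hna : N2 ν (na F G) ≤ ecst u 2 * (ecst u CF * (ecst u 2 * (ecst u CF * Q ^ 2))) := by
    refine ((N2 ν).sub_le _ _).trans (oadd_le ?_ ?_)
    · refine (two 0 1).trans ?_
      calc _ = 1 * (ecst u 2 * (ecst u CF * Q ^ 2)) := by rw [one_mul]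
        _ ≤ _ := mul_le_mul' (one_le_ecst hC) le_rfl
    · exact mm f2 (two 2 3)
  have hnb : N2 ν (nb F G) ≤ ecst u 2 * (ecst u 2 * (ecst u CF * Q ^ 2)) := by
    have : N2 ν (G 0 * G 1 - F2 F * (G 2 * G 3)) ≤ ecst u 2 * (ecst u CF * Q ^ 2) := by
      refine ((N2 ν).sub_le _ _).trans (oadd_le ?_ ?_)
      · refine (mm (a 0) (a 1)).trans ?_
        calc _ = 1 * Q ^ 2 := by rw [one_mul, pow_two]
          _ ≤ _ := mul_le_mul' (one_le_ecst hC) le_rfl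
      · rw [pow_two]; exact mm f2 (mm (a 2) (a 3))
    unfold nb
    rw [two_mul]
    exact ((N2 ν).add' _ _).trans (oadd_le this this)
  have : N2 ν (Nm F G) ≤ ecst u 2 * (ecst u 2 ^ 4 * ecst u CF ^ 5 * Q ^ 4) := by
    refine ((N2 ν).sub_le _ _).trans (oadd_le ?_ ?_)
    · refine ((N2 ν).pow_le _ _).trans ((pow_le_pow_left' hna 2).trans ?_)
      calc _ = ecst u 2 ^ 4 * ecst u CF ^ 4 * Q ^ 4 := by ring
        _ ≤ _ := by
          refine mul_le_mul' (mul_le_mul' le_rfl (e1 (by norm_num))) le_rfl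
    · refine (mm f1 (((N2 ν).pow_le _ _).trans (pow_le_pow_left' hnb 2))).trans ?_
      calc _ = ecst u 2 ^ 4 * ecst u CF ^ 3 * Q ^ 4 := by ring
        _ ≤ _ := by
          refine mul_le_mul' (mul_le_mul' le_rfl (e1 (by norm_num))) le_rfl
  refine this.trans (le_of_eq ?_)
  rw [show (32 : ℝ≥0∞) * CF ^ 5 = 2 ^ 5 * CF ^ 5 by norm_num, ecst_mul, ecst_pow, ecst_pow]
  ring

omit hC hF in
lemma QN_div {n d : ℕ} {G H : Q4 K} (hGH : G = (X - C X : P2 K) ^ d • H) (hW : QW 0 1 n G) :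
    QN ν H ≤ ecst u 4 ^ n * QN ν G := by
  refine iSup_le fun i => ?_
  have : G i = (X - C X) ^ d * H i := by rw [hGH]; rfl
  refine (N2_div ν d n (H i) ?_).trans ?_
  · rw [← this]
    apply natDegree_of_Wt
    obtain ⟨h0, h1, h2, h3⟩ := hW
    fin_cases i
    · exact h0
    · exact h1.mono (by norm_num)
    · exact h2.mono (by norm_num)
    · exact h3.mono (by norm_num)
  · rw [← this]; exact mul_le_mul' le_rfl (le_QN _ _ _)

omit hC hF in
lemma QW10_div {n : ℤ} {d : ℕ} {G H : Q4 K} (hGH : G = (X - C X : P2 K) ^ d • H) (hW : QW 1 0 n G) : QW 1 0 (n - d) H := by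
  subst hGH
  obtain ⟨h0, h1, h2, h3⟩ := hW
  exact ⟨Wt10_of_sub_pow d h0, (Wt10_of_sub_pow d h1).mono (by linarith), (Wt10_of_sub_pow d h2).mono (by linarith),
    (Wt10_of_sub_pow d h3).mono (by linarith)⟩
omit hC hF in
lemma QW01_div {n : ℤ} {d : ℕ} {G H : Q4 K} (hGH : G = (X - C X : P2 K) ^ d • H) (hW : QW 0 1 n G) : QW 0 1 (n - d) H := by
  subst hGH
  obtain ⟨h0, h1, h2, h3⟩ := hW
  exact ⟨Wt01_of_sub_pow d h0, (Wt01_of_sub_pow d h1).mono (by linarith), (Wt01_of_sub_pow d h2).mono (by linarith),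
    (Wt01_of_sub_pow d h3).mono (by linarith)⟩
end norm

section
variable {K : Type*} [Field K] [NumberField K] (F : K[X])

/-- auxiliary data with a uniform size `S` -/
structure Aux (m1 m2 d : ℕ) (S : ℝ) where
  G : Q4 K
  H : Q4 K
  J : Q4 K
  R : P2 K
  hH : (T F ^ d) G = (X - C X : P2 K) ^ d • H
  hJ : (T' F ^ d) G = (X - C X : P2 K) ^ d • J
  hR : Nm F G = (X - C X : P2 K) ^ (2 * d) * R
  R_ne : R ≠ 0
  G1 : QW 1 0 m1 G
  G2 : QW 0 1 m2 G
  H1 : QW 1 0 (m1 + 2 * d) H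
  H2 : QW 0 1 (m2 + 2 * d) H
  J1 : QW 1 0 (m1 + 2 * d) J
  J2 : QW 0 1 (m2 + 2 * d) J
  R1 : Wt 1 0 (4 * m1 - 2 * d) R
  R2 : Wt 0 1 (4 * m2 - 2 * d) R
  sG : ∀ u v (h : Pl u v), QN (plN h) G ≤ ecst u (ENNReal.ofReal S)
  sH : ∀ u v (h : Pl u v), QN (plN h) H ≤ ecst u (ENNReal.ofReal S)
  sJ : ∀ u v (h : Pl u v), QN (plN h) J ≤ ecst u (ENNReal.ofReal S)
  sR : ∀ u v (h : Pl u v), N2 (plN h) R ≤ ecst u (ENNReal.ofReal S)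

theorem aux_exists' {F F' : K[X]} {r : K} (hfac : F = (X - C r) * F') (hr : F'.eval r ≠ 0) (hF : F.natDegree ≤ 6) {CF : ℕ} (hB : Bd F CF) : ∃ c : ℝ, 1 ≤ c ∧
    ∀ (m1 m2 d p q : ℕ) (S : ℝ), 2 ≤ m1 → 2 ≤ m2 → p + 3 * d = 2 * d * (m1 + m2) + 2 * d ^ 2 →
    q = (2 * m1 - 1) * (2 * m2 - 1) → p < q →
    S = 32 * (4 * CF : ℝ) ^ (5 + 4 * m2 + 5 * d) * (q * (c * (c * q * (4 * CF : ℝ) ^ (m2 + 3 * d)) ^ ((p : ℝ) / (q - p)))) ^ 4 →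
    Nonempty (Aux F m1 m2 d S) := by
  obtain ⟨c, hc, HG⟩ := aux_exists F hF hB
  refine ⟨c, hc, ?_⟩
  intro m1 m2 d p q S h1 h2 hp hq hpq hS
  obtain ⟨G, G0, G1, G2, hD, hs⟩ := HG m1 m2 d p q h1 h2 hp hq hpq
  have hC1 : (1 : ℝ) ≤ CF := by exact_mod_cast hB.1
  have hCe : (1 : ℝ≥0∞) ≤ CF := by exact_mod_cast hB.1
  have hq1 : (1 : ℝ) ≤ q := by exact_mod_cast (by omega : 1 ≤ q)
  have hex : 0 ≤ (p : ℝ) / (q - p) := by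
    have : (p : ℝ) < q := by exact_mod_cast hpq
    exact div_nonneg (by positivity) (by linarith)
  set S0 : ℝ := (q * (c * (c * q * (4 * CF : ℝ) ^ (m2 + 3 * d)) ^ ((p : ℝ) / (q - p)))) with hS0
  have hpow1 : ∀ n : ℕ, (1:ℝ) ≤ (4 * CF : ℝ) ^ n := fun n => one_le_pow₀ (by linarith)
  have hin : 1 ≤ c * q * (4 * CF : ℝ) ^ (m2 + 3 * d) := one_le_mul_of_one_le_of_one_le (one_le_mul_of_one_le_of_one_le hc hq1) (hpow1 _)
  have hS01 : 1 ≤ S0 := one_le_mul_of_one_le_of_one_le hq1 (one_le_mul_of_one_le_of_one_le hc (Real.one_le_rpow hin hex))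
  have sG0 : ∀ u v (h : Pl u v), QN (plN h) G ≤ ecst u (ENNReal.ofReal S0) := by
    intro u v h
    refine (hs u v h).trans (ecst_mono (ENNReal.ofReal_le_ofReal ?_))
    rw [hS0]
    gcongr
    push_cast
    rw [show (4 * CF : ℝ) = 2 * (2 * CF) by ring, mul_pow 2 (2 * (CF:ℝ))]
    gcongr
    · linarith
    · omega
  have hT := hD d le_rfl
  have hR0 := eps_dvd_Nm (F := F) (by
    rcases Nat.eq_zero_or_pos F.natDegree with h | h
    · exfalso
      rw [hfac, natDegree_mul (X_sub_C_ne_zero r) (by rintro rfl; simp at hr), natDegree_X_sub_C] at h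
      omega
    · exact h) hT
  obtain ⟨R, hR⟩ := hR0
  obtain ⟨H, hH⟩ := hT
  obtain ⟨J, hJ⟩ := Dv_T' d G hD d 0 le_rfl
  simp only [add_zero, pow_zero, Module.End.one_apply] at hJ
  have wT1 := QW_Tpow hF (by norm_num) le_rfl le_rfl (by norm_num) G1 d
  have wT2 := QW_Tpow hF le_rfl (by norm_num) (by norm_num) le_rfl G2 d
  have wT'1 := QW_T'pow hF (by norm_num) le_rfl G1 d
  have wT'2 := QW_T'pow hF le_rfl (by norm_num) G2 d
  have wN1 := Nm_Wt hF (by norm_num) le_rfl G1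
  have wN2 := Nm_Wt hF le_rfl (by norm_num) G2
  have hNe := Nm_ne_zero hfac hr G0
  clear_value S0
  have ecS : ∀ (n k j : ℕ) (u : Bool), n ≤ 5 + 4 * m2 + 5 * d → k ≤ 4 → j ≤ 32 →
      ecst u (j * (4 * CF) ^ n * ENNReal.ofReal S0 ^ k) ≤ ecst u (ENNReal.ofReal S) := by
    intro n k j u hn hk hj
    apply ecst_mono
    have : (j * (4 * CF : ℝ≥0∞) ^ n * ENNReal.ofReal S0 ^ k) = ENNReal.ofReal (j * (4 * CF : ℝ) ^ n * S0 ^ k) := by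
      rw [ENNReal.ofReal_mul (by positivity), ENNReal.ofReal_mul (by positivity), ENNReal.ofReal_pow (by positivity), ENNReal.ofReal_pow (by positivity), ENNReal.ofReal_mul (by positivity)]
      simp
    rw [this, hS]
    apply ENNReal.ofReal_le_ofReal
    have hj' : (j : ℝ) ≤ 32 := by exact_mod_cast hj
    refine mul_le_mul (mul_le_mul hj' (pow_le_pow_right₀ (by linarith) hn) (by positivity) (by norm_num))
      (pow_le_pow_right₀ hS01 hk) (by positivity) (by positivity)
  have four : ∀ (u : Bool) (n k : ℕ), ecst u 4 ^ n * ecst u (2 * CF) ^ k ≤ ecst u ((4 * CF) ^ (n + k)) := by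
    intro u n k
    rw [ecst_pow, pow_add]
    refine mul_le_mul' (pow_le_pow_left' (ecst_mono ?_) n) (pow_le_pow_left' (ecst_mono ?_) k)
    · calc (4 : ℝ≥0∞) = 4 * 1 := by rw [mul_one]
        _ ≤ _ := mul_le_mul' le_rfl hCe
    · exact mul_le_mul' (by norm_num) le_rfl
  refine ⟨⟨G, H, J, R, hH, hJ, hR, ?_, G1, G2,
    QW_mono (QW10_div hH wT1) (by linarith), QW_mono (QW01_div hH wT2) (by linarith),
    QW_mono (QW10_div hJ wT'1) (by linarith), QW_mono (QW01_div hJ wT'2) (by linarith),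
    ?_, ?_, ?_, ?_, ?_, ?_⟩⟩
  · rintro rfl; simp at hR; exact hNe hR
  · rw [hR] at wN1
    exact (Wt10_of_sub_pow _ wN1).mono (by push_cast; linarith)
  · rw [hR] at wN2
    exact (Wt01_of_sub_pow _ wN2).mono (by push_cast; linarith)
  · intro u v h
    refine (sG0 u v h).trans (le_trans (le_of_eq ?_) (ecS 0 1 1 u (by omega) (by norm_num) (by norm_num)))
    simp
  · intro u v h
    refine (QN_div (plN h) (n := m2 + 3 * d) hH (QW_mono wT2 (by push_cast; linarith))).trans ?_
    refine (mul_le_mul' le_rfl (QN_Tpow (plN h) hCe (hB.2 u v h) G d)).trans ?_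
    rw [← mul_assoc]
    refine (mul_le_mul' (four u _ _) (sG0 u v h)).trans ?_
    rw [← ecst_mul]
    refine le_trans (le_of_eq ?_) (ecS (m2 + 3 * d + d) 1 1 u (by omega) (by norm_num) (by norm_num))
    simp
  · intro u v h
    refine (QN_div (plN h) (n := m2 + 3 * d) hJ (QW_mono wT'2 (by push_cast; linarith))).trans ?_
    refine (mul_le_mul' le_rfl (QN_T'pow (plN h) hCe (hB.2 u v h) G d)).trans ?_
    rw [← mul_assoc]
    refine (mul_le_mul' (four u _ _) (sG0 u v h)).trans ?_
    rw [← ecst_mul]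
    refine le_trans (le_of_eq ?_) (ecS (m2 + 3 * d + d) 1 1 u (by omega) (by norm_num) (by norm_num))
    simp
  · intro u v h
    refine (N2_div (plN h) (2 * d) (4 * m2) R ?_).trans ?_
    · rw [← hR]; apply natDegree_of_Wt; exact wN2.mono (by push_cast; linarith)
    · rw [← hR]
      refine (mul_le_mul' le_rfl (Nm_norm (plN h) hCe (hB.2 u v h) G)).trans ?_
      refine (mul_le_mul' le_rfl (mul_le_mul' le_rfl (pow_le_pow_left' (sG0 u v h) 4))).trans ?_
      rw [← ecst_pow, ← ecst_pow, ← ecst_mul, ← ecst_mul]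
      refine le_trans (ecst_mono ?_) (ecS (4 * m2 + 5) 4 32 u (by omega) (by norm_num) (by norm_num))
      rw [pow_add]
      calc (4 : ℝ≥0∞) ^ (4 * m2) * (32 * CF ^ 5 * ENNReal.ofReal S0 ^ 4)
          ≤ (4 * CF) ^ (4 * m2) * (32 * (4 * CF) ^ 5 * ENNReal.ofReal S0 ^ 4) := by
            refine mul_le_mul' (pow_le_pow_left' ?_ _) (mul_le_mul' (mul_le_mul' le_rfl (pow_le_pow_left' ?_ _)) le_rfl)
            · calc (4 : ℝ≥0∞) = 4 * 1 := by rw [mul_one]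
                _ ≤ _ := mul_le_mul' le_rfl hCe
            · calc (CF : ℝ≥0∞) = 1 * CF := by rw [one_mul]
                _ ≤ _ := mul_le_mul' (by norm_num) le_rfl
        _ = _ := by push_cast; ring
end
end
end Mord

set_option linter.unusedSectionVars false
set_option linter.style.longLine false

namespace Mord
open scoped ENNReal
open Polynomial

noncomputable section

section
variable {K : Type*} [Field K]

def Wr {l : ℕ} (φ : Fin l → K[X]) : K[X] := (Matrix.of fun (j a : Fin l) => hasseDeriv (a : ℕ) (φ j)).det

lemma Wr_update {l : ℕ} (φ : Fin l → K[X]) {i j : Fin l} (hij : i ≠ j) (c : K) :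
    Wr (Function.update φ i (φ i + c • φ j)) = Wr φ := by
  unfold Wr
  refine Eq.trans ?_ (Matrix.det_updateRow_add_smul_self (Matrix.of fun (j a : Fin l) => hasseDeriv (a : ℕ) (φ j)) hij (C c))
  congr 1
  refine Matrix.ext fun k a => ?_
  by_cases hk : k = i
  · subst hk
    rw [Matrix.updateRow_self, Matrix.of_apply, Function.update_self, map_add, map_smul, smul_eq_C_mul]
    rfl
  · rw [Matrix.updateRow_ne hk, Matrix.of_apply, Function.update_of_ne hk]
    rfl

lemma li_update {l : ℕ} {φ : Fin l → K[X]} (h : LinearIndependent K φ) {i j : Fin l} (hij : i ≠ j) (c : K) :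
    LinearIndependent K (Function.update φ i (φ i + c • φ j)) := by
  rw [Fintype.linearIndependent_iff] at h ⊢
  intro g hg
  have key : ∑ k, (g + Pi.single j (c * g i) : Fin l → K) k • φ k = 0 := by
    rw [← hg]
    simp only [Pi.add_apply, add_smul, Finset.sum_add_distrib]
    have e1 : ∑ k, (Pi.single j (c * g i) : Fin l → K) k • φ k = (c * g i) • φ j := by
      rw [Finset.sum_eq_single j] <;> simp +contextual
    rw [e1, ← Finset.add_sum_erase _ _ (Finset.mem_univ i), ← Finset.add_sum_erase (a := i) _ (fun k => g k • Function.update φ i (φ i + c • φ j) k) (Finset.mem_univ i)]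
    have e2 : ∑ k ∈ Finset.univ.erase i, g k • Function.update φ i (φ i + c • φ j) k = ∑ k ∈ Finset.univ.erase i, g k • φ k := by
      refine Finset.sum_congr rfl fun k hk => ?_
      rw [Function.update_of_ne (Finset.ne_of_mem_erase hk)]
    rw [e2, Function.update_self, smul_add, smul_smul, mul_comm]
    abel
  have h2 := h _ key
  have hi : g i = 0 := by simpa [Pi.single_eq_of_ne hij] using h2 i
  intro k
  simpa [hi] using h2 k

lemma choose_det_ne_zero [CharZero K] {l : ℕ} (n : Fin l → ℕ) (hn : Function.Injective n) :
    (Matrix.of fun j a : Fin l => ((n j).choose a : K)).det ≠ 0 := by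
  have h := Matrix.det_eval_matrixOfPolynomials_eq_det_vandermonde (fun i => (n i : K)) (fun a => descPochhammer K a)
    (fun i => descPochhammer_natDegree K i) (fun i => monic_descPochhammer K i)
  have h1 : (Matrix.vandermonde fun i => (n i : K)).det ≠ 0 := by
    rw [Matrix.det_vandermonde_ne_zero_iff]
    intro a b hab
    exact hn (Nat.cast_injective (R := K) hab)
  rw [h] at h1
  intro h0
  apply h1
  have : (Matrix.of fun i j : Fin l => (descPochhammer K j).eval (n i : K)) =
      Matrix.of fun i j : Fin l => ((j : ℕ).factorial : K) * (Matrix.of fun j a : Fin l => ((n j).choose a : K)) i j := by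
    ext i j
    simp only [Matrix.of_apply]
    rw [descPochhammer_eval_eq_descFactorial, Nat.descFactorial_eq_factorial_mul_choose]
    push_cast; ring
  rw [this, Matrix.det_mul_row, h0, mul_zero]

lemma Wr_distinct [CharZero K] {l : ℕ} (φ : Fin l → K[X]) (h0 : ∀ j, φ j ≠ 0)
    (hinj : Function.Injective fun j => (φ j).natTrailingDegree) : Wr φ ≠ 0 := by
  set n : Fin l → ℕ := fun j => (φ j).natTrailingDegree with hn
  have hg : ∀ j a : Fin l, ∃ g : K[X], X ^ (a : ℕ) * hasseDeriv (a : ℕ) (φ j) = X ^ (n j) * g ∧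
      g.eval 0 = (φ j).trailingCoeff * ((n j).choose a : K) := by
    intro j a
    have hc : ∀ m : ℕ, (X ^ (a : ℕ) * hasseDeriv (a : ℕ) (φ j)).coeff m = (m.choose a : K) * (φ j).coeff m := by
      intro m
      rw [coeff_X_pow_mul']
      split_ifs with h
      · rw [hasseDeriv_coeff, Nat.sub_add_cancel h]
      · rw [Nat.choose_eq_zero_of_lt (by omega)]; simp
    have hd : X ^ (n j) ∣ X ^ (a : ℕ) * hasseDeriv (a : ℕ) (φ j) := by
      rw [X_pow_dvd_iff]
      intro m hm
      rw [hc, coeff_eq_zero_of_lt_natTrailingDegree hm, mul_zero]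
    obtain ⟨g, hg⟩ := hd
    refine ⟨g, hg, ?_⟩
    have := hc (n j)
    rw [hg, coeff_X_pow_mul', if_pos le_rfl, Nat.sub_self, coeff_zero_eq_eval_zero] at this
    rw [this, mul_comm]; rfl
  choose g hg1 hg2 using hg
  intro hW
  have e1 : (Matrix.of fun j a : Fin l => X ^ (a : ℕ) * (Matrix.of fun (j a : Fin l) => hasseDeriv (a : ℕ) (φ j)) j a).det = 0 := by
    rw [Matrix.det_mul_row]
    unfold Wr at hW
    rw [hW, mul_zero]
  have e2 : (Matrix.of fun j a : Fin l => X ^ (a : ℕ) * (Matrix.of fun (j a : Fin l) => hasseDeriv (a : ℕ) (φ j)) j a) =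
      Matrix.of fun j a : Fin l => X ^ (n j) * (Matrix.of g) j a := by
    exact Matrix.ext fun j a => hg1 j a
  rw [e2, Matrix.det_mul_column, mul_eq_zero] at e1
  rcases e1 with e1 | e1
  · rw [Finset.prod_eq_zero_iff] at e1
    obtain ⟨j, _, hj⟩ := e1
    exact pow_ne_zero _ X_ne_zero hj
  · have e3 := congrArg (evalRingHom (0 : K)) e1
    rw [RingHom.map_det, map_zero] at e3
    have e4 : (evalRingHom (0 : K)).mapMatrix (Matrix.of g) = Matrix.of fun j a : Fin l =>
        (φ j).trailingCoeff * (Matrix.of fun j a : Fin l => ((n j).choose a : K)) j a := by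
      ext j a
      simp [hg2]
    rw [e4, Matrix.det_mul_column, mul_eq_zero] at e3
    rcases e3 with e3 | e3
    · rw [Finset.prod_eq_zero_iff] at e3
      obtain ⟨j, _, hj⟩ := e3
      exact h0 j (trailingCoeff_eq_zero.1 hj)
    · exact choose_det_ne_zero n hinj e3

theorem Wr_ne_zero [CharZero K] {l : ℕ} {φ : Fin l → K[X]} (h : LinearIndependent K φ) : Wr φ ≠ 0 := by
  obtain ⟨N, hN⟩ : ∃ N : ℕ, ∀ j, (φ j).natDegree ≤ N :=
    ⟨Finset.univ.sup fun j => (φ j).natDegree, fun j => Finset.le_sup (f := fun j => (φ j).natDegree) (Finset.mem_univ j)⟩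
  generalize hs : ∑ j, (N - (φ j).natTrailingDegree) = s
  induction s using Nat.strong_induction_on generalizing φ with
  | _ s ih =>
    by_cases hinj : Function.Injective fun j => (φ j).natTrailingDegree
    · exact Wr_distinct φ (fun j => h.ne_zero j) hinj
    · rw [Function.Injective] at hinj
      push Not at hinj
      obtain ⟨i, j, he, hij⟩ := hinj
      set c := -(φ i).trailingCoeff / (φ j).trailingCoeff with hc
      have hli := li_update h hij c
      rw [← Wr_update φ hij c]
      set φ' := Function.update φ i (φ i + c • φ j) with hφ'
      have hi : φ' i = φ i + c • φ j := by rw [hφ', Function.update_self]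
      have hj : ∀ k, k ≠ i → φ' k = φ k := fun k hk => by rw [hφ', Function.update_of_ne hk]
      have hne := hli.ne_zero i
      have hdeg : ∀ k, (φ' k).natDegree ≤ N := by
        intro k
        by_cases hk : k = i
        · subst hk
          rw [hi]
          refine (natDegree_add_le _ _).trans (max_le (hN _) ((natDegree_smul_le _ _).trans (hN _)))
        · rw [hj k hk]; exact hN k
      have hlt : (φ i).natTrailingDegree < (φ' i).natTrailingDegree := by
        refine (le_natTrailingDegree (n := (φ i).natTrailingDegree + 1) hne ?_)
        intro m hm
        rw [hi, coeff_add, coeff_smul]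
        rcases Nat.lt_succ_iff_lt_or_eq.1 hm with h1 | h1
        · rw [coeff_eq_zero_of_lt_natTrailingDegree h1, coeff_eq_zero_of_lt_natTrailingDegree (by rwa [← he])]; simp
        · have e1 : (φ i).coeff m = (φ i).trailingCoeff := by rw [h1]; rfl
          have e2 : (φ j).coeff m = (φ j).trailingCoeff := by rw [h1, he]; rfl
          have : (φ j).trailingCoeff ≠ 0 := fun h' => h.ne_zero j (trailingCoeff_eq_zero.1 h')
          rw [e1, e2, hc, smul_eq_mul]; field_simp; ring
      refine ih _ ?_ hli hdeg rfl
      rw [← hs]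
      have hb : (φ' i).natTrailingDegree ≤ N := (natTrailingDegree_le_natDegree _).trans (hdeg i)
      refine Finset.sum_lt_sum ?_ ⟨i, Finset.mem_univ i, by omega⟩
      intro k _
      by_cases hk : k = i
      · subst hk; omega
      · rw [hj k hk]
end
end
end Mord

set_option linter.unusedSectionVars false
set_option linter.style.longLine false

namespace Mord
open scoped ENNReal
open Polynomial Height

noncomputable section

section
variable {K : Type*} [Field K] {u : Bool} (ν : SubNorm u K)

lemma poly_taylor {n : ℕ} {p : K[X]} (hp : p.natDegree ≤ n) {s : K} (hs : ν s ≤ 1) :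
    ν.poly 1 (p.comp (X + C s)) ≤ ecst u 2 ^ n * ν.poly 1 p := by
  have h1 : ν.poly 1 (X + C s) ≤ ecst u 2 := by
    refine ((ν.poly 1).add' _ _).trans ?_
    refine (oadd_le (u := u) (ν.poly_X 1) (c := 1) ((ν.poly_C 1 s).trans hs)).trans ?_
    simp
  refine ((ν.poly 1).eval₂_le C (X + C s) p).trans ?_
  refine le_trans (SubNorm.poly_mono (ν' := ν) (fun a => ν.poly_C 1 a) _ _) ?_
  exact ν.poly_radius h1 (one_le_ecst (by norm_num)) p hp

lemma poly_div (c n : ℕ) (p : K[X]) {s : K} (hs : ν s ≤ 1) (h : ((X - C s) ^ c * p).natDegree ≤ n) :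
    ν.poly 1 p ≤ ecst u 4 ^ n * ν.poly 1 ((X - C s) ^ c * p) := by
  have hp : p.natDegree ≤ n := by
    refine le_trans ?_ h
    by_cases hp0 : p = 0
    · simp [hp0]
    rw [((monic_X_sub_C _).pow c).natDegree_mul' hp0]
    omega
  have hd : (p.comp (X + C s)).natDegree ≤ n := by
    rw [natDegree_comp]; simpa using hp
  have h1 : ν.poly 1 p ≤ ecst u 2 ^ n * ν.poly 1 (p.comp (X + C s)) := by
    have e : p = (p.comp (X + C s)).comp (X + C (-s)) := by
      rw [comp_assoc]; simp
    conv_lhs => rw [e]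
    refine poly_taylor ν hd ?_
    rw [SubNorm.neg']; exact hs
  have h2 : ν.poly 1 (p.comp (X + C s)) ≤ ecst u 2 ^ n * ν.poly 1 ((X - C s) ^ c * p) := by
    refine le_trans ?_ (poly_taylor ν h hs)
    have : ((X - C s) ^ c * p).comp (X + C s) = X ^ c * p.comp (X + C s) := by simp
    rw [this, SubNorm.poly_apply, SubNorm.poly_apply]
    refine le_trans ?_ (osum_inj (e := fun k => k + c) (fun a b h => by simpa using h) _)
    refine osum_mono fun k => ?_
    rw [coeff_X_pow_mul]; simp
  refine h1.trans ((mul_le_mul' le_rfl h2).trans ?_)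
  rw [← mul_assoc, ← mul_pow, ← ecst_mul]
  norm_num
end

section
variable {K : Type*} [Field K] [NumberField K]

theorem order_bound (p : K[X]) (hp : p ≠ 0) {n : ℕ} (hn : p.natDegree ≤ n) {S : ℝ} (hS1 : 1 ≤ S)
    (hS : ∀ u v (h : Pl u v), (plN h).poly 1 p ≤ ecst u (ENNReal.ofReal S)) (ζ : K) (k : ℕ)
    (hk : (X - C ζ) ^ k ∣ p) : k * logHeight₁ ζ ≤ totalWeight K * Real.log (4 ^ n * S) := by
  have h4 : (1 : ℝ) ≤ 4 ^ n * S := one_le_mul_of_one_le_of_one_le (one_le_pow₀ (by norm_num)) hS1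
  by_cases hζ : ζ = 0
  · subst hζ
    simp only [logHeight₁_zero, mul_zero]
    exact mul_nonneg (Nat.cast_nonneg _) (Real.log_nonneg h4)
  obtain ⟨g, rfl⟩ := hk
  have hg : g ≠ 0 := right_ne_zero_of_mul hp
  set t := g.trailingCoeff with ht
  have ht0 : t ≠ 0 := trailingCoeff_eq_zero.not.2 hg
  rw [← logHeight₁_pow, logHeight₁_eq_logHeight, ← logHeight_smul_eq_logHeight _ ht0]
  have hy : logHeight ![(1:K), 1] = 0 := by rw [← logHeight₁_eq_logHeight, logHeight₁_one]
  have tcp : ((X - C ζ) ^ k * g).trailingCoeff = (-ζ) ^ k * t := by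
    have tX : (X - C ζ).trailingCoeff = - ζ := by
      have h0 : (X - C ζ).natTrailingDegree = 0 := by
        rw [natTrailingDegree_eq_zero]; right; simpa using hζ
      rw [trailingCoeff, h0]; simp
    have tXk : ∀ k : ℕ, ((X - C ζ) ^ k).trailingCoeff = (-ζ) ^ k := by
      intro k
      induction k with
      | zero => simp [trailingCoeff]
      | succ k ih => rw [pow_succ, trailingCoeff_mul, ih, tX, pow_succ]
    rw [trailingCoeff_mul, tXk]
  have key := logHeight_le_of_local (K := K) (x := t • ![ζ ^ k, 1]) (y := ![(1:K), 1]) ?_ ?_ h4 ?_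
  · rw [hy, zero_add] at key; exact key
  · intro h
    have := congrFun h 1
    simp [ht0] at this
  · intro h
    have := congrFun h 1
    simp at this
  · intro u v h
    have e1 : (⨆ j, v (![(1:K), 1] j)) = 1 := by
      have : ∀ j, v (![(1:K), 1] j) = 1 := by intro j; fin_cases j <;> simp
      simp [this]
    rw [e1, mul_one]
    have hb : 1 ≤ cst u (4 ^ n * S) := cst_one_le h4
    have cvt : ∀ x : K, plN h x ≤ ecst u (ENNReal.ofReal (4 ^ n * S)) → v x ≤ cst u (4 ^ n * S) := by
      intro x hx
      rw [ecst_ofReal, plN_apply] at hx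
      exact (ENNReal.ofReal_le_ofReal_iff (by linarith)).1 hx
    have main : v t ≤ cst u (4 ^ n * S) ∧ v (t * ζ ^ k) ≤ cst u (4 ^ n * S) := by
      rcases le_total (v ζ) 1 with hz | hz
      · have h1 : v t ≤ cst u (4 ^ n * S) := by
          apply cvt
          refine ((plN h).coeff_le_poly_one g g.natTrailingDegree).trans ?_
          refine (poly_div (plN h) k n g (s := ζ) ?_ hn).trans ?_
          · rw [plN_apply]; simpa using hz
          · refine (mul_le_mul' le_rfl (hS u v h)).trans ?_
            rw [← ecst_pow, ← ecst_mul, ENNReal.ofReal_mul (by positivity), ENNReal.ofReal_pow (by norm_num)]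
            norm_num
        refine ⟨h1, ?_⟩
        rw [map_mul, map_pow]
        exact (mul_le_of_le_one_right (v.nonneg _) (pow_le_one₀ (v.nonneg _) hz)).trans h1
      · have h1 : v (t * ζ ^ k) ≤ cst u (4 ^ n * S) := by
          have e : v (t * ζ ^ k) = v (((X - C ζ) ^ k * g).trailingCoeff) := by
            rw [tcp]; simp [mul_comm]
          rw [e]
          apply cvt
          refine ((plN h).coeff_le_poly_one _ _).trans ((hS u v h).trans (ecst_mono ?_))
          refine ENNReal.ofReal_le_ofReal ?_
          exact le_mul_of_one_le_left (by linarith) (one_le_pow₀ (by norm_num))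
        refine ⟨?_, h1⟩
        refine le_trans ?_ h1
        rw [map_mul, map_pow]
        exact le_mul_of_one_le_right (v.nonneg _) (one_le_pow₀ hz)
    intro i
    fin_cases i
    · simpa using main.2
    · simpa using main.1
end
end
end Mord

set_option linter.unusedSectionVars false
set_option linter.style.longLine false

namespace Mord
open scoped ENNReal
open Polynomial Height

noncomputable section

section
variable {K : Type*} [Field K]

/-- `Σ φ_j(z1) ψ_j(z2)` -/
def tens {l : ℕ} (φ ψ : Fin l → K[X]) : P2 K := ∑ j, C (φ j) * (ψ j).map C

lemma tens_coeff {l : ℕ} (φ ψ : Fin l → K[X]) (i j : ℕ) :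
    ((tens φ ψ).coeff j).coeff i = ∑ k, (φ k).coeff i * (ψ k).coeff j := by
  unfold tens
  simp [finsetSum_coeff, coeff_C_mul, coeff_map, coeff_mul_C]

lemma tens_exists (R : P2 K) (hR : R ≠ 0) : ∃ (l : ℕ) (φ ψ : Fin l → K[X]), 1 ≤ l ∧ l ≤ R.natDegree + 1 ∧
    LinearIndependent K φ ∧ LinearIndependent K ψ ∧ R = tens φ ψ := by
  set D := R.natDegree
  set W := Submodule.span K (Set.range fun k : Fin (D + 1) => R.coeff k) with hW
  have hfin : Module.Finite K W := Module.Finite.span_of_finite K (Set.finite_range _)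
  have hle : Module.finrank K W ≤ D + 1 := by
    have := finrank_range_le_card (R := K) (fun k : Fin (D + 1) => R.coeff k)
    simpa [Set.finrank] using this
  set l := Module.finrank K W
  set b := Module.finBasis K W
  have hmem : ∀ k : Fin (D + 1), R.coeff k ∈ W := fun k => Submodule.subset_span ⟨k, rfl⟩
  set ψ : Fin l → K[X] := fun j => ∑ k : Fin (D + 1), monomial (k : ℕ) (b.repr ⟨R.coeff k, hmem k⟩ j) with hψ
  have hψc : ∀ j (k : Fin (D + 1)), (ψ j).coeff k = b.repr ⟨R.coeff k, hmem k⟩ j := by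
    intro j k
    simp only [hψ, finsetSum_coeff, coeff_monomial]
    rw [Finset.sum_eq_single k]
    · simp
    · intro m _ hm
      rw [if_neg (fun h => hm (Fin.ext h))]
    · simp
  have hψ0 : ∀ j (k : ℕ), D < k → (ψ j).coeff k = 0 := by
    intro j k hk
    simp only [hψ, finsetSum_coeff, coeff_monomial]
    refine Finset.sum_eq_zero fun m _ => if_neg ?_
    have := m.2; omega
  have hrep : R = tens (fun j => (b j : K[X])) ψ := by
    refine Polynomial.ext fun k => ?_
    refine Polynomial.ext fun i => ?_
    rw [tens_coeff]
    by_cases hk : D < k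
    · rw [coeff_eq_zero_of_natDegree_lt hk]
      simp [hψ0 _ _ hk]
    · have hk' : k < D + 1 := by omega
      have e1 := b.sum_repr ⟨R.coeff k, hmem ⟨k, hk'⟩⟩
      have e2 := congrArg (fun w : W => (w : K[X]).coeff i) e1
      simp only [Submodule.coe_sum, Submodule.coe_smul, finsetSum_coeff, coeff_smul, smul_eq_mul] at e2
      rw [← e2]
      refine Finset.sum_congr rfl fun j _ => ?_
      rw [mul_comm, hψc j ⟨k, hk'⟩]
  have hl : 1 ≤ l := by
    by_contra h
    have h0 : l = 0 := by omega
    apply hR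
    rw [hrep]
    unfold tens
    have : IsEmpty (Fin l) := by rw [h0]; infer_instance
    simp
  refine ⟨l, fun j => (b j : K[X]), ψ, hl, hle, ?_, ?_, hrep⟩
  · exact b.linearIndependent.map' W.subtype (Submodule.ker_subtype W)
  · rw [Fintype.linearIndependent_iff]
    intro c hc
    set L : W →ₗ[K] K := b.constr K c with hL
    have hv : ∀ k : Fin (D + 1), L ⟨R.coeff k, hmem k⟩ = 0 := by
      intro k
      have e1 := congrArg (fun p => Polynomial.coeff p (k : ℕ)) hc
      simp only [finsetSum_coeff, coeff_smul, smul_eq_mul, coeff_zero, hψc] at e1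
      rw [hL, Module.Basis.constr_apply_fintype]
      simp only [Module.Basis.equivFun_apply, smul_eq_mul]
      rw [← e1]
      exact Finset.sum_congr rfl fun j _ => mul_comm _ _
    have hz : ∀ w : W, L w = 0 := by
      rintro ⟨w, hw⟩
      induction hw using Submodule.span_induction with
      | mem x h => obtain ⟨k, rfl⟩ := h; exact hv k
      | zero => exact map_zero L
      | add x y hx hy h1 h2 =>
        have := map_add L ⟨x, hx⟩ ⟨y, hy⟩
        rw [h1, h2, add_zero] at this; exact this
      | smul a x hx h1 =>
        have := map_smul L a ⟨x, hx⟩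
        rw [h1, smul_zero] at this; exact this
    intro j
    have := hz (b j)
    rwa [hL, Module.Basis.constr_basis] at this

/-- the matrix of derivatives -/
def Emat {l : ℕ} (φ ψ : Fin l → K[X]) : Matrix (Fin l) (Fin l) (P2 K) :=
  Matrix.of fun a b => tens (fun j => hasseDeriv (a : ℕ) (φ j)) (fun j => hasseDeriv (b : ℕ) (ψ j))

lemma Emat_det {l : ℕ} (φ ψ : Fin l → K[X]) : (Emat φ ψ).det = C (Wr φ) * (Wr ψ).map C := by
  have h1 : Emat φ ψ = ((C : K[X] →+* P2 K).mapMatrix (Matrix.of fun (j a : Fin l) => hasseDeriv (a : ℕ) (φ j))).transpose *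
      (mapRingHom C).mapMatrix (Matrix.of fun (j a : Fin l) => hasseDeriv (a : ℕ) (ψ j)) := by
    refine Matrix.ext fun a b => ?_
    rw [Matrix.mul_apply]
    rfl
  rw [h1, Matrix.det_mul, Matrix.det_transpose, ← RingHom.map_det, ← RingHom.map_det]
  rfl

lemma Emat_coeff {l : ℕ} (φ ψ : Fin l → K[X]) (a b : Fin l) (i j : ℕ) :
    ((Emat φ ψ a b).coeff j).coeff i = ((i + a).choose a * (j + b).choose b : ℕ) * ((tens φ ψ).coeff (j + b)).coeff (i + a) := by
  unfold Emat
  rw [Matrix.of_apply, tens_coeff, tens_coeff, Finset.mul_sum]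
  refine Finset.sum_congr rfl fun k _ => ?_
  rw [hasseDeriv_coeff, hasseDeriv_coeff]
  push_cast; ring

/-- index condition -/
def Ix (w1 w2 θ : ℝ) (p : P2 K) : Prop := ∀ i j : ℕ, (p.coeff j).coeff i ≠ 0 → θ ≤ w1 * i + w2 * j

namespace Ix
variable {w1 w2 θ θ' : ℝ} {p q : P2 K}
lemma mono (h : Ix w1 w2 θ p) (h' : θ' ≤ θ) : Ix w1 w2 θ' p := fun i j hij => h'.trans (h i j hij)
lemma sum {ι : Type*} (s : Finset ι) (f : ι → P2 K) (h : ∀ i ∈ s, Ix w1 w2 θ (f i)) : Ix w1 w2 θ (∑ i ∈ s, f i) := by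
  intro i j hij
  rw [finsetSum_coeff, finsetSum_coeff] at hij
  obtain ⟨k, hk, hk'⟩ := Finset.exists_ne_zero_of_sum_ne_zero hij
  exact h k hk i j hk'
lemma mul (h : Ix w1 w2 θ p) (h' : Ix w1 w2 θ' q) : Ix w1 w2 (θ + θ') (p * q) := by
  intro i j hij
  rw [coeff_mul, finsetSum_coeff] at hij
  obtain ⟨k, hk, hk'⟩ := Finset.exists_ne_zero_of_sum_ne_zero hij
  rw [coeff_mul] at hk'
  obtain ⟨m, hm, hm'⟩ := Finset.exists_ne_zero_of_sum_ne_zero hk'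
  have h1 := h _ _ (left_ne_zero_of_mul hm')
  have h2 := h' _ _ (right_ne_zero_of_mul hm')
  rw [Finset.HasAntidiagonal.mem_antidiagonal] at hk hm
  rw [← hk, ← hm]; push_cast; linarith
lemma one : Ix w1 w2 0 (1 : P2 K) := by
  intro i j hij
  rw [coeff_one] at hij
  split_ifs at hij with hj
  · rw [coeff_one] at hij
    split_ifs at hij with hi
    · subst hi hj; simp
    · simp at hij
  · simp at hij
lemma neg (h : Ix w1 w2 θ p) : Ix w1 w2 θ (-p) := by
  intro i j hij; apply h; simpa using hij
lemma prod {ι : Type*} (s : Finset ι) (f : ι → P2 K) (e : ι → ℝ) (h : ∀ i ∈ s, Ix w1 w2 (e i) (f i)) :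
    Ix w1 w2 (∑ i ∈ s, e i) (∏ i ∈ s, f i) := by
  classical
  induction s using Finset.induction_on with
  | empty => simpa using one
  | insert a s ha ih =>
    rw [Finset.sum_insert ha, Finset.prod_insert ha]
    exact (h a (Finset.mem_insert_self _ _)).mul (ih fun i hi => h i (Finset.mem_insert_of_mem hi))
lemma det {l : ℕ} (M : Matrix (Fin l) (Fin l) (P2 K)) (e : Fin l → ℝ) (h : ∀ a b, Ix w1 w2 (e b) (M a b)) :
    Ix w1 w2 (∑ b, e b) M.det := by
  rw [Matrix.det_apply]
  refine sum _ _ fun σ _ => ?_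
  have := prod (w1 := w1) (w2 := w2) Finset.univ (fun b => M (σ b) b) e fun b _ => h _ _
  rcases Int.units_eq_one_or (Equiv.Perm.sign σ) with hs | hs
  · simpa [hs] using this
  · simpa [hs] using this.neg
end Ix

lemma Ix_Emat {l : ℕ} {φ ψ : Fin l → K[X]} {w1 w2 θ : ℝ} (h1 : 0 ≤ w1) (h2 : 0 ≤ w2) (h : Ix w1 w2 θ (tens φ ψ)) (a b : Fin l) :
    Ix w1 w2 (max 0 (θ - w1 * (l - 1) - w2 * b)) (Emat φ ψ a b) := by
  intro i j hij
  rw [Emat_coeff] at hij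
  have := h _ _ (right_ne_zero_of_mul hij)
  push_cast at this
  have ha : w1 * a ≤ w1 * (l - 1) := by
    refine mul_le_mul_of_nonneg_left ?_ h1
    have : (a : ℕ) + 1 ≤ l := a.2
    have : ((a : ℕ) : ℝ) + 1 ≤ l := by exact_mod_cast this
    linarith
  refine max_le (by positivity) ?_
  linarith

theorem index_le {l : ℕ} {φ ψ : Fin l → K[X]} [CharZero K] (hφ : LinearIndependent K φ) (hψ : LinearIndependent K ψ)
    {w1 w2 θ : ℝ} (h1 : 0 ≤ w1) (h2 : 0 ≤ w2) (h : Ix w1 w2 θ (tens φ ψ)) :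
    ∑ b : Fin l, max 0 (θ - w1 * (l - 1) - w2 * b) ≤ w1 * (Wr φ).natTrailingDegree + w2 * (Wr ψ).natTrailingDegree := by
  have := Ix.det (Emat φ ψ) _ fun a b => Ix_Emat h1 h2 h a b
  rw [Emat_det] at this
  apply this
  rw [coeff_C_mul, coeff_map, coeff_mul_C]
  exact mul_ne_zero (trailingCoeff_eq_zero.not.2 (Wr_ne_zero hφ)) (trailingCoeff_eq_zero.not.2 (Wr_ne_zero hψ))

lemma sum_lower {l D : ℕ} {t : ℝ} (hD : 1 ≤ D) (hl : 1 ≤ l) (hl' : l ≤ D + 1) (ht : 0 ≤ t) (ht4 : t ≤ 4) :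
    l * (t ^ 2 / 8) ≤ ∑ b : Fin l, max 0 (t - 1 / D * b) := by
  rw [Fin.sum_univ_eq_sum_range (fun b => max 0 (t - 1 / D * b))]
  set c := min l (⌊t * D / 2⌋₊ + 1) with hc
  have hD' : (1 : ℝ) ≤ D := by exact_mod_cast hD
  have hlD : (l : ℝ) ≤ D + 1 := by exact_mod_cast hl'
  have h1 : (c : ℝ) * (t / 2) ≤ ∑ b ∈ Finset.range l, max 0 (t - 1 / D * b) := by
    calc (c : ℝ) * (t / 2) = ∑ b ∈ Finset.range c, t / 2 := by simp
      _ ≤ ∑ b ∈ Finset.range c, max 0 (t - 1 / D * b) := by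
        refine Finset.sum_le_sum fun b hb => le_max_of_le_right ?_
        have hb' : b ≤ ⌊t * D / 2⌋₊ := by
          have := Finset.mem_range.1 hb
          have := min_le_right l (⌊t * D / 2⌋₊ + 1)
          omega
        have hb2 : (b : ℝ) ≤ t * D / 2 := (Nat.cast_le.2 hb').trans (Nat.floor_le (by positivity))
        have : 1 / (D : ℝ) * b ≤ t / 2 := by
          rw [one_div, inv_mul_le_iff₀ (by linarith)]; linarith
        linarith
      _ ≤ _ := Finset.sum_le_sum_of_subset_of_nonneg (Finset.range_mono (min_le_left _ _)) fun _ _ _ => le_max_left _ _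
  refine le_trans ?_ h1
  have h2 : (l : ℝ) * (t / 4) ≤ c := by
    rw [hc, Nat.cast_min]
    refine le_min ?_ ?_
    · have : (0:ℝ) ≤ l := by positivity
      nlinarith
    · have := Nat.lt_floor_add_one (t * D / 2)
      push_cast
      nlinarith
  nlinarith
end
end
end Mord

set_option linter.unusedSectionVars false
set_option linter.style.longLine false

namespace Mord
open scoped ENNReal
open Polynomial Height

noncomputable section

section
variable {K : Type*} [Field K]

/-- translation to the point `(ζ1, ζ2)` -/
def sh (ζ1 ζ2 : K) : P2 K →+* P2 K := eval₂RingHom ((C : K[X] →+* P2 K).comp (taylorAlgHom ζ1).toRingHom) (X + C (C ζ2))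

lemma sh_tens (ζ1 ζ2 : K) {l : ℕ} (φ ψ : Fin l → K[X]) :
    sh ζ1 ζ2 (tens φ ψ) = tens (fun j => taylor ζ1 (φ j)) (fun j => taylor ζ2 (ψ j)) := by
  unfold tens
  rw [map_sum]
  refine Finset.sum_congr rfl fun j _ => ?_
  rw [map_mul]
  congr 1
  · simp [sh]
  · have : (sh ζ1 ζ2).comp (mapRingHom C) = (mapRingHom (C : K →+* K[X])).comp (taylorAlgHom ζ2).toRingHom := by
      ext <;> simp [sh]
    exact congrArg (fun f => f (ψ j)) this

lemma hasse_taylor (ζ : K) (a : ℕ) (p : K[X]) : hasseDeriv a (taylor ζ p) = taylor ζ (hasseDeriv a p) := by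
  ext n
  rw [hasseDeriv_coeff, taylor_coeff, taylor_coeff]
  have h := congrArg (fun L => L p) (hasseDeriv_comp (R := K) n a)
  simp only [LinearMap.comp_apply, LinearMap.smul_apply] at h
  rw [h, nsmul_eq_mul, eval_mul, eval_natCast, Nat.choose_symm_add]

lemma Wr_taylor (ζ : K) {l : ℕ} (φ : Fin l → K[X]) : Wr (fun j => taylor ζ (φ j)) = taylor ζ (Wr φ) := by
  unfold Wr
  have := RingHom.map_det (taylorAlgHom ζ).toRingHom (Matrix.of fun (j a : Fin l) => hasseDeriv (a : ℕ) (φ j))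
  refine Eq.trans ?_ this.symm
  congr 1
  refine Matrix.ext fun j a => ?_
  exact hasse_taylor ζ a (φ j)

lemma dvd_of_taylor (ζ : K) (p : K[X]) : (X - C ζ) ^ (taylor ζ p).natTrailingDegree ∣ p := by
  set k := (taylor ζ p).natTrailingDegree
  have h : X ^ k ∣ taylor ζ p := by
    rw [X_pow_dvd_iff]
    intro m hm
    exact coeff_eq_zero_of_lt_natTrailingDegree hm
  obtain ⟨q, hq⟩ := h
  refine ⟨taylor (-ζ) q, ?_⟩
  have := congrArg (taylor (-ζ)) hq
  rw [taylor_taylor, taylor_mul, taylor_pow, taylor_X] at this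
  simpa [sub_eq_add_neg] using this

lemma taylor_li (ζ : K) {l : ℕ} {φ : Fin l → K[X]} (h : LinearIndependent K φ) :
    LinearIndependent K fun j => taylor ζ (φ j) :=
  h.map' (taylor ζ) (LinearMap.ker_eq_bot.2 (taylor_injective ζ))

lemma SubNorm.natCast_le {u : Bool} {A : Type*} [CommRing A] (ν : SubNorm u A) (n : ℕ) : ν (n : A) ≤ ecst u n := by
  have := ν.sum_le_card (Finset.range n) (fun _ => (1 : A)) 1 fun i _ => ν.one'
  simpa using this

lemma N2_apply {u : Bool} (ν : SubNorm u K) (p : P2 K) :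
    N2 ν p = osum u fun j => osum u fun i => ν ((p.coeff j).coeff i) := by
  unfold N2
  rw [SubNorm.poly_apply]
  simp only [SubNorm.poly_apply, one_pow, mul_one]

lemma N2_Emat {u : Bool} (ν : SubNorm u K) {l D1 D2 : ℕ} {φ ψ : Fin l → K[X]} (h1 : Wt 1 0 D1 (tens φ ψ))
    (h2 : Wt 0 1 D2 (tens φ ψ)) (a b : Fin l) : N2 ν (Emat φ ψ a b) ≤ ecst u (2 ^ (D1 + D2)) * N2 ν (tens φ ψ) := by
  rw [N2_apply, N2_apply, ← osum_mul_left]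
  refine le_trans (osum_mono fun j => ?_) (osum_inj (e := fun j => j + (b : ℕ)) (fun x y h => by simpa using h) _)
  rw [← osum_mul_left]
  refine le_trans (osum_mono fun i => ?_) (osum_inj (e := fun j => j + (a : ℕ)) (fun x y h => by simpa using h) _)
  rw [Emat_coeff]
  by_cases hi : D1 < i + a
  · rw [h1 (i + a) (j + b) (by push_cast; omega)]; simp [ν.zero']
  by_cases hj : D2 < j + b
  · rw [h2 (i + a) (j + b) (by push_cast; omega)]; simp [ν.zero']
  refine (ν.mul' _ _).trans (mul_le_mul' ((ν.natCast_le _).trans (ecst_mono ?_)) le_rfl)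
  have : (i + a).choose a * (j + b).choose b ≤ 2 ^ (D1 + D2) := by
    rw [pow_add]
    refine Nat.mul_le_mul ?_ ?_
    · exact (Nat.choose_le_two_pow _ _).trans (Nat.pow_le_pow_right (by norm_num) (by omega))
    · exact (Nat.choose_le_two_pow _ _).trans (Nat.pow_le_pow_right (by norm_num) (by omega))
  calc _ ≤ ((2 ^ (D1 + D2) : ℕ) : ℝ≥0∞) := Nat.cast_le.2 this
    _ = _ := by push_cast; rfl

lemma SubNorm.prod_le {u : Bool} {A ι : Type*} [CommRing A] (ν : SubNorm u A) (s : Finset ι) (f : ι → A) (B : ℝ≥0∞)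
    (h : ∀ i ∈ s, ν (f i) ≤ B) : ν (∏ i ∈ s, f i) ≤ B ^ s.card := by
  classical
  induction s using Finset.induction_on with
  | empty => simpa using ν.one'
  | insert a s ha ih =>
    rw [Finset.prod_insert ha, Finset.card_insert_of_notMem ha, pow_succ']
    exact (ν.mul' _ _).trans (mul_le_mul' (h a (Finset.mem_insert_self _ _)) (ih fun i hi => h i (Finset.mem_insert_of_mem hi)))

lemma SubNorm.det_le {u : Bool} {A : Type*} [CommRing A] (ν : SubNorm u A) {l : ℕ} (M : Matrix (Fin l) (Fin l) A) (B : ℝ≥0∞)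
    (h : ∀ a b, ν (M a b) ≤ B) : ν M.det ≤ ecst u (l.factorial) * B ^ l := by
  rw [Matrix.det_apply]
  have := ν.sum_le_card Finset.univ (fun σ : Equiv.Perm (Fin l) => Equiv.Perm.sign σ • ∏ i, M (σ i) i) (B ^ l) ?_
  · simpa [Fintype.card_perm] using this
  · intro σ _
    have hp := ν.prod_le Finset.univ (fun i => M (σ i) i) B fun i _ => h _ _
    rw [Finset.card_univ, Fintype.card_fin] at hp
    rcases Int.units_eq_one_or (Equiv.Perm.sign σ) with hs | hs
    · simpa [hs] using hp
    · simpa [hs, ν.neg'] using hp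

lemma natDegree_det_le {l n : ℕ} (M : Matrix (Fin l) (Fin l) K[X]) (h : ∀ a b, (M a b).natDegree ≤ n) : M.det.natDegree ≤ l * n := by
  rw [Matrix.det_apply]
  refine natDegree_sum_le_of_forall_le _ _ fun σ _ => ?_
  have hp : (∏ i, M (σ i) i).natDegree ≤ l * n := by
    refine (natDegree_prod_le _ _).trans ?_
    refine (Finset.sum_le_sum fun i _ => h (σ i) i).trans ?_
    simp
  rcases Int.units_eq_one_or (Equiv.Perm.sign σ) with hs | hs
  · simpa [hs] using hp
  · simpa [hs] using hp

lemma natDegree_Wr_le {l n : ℕ} (φ : Fin l → K[X]) (h : ∀ j, (φ j).natDegree ≤ n) : (Wr φ).natDegree ≤ l * n :=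
  natDegree_det_le _ fun j _ => ((natDegree_hasseDeriv_le _ _).trans (Nat.sub_le _ _)).trans (h j)

/-- degree bounds on the factors of a tensor -/
lemma tens_deg {l D1 D2 : ℕ} {φ ψ : Fin l → K[X]} (hφ : LinearIndependent K φ) (hψ : LinearIndependent K ψ)
    (h1 : Wt 1 0 D1 (tens φ ψ)) (h2 : Wt 0 1 D2 (tens φ ψ)) :
    (∀ j, (φ j).natDegree ≤ D1) ∧ (∀ j, (ψ j).natDegree ≤ D2) := by
  rw [Fintype.linearIndependent_iff] at hφ hψ
  constructor
  · intro k
    rw [natDegree_le_iff_coeff_eq_zero]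
    intro i hi
    refine hψ (fun k => (φ k).coeff i) ?_ k
    ext j
    have := h1 i j (by push_cast; omega)
    rw [tens_coeff] at this
    simpa [finsetSum_coeff] using this
  · intro k
    rw [natDegree_le_iff_coeff_eq_zero]
    intro j hj
    refine hφ (fun k => (ψ k).coeff j) ?_ k
    ext i
    have := h2 i j (by push_cast; omega)
    rw [tens_coeff] at this
    simpa [finsetSum_coeff, mul_comm] using this
end

section
variable {K : Type*} [Field K] [NumberField K]

theorem roth {R : P2 K} (hR : R ≠ 0) {D1 D2 : ℕ} (h1 : Wt 1 0 D1 R) (h2 : Wt 0 1 D2 R) (hD2 : 1 ≤ D2) (hD : D2 ≤ D1)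
    {S : ℝ} (hS1 : 1 ≤ S) (hS : ∀ u v (h : Pl u v), N2 (plN h) R ≤ ecst u (ENNReal.ofReal S)) {ζ1 ζ2 : K}
    (hh1 : 0 < logHeight₁ ζ1) (hh2 : 0 < logHeight₁ ζ2) {θ : ℝ} (hθ : (D2 : ℝ) / D1 ≤ θ) (hθ4 : θ ≤ 4)
    (hI : Ix (1 / D1) (1 / D2) θ (sh ζ1 ζ2 R)) :
    (θ - D2 / D1) ^ 2 / 8 ≤ totalWeight K * (5 * D1 + Real.log S) * (1 / (D1 * logHeight₁ ζ1) + 1 / (D2 * logHeight₁ ζ2)) := by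
  obtain ⟨l, φ, ψ, hl1, hl2, hφ, hψ, rfl⟩ := tens_exists R hR
  have hl2' : l ≤ D2 + 1 := hl2.trans (by have := natDegree_of_Wt h2; omega)
  obtain ⟨dφ, dψ⟩ := tens_deg hφ hψ h1 h2
  rw [sh_tens] at hI
  have hidx := index_le (taylor_li ζ1 hφ) (taylor_li ζ2 hψ) (by positivity) (by positivity) hI
  rw [Wr_taylor, Wr_taylor] at hidx
  set k1 := (taylor ζ1 (Wr φ)).natTrailingDegree
  set k2 := (taylor ζ2 (Wr ψ)).natTrailingDegree
  have hU := Wr_ne_zero hφ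
  have hV := Wr_ne_zero hψ
  have dU := natDegree_Wr_le φ dφ
  have dV := natDegree_Wr_le ψ dψ
  have vU := dvd_of_taylor ζ1 (Wr φ)
  have vV := dvd_of_taylor ζ2 (Wr ψ)
  set U := Wr φ
  set V := Wr ψ
  set S' : ℝ := l.factorial * (2 ^ (D1 + D2) * S) ^ l with hS'
  have hD1r : (1 : ℝ) ≤ D1 := by exact_mod_cast hD2.trans hD
  have hD2r : (1 : ℝ) ≤ D2 := by exact_mod_cast hD2
  have hDr : (D2 : ℝ) ≤ D1 := by exact_mod_cast hD
  have hlr : (1 : ℝ) ≤ l := by exact_mod_cast hl1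
  have hlr2 : (l : ℝ) ≤ D2 + 1 := by exact_mod_cast hl2'
  have h2S : 1 ≤ 2 ^ (D1 + D2) * S := one_le_mul_of_one_le_of_one_le (one_le_pow₀ (by norm_num)) hS1
  have hf1 : (1 : ℝ) ≤ l.factorial := by exact_mod_cast l.factorial_pos
  have hS'1 : 1 ≤ S' := one_le_mul_of_one_le_of_one_le hf1 (one_le_pow₀ h2S)
  have hW : ∀ u v (h : Pl u v), N2 (plN h) (C U * V.map C) ≤ ecst u (ENNReal.ofReal S') := by
    intro u v h
    rw [← Emat_det]
    refine ((N2 (plN h)).det_le (Emat φ ψ) _ fun a b => N2_Emat (plN h) h1 h2 a b).trans ?_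
    refine (mul_le_mul' le_rfl (pow_le_pow_left₀ zero_le (mul_le_mul' le_rfl (hS u v h)) l)).trans ?_
    rw [← ecst_mul, ← ecst_pow, ← ecst_mul]
    apply ecst_mono
    rw [hS', ENNReal.ofReal_mul (by positivity), ENNReal.ofReal_pow (by positivity), ENNReal.ofReal_mul (by positivity),
      ENNReal.ofReal_pow (by norm_num), ENNReal.ofReal_natCast]
    norm_num
  have b1 : k1 * logHeight₁ ζ1 ≤ totalWeight K * Real.log (4 ^ (l * D1) * S') := by
    have htv : V.trailingCoeff ≠ 0 := trailingCoeff_eq_zero.not.2 hV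
    refine order_bound (U * C V.trailingCoeff) (mul_ne_zero hU (C_ne_zero.2 htv)) ?_ hS'1 ?_ ζ1 k1 (vU.mul_right _)
    · exact (natDegree_mul_C_le _ _).trans dU
    · intro u v h
      refine le_trans ?_ (hW u v h)
      have := ((plN h).poly 1).coeff_le_poly_one (C U * V.map C) V.natTrailingDegree
      rwa [coeff_C_mul, coeff_map] at this
  have b2 : k2 * logHeight₁ ζ2 ≤ totalWeight K * Real.log (4 ^ (l * D2) * S') := by
    have htv : U.trailingCoeff ≠ 0 := trailingCoeff_eq_zero.not.2 hU
    refine order_bound (C U.trailingCoeff * V) (mul_ne_zero (C_ne_zero.2 htv) hV) ?_ hS'1 ?_ ζ2 k2 (vV.mul_left _)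
    · exact (natDegree_C_mul_le _ _).trans dV
    · intro u v h
      refine le_trans ?_ (hW u v h)
      rw [N2_apply, SubNorm.poly_apply]
      refine osum_mono fun j => ?_
      have := le_osum (u := u) (fun i => plN h (((C U * V.map C).coeff j).coeff i)) U.natTrailingDegree
      refine le_trans (le_of_eq ?_) this
      rw [coeff_C_mul, coeff_C_mul, coeff_map, coeff_mul_C, one_pow, mul_one]
      rfl
  have hl0 : (0 : ℝ) < l := by linarith
  have hlogS : 0 ≤ Real.log S := Real.log_nonneg hS1
  have hlogl : Real.log l ≤ D1 := by
    have := Real.log_le_sub_one_of_pos hl0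
    linarith
  have hlog2 : Real.log 2 ≤ 0.7 := by have := Real.log_two_lt_d9; linarith
  have hlog20 : 0 ≤ Real.log 2 := Real.log_nonneg (by norm_num)
  have hlogS' : Real.log S' ≤ l * (D1 + 2 * D1 * Real.log 2 + Real.log S) := by
    have hfac : Real.log (l.factorial : ℝ) ≤ l * Real.log l := by
      have : (l.factorial : ℝ) ≤ (l : ℝ) ^ l := by exact_mod_cast l.factorial_le_pow
      rw [← Real.log_pow]
      exact Real.log_le_log (by linarith) this
    rw [hS', Real.log_mul (by positivity) (by positivity), Real.log_pow, Real.log_mul (by positivity) (by linarith), Real.log_pow]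
    push_cast
    have e1 : (l : ℝ) * Real.log l ≤ l * D1 := mul_le_mul_of_nonneg_left hlogl hl0.le
    have e2 : (l : ℝ) * (((D1 : ℝ) + D2) * Real.log 2 + Real.log S) ≤ l * (2 * D1 * Real.log 2 + Real.log S) := by
      refine mul_le_mul_of_nonneg_left ?_ hl0.le
      have : ((D1 : ℝ) + D2) * Real.log 2 ≤ 2 * D1 * Real.log 2 := mul_le_mul_of_nonneg_right (by linarith) hlog20
      linarith
    linarith
  have hgen : ∀ D : ℕ, D ≤ D1 → Real.log (4 ^ (l * D) * S') ≤ l * (5 * D1 + Real.log S) := by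
    intro D hDD
    have hDDr : (D : ℝ) ≤ D1 := by exact_mod_cast hDD
    rw [Real.log_mul (by positivity) (by positivity), Real.log_pow, show (4:ℝ) = 2 ^ 2 by norm_num, Real.log_pow]
    push_cast
    have e1 : (l : ℝ) * D * (2 * Real.log 2) ≤ l * (D1 * 1.4) := by
      rw [mul_assoc]
      refine mul_le_mul_of_nonneg_left ?_ hl0.le
      refine mul_le_mul hDDr (by linarith) (by positivity) (by positivity)
    have e2 : (l : ℝ) * (D1 + 2 * D1 * Real.log 2 + Real.log S) ≤ l * (D1 + 1.4 * D1 + Real.log S) := by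
      refine mul_le_mul_of_nonneg_left ?_ hl0.le
      nlinarith
    have e3 : (0:ℝ) ≤ l * D1 := by positivity
    nlinarith
  have tw0 : (0 : ℝ) ≤ totalWeight K := Nat.cast_nonneg _
  have c1 : (k1 : ℝ) ≤ totalWeight K * (l * (5 * D1 + Real.log S)) / logHeight₁ ζ1 := by
    rw [le_div_iff₀ hh1]
    exact b1.trans (mul_le_mul_of_nonneg_left (hgen D1 le_rfl) tw0)
  have c2 : (k2 : ℝ) ≤ totalWeight K * (l * (5 * D1 + Real.log S)) / logHeight₁ ζ2 := by
    rw [le_div_iff₀ hh2]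
    exact b2.trans (mul_le_mul_of_nonneg_left (hgen D2 hD) tw0)
  have hd0 : (0 : ℝ) ≤ D2 / D1 := by positivity
  have hlow := sum_lower (t := θ - D2 / D1) hD2 hl1 hl2' (by linarith) (by linarith)
  have hcmp : ∑ b : Fin l, max 0 (θ - D2 / D1 - 1 / D2 * b) ≤ ∑ b : Fin l, max 0 (θ - 1 / D1 * (l - 1) - 1 / D2 * b) := by
    refine Finset.sum_le_sum fun b _ => max_le_max le_rfl ?_
    have : 1 / (D1 : ℝ) * (l - 1) ≤ D2 / D1 := by
      rw [one_div, inv_mul_eq_div]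
      exact div_le_div_of_nonneg_right (by linarith) (by linarith)
    linarith
  have hfin : l * ((θ - D2 / D1) ^ 2 / 8) ≤ l * (totalWeight K * (5 * D1 + Real.log S) * (1 / (D1 * logHeight₁ ζ1) + 1 / (D2 * logHeight₁ ζ2))) := by
    refine hlow.trans (hcmp.trans (hidx.trans ?_))
    have e1 := mul_le_mul_of_nonneg_left c1 (show (0:ℝ) ≤ 1 / D1 by positivity)
    have e2 := mul_le_mul_of_nonneg_left c2 (show (0:ℝ) ≤ 1 / D2 by positivity)
    refine (add_le_add e1 e2).trans (le_of_eq ?_)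
    have : (D1 : ℝ) ≠ 0 := by linarith
    have : (D2 : ℝ) ≠ 0 := by linarith
    field_simp
  exact le_of_mul_le_mul_left hfin hl0
end
end
end Mord

set_option linter.unusedSectionVars false
set_option linter.style.longLine false

namespace Mord
open scoped ENNReal

noncomputable section

lemma osum_nat_le {u : Bool} (f : ℕ → ℝ≥0∞) (B : ℝ≥0∞)
    (h : ∀ N : ℕ, ∃ g : ℕ → ℝ≥0∞, (∀ i < N, f i ≤ g i) ∧ osum u g ≤ B) : osum u f ≤ B := by
  cases u with
  | true =>
    have : osum true f = ∑' i, f i := by simp [osum]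
    rw [this]
    refine ENNReal.tsum_le_of_sum_range_le fun N => ?_
    obtain ⟨g, hg, hB⟩ := h N
    have e : osum true g = ∑' i, g i := by simp [osum]
    rw [e] at hB
    refine le_trans (Finset.sum_le_sum fun i hi => hg i (Finset.mem_range.1 hi)) ?_
    exact (ENNReal.sum_le_tsum _).trans hB
  | false =>
    have : osum false f = ⨆ i, f i := by simp [osum]
    rw [this]
    refine iSup_le fun i => ?_
    obtain ⟨g, hg, hB⟩ := h (i + 1)
    exact (hg i (by omega)).trans ((le_osum g i).trans hB)

section
open PowerSeries
variable {K : Type*} [Field K]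

/-- iterates converging to the solution of `V + X V^2 = W` -/
def Vit (W : K⟦X⟧) : ℕ → K⟦X⟧
  | 0 => 0
  | k + 1 => W - X * Vit W k ^ 2

lemma Vit_dvd (W : K⟦X⟧) (k : ℕ) : X ^ k ∣ Vit W (k + 1) - Vit W k := by
  induction k with
  | zero => simp
  | succ k ih =>
    obtain ⟨q, hq⟩ := ih
    have : Vit W (k + 1 + 1) - Vit W (k + 1) = X ^ (k + 1) * (- q * (Vit W (k + 1) + Vit W k)) := by
      have e1 : Vit W (k + 1 + 1) = W - X * Vit W (k + 1) ^ 2 := rfl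
      have e2 : Vit W (k + 1) = W - X * Vit W k ^ 2 := rfl
      rw [e1]; nth_rewrite 2 [e2]
      calc _ = - X * ((Vit W (k + 1) - Vit W k) * (Vit W (k + 1) + Vit W k)) := by ring
        _ = _ := by rw [hq]; ring
    exact ⟨_, this⟩

lemma Vit_coeff (W : K⟦X⟧) {n k : ℕ} (h : n < k) : coeff n (Vit W k) = coeff n (Vit W (n + 1)) := by
  induction k with
  | zero => omega
  | succ k ih =>
    rcases Nat.lt_succ_iff_lt_or_eq.1 h with h1 | h1
    · rw [← ih h1, ← sub_eq_zero, ← map_sub]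
      exact X_pow_dvd_iff.1 (Vit_dvd W k) n h1
    · rw [h1]

def Vlim (W : K⟦X⟧) : K⟦X⟧ := mk fun n => coeff n (Vit W (n + 1))

lemma Vlim_coeff (W : K⟦X⟧) {n k : ℕ} (h : n < k) : coeff n (Vlim W) = coeff n (Vit W k) := by
  rw [Vit_coeff W h, Vlim, coeff_mk]

lemma Vlim_dvd (W : K⟦X⟧) (k : ℕ) : X ^ k ∣ Vlim W - Vit W k := by
  rw [X_pow_dvd_iff]
  intro m hm
  rw [map_sub, Vlim_coeff W hm, sub_self]

lemma Vlim_eq (W : K⟦X⟧) : Vlim W + X * Vlim W ^ 2 = W := by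
  rw [← sub_eq_zero]
  ext n
  obtain ⟨q, hq⟩ := Vlim_dvd W (n + 1)
  obtain ⟨q', hq'⟩ := Vlim_dvd W (n + 2)
  have e1 : Vit W (n + 2) = W - X * Vit W (n + 1) ^ 2 := rfl
  have : Vlim W + X * Vlim W ^ 2 - W = X ^ (n + 1) * (X * q' + X * q * (Vlim W + Vit W (n + 1))) := by
    calc _ = (Vlim W - Vit W (n + 2)) + X * ((Vlim W - Vit W (n + 1)) * (Vlim W + Vit W (n + 1))) := by rw [e1]; ring
      _ = _ := by rw [hq', hq]; ring
  rw [map_zero]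
  exact X_pow_dvd_iff.1 ⟨_, this⟩ n (by omega)

lemma Vlim_norm {u : Bool} (ν : SubNorm u K) (r : ℝ≥0∞) (W : K⟦X⟧) (h : r * ν.ps r W ≤ ecst u (1 / 4)) :
    ν.ps r (Vlim W) ≤ ecst u 2 * ν.ps r W := by
  have hV : ∀ k, ν.ps r (Vit W k) ≤ ecst u 2 * ν.ps r W := by
    intro k
    induction k with
    | zero => simp [Vit, SubNorm.zero']
    | succ k ih =>
      refine ((ν.ps r).sub_le _ _).trans (oadd_le le_rfl ?_)
      refine ((ν.ps r).mul' _ _).trans ?_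
      refine (mul_le_mul' (ν.ps_X r) (((ν.ps r).pow_le _ 2).trans (pow_le_pow_left₀ zero_le ih 2))).trans ?_
      calc r * (ecst u 2 * ν.ps r W) ^ 2 = (ecst u 2) ^ 2 * (r * ν.ps r W) * ν.ps r W := by ring
        _ ≤ (ecst u 2) ^ 2 * ecst u (1 / 4) * ν.ps r W := by gcongr
        _ = 1 * ν.ps r W := by
          rw [← ecst_pow, ← ecst_mul]
          congr 1
          unfold ecst
          split
          · rw [one_div, show ((2:ℝ≥0∞) ^ 2) = 4 by norm_num]
            exact ENNReal.mul_inv_cancel (by norm_num) (by norm_num)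
          · rfl
        _ = _ := one_mul _
  rw [SubNorm.ps_apply]
  refine osum_nat_le _ _ fun N => ⟨fun k => ν (coeff k (Vit W N)) * r ^ k, fun i hi => ?_, hV N⟩
  rw [Vlim_coeff W hi]

theorem sqrt_exists (W : K⟦X⟧) : ∃ S : K⟦X⟧, constantCoeff S = 1 ∧ S ^ 2 = 1 + 4 * X * W ∧
    ∀ (u : Bool) (ν : SubNorm u K) (r : ℝ≥0∞), r * ν.ps r W ≤ ecst u (1 / 4) → ν.ps r S ≤ ecst u 2 := by
  refine ⟨1 + 2 * X * Vlim W, by simp, ?_, ?_⟩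
  · nth_rewrite 2 [← Vlim_eq W]; ring
  · intro u ν r h
    have h2 : ν.ps r 2 ≤ ecst u 2 := by
      have := (ν.ps r).natCast_le 2
      simpa using this
    refine ((ν.ps r).add' _ _).trans ((oadd_le (c := 1) (ν.ps r).one' ?_).trans (by simp))
    refine ((ν.ps r).mul' _ _).trans ?_
    refine (mul_le_mul' (((ν.ps r).mul' _ _).trans (mul_le_mul' h2 (ν.ps_X r))) (Vlim_norm ν r W h)).trans ?_
    calc ecst u 2 * r * (ecst u 2 * ν.ps r W) = (ecst u 2) ^ 2 * (r * ν.ps r W) := by ring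
      _ ≤ (ecst u 2) ^ 2 * ecst u (1 / 4) := by gcongr
      _ = 1 := by
        rw [← ecst_pow, ← ecst_mul]
        unfold ecst
        split
        · rw [one_div, show ((2:ℝ≥0∞) ^ 2) = 4 by norm_num]
          exact ENNReal.mul_inv_cancel (by norm_num) (by norm_num)
        · rfl
end
end
end Mord

set_option linter.unusedSectionVars false
set_option linter.style.longLine false

namespace Mord
open scoped ENNReal

noncomputable section

section
open Polynomial
variable {K : Type*} [Field K]

lemma SubNorm.poly_radius_mono {u : Bool} {A : Type*} [CommRing A] (ν : SubNorm u A) {r R : ℝ≥0∞} (h : r ≤ R) (p : A[X]) :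
    ν.poly r p ≤ ν.poly R p := by
  rw [SubNorm.poly_apply, SubNorm.poly_apply]
  exact osum_mono fun k => mul_le_mul' le_rfl (pow_le_pow_left₀ zero_le h k)

lemma poly_eval_le {u : Bool} (ν : SubNorm u K) {n : ℕ} (F : K[X]) (hF : F.natDegree ≤ n) {z : K} {R : ℝ≥0∞} (hz : ν z ≤ R) (hR : 1 ≤ R) :
    ν (F.eval z) ≤ R ^ n * ν.poly 1 F := by
  have h := ν.eval₂_le (RingHom.id K) z F
  have e : F.eval₂ (RingHom.id K) z = F.eval z := rfl
  rw [e] at h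
  refine h.trans (le_trans (SubNorm.poly_mono (ν' := ν) (fun a => le_rfl) _ _) ?_)
  exact ν.poly_radius hz hR F hF

lemma poly_divX_le {u : Bool} (ν : SubNorm u K) (R : ℝ≥0∞) (p : K[X]) : R * ν.poly R (divX p) ≤ ν.poly R p := by
  rw [SubNorm.poly_apply, SubNorm.poly_apply, ← osum_mul_left]
  refine le_trans (osum_mono fun k => ?_) (osum_inj (e := fun j => j + 1) (fun x y h => by simpa using h) _)
  rw [coeff_divX, pow_succ]
  exact le_of_eq (by ring)

lemma poly_taylor_le {u : Bool} (ν : SubNorm u K) {n : ℕ} (F : K[X]) (hF : F.natDegree ≤ n) {z : K} {R : ℝ≥0∞} (hz : ν z ≤ R) (hR : 1 ≤ R) :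
    ν.poly R (taylor z F) ≤ (ecst u 2 * R) ^ n * ν.poly 1 F := by
  rw [taylor_apply]
  refine ((ν.poly R).eval₂_le C (X + C z) F).trans ?_
  refine le_trans (SubNorm.poly_mono (ν' := ν) (fun a => ν.poly_C R a) _ _) ?_
  refine ν.poly_radius ?_ ?_ F hF
  · exact ((ν.poly R).add' _ _).trans (oadd_le (ν.poly_X R) ((ν.poly_C R z).trans hz))
  · exact one_le_mul_of_one_le_of_one_le (one_le_ecst (by norm_num)) hR
end

section
variable {K : Type*} [Field K] [NumberField K]

/-- local size of a point, with constant `c` -/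
def szA (c : ℕ) (u : Bool) (v : AbsoluteValue K ℝ) (z : K) : ℝ≥0∞ := ecst u c * ENNReal.ofReal (max 1 (v z))

lemma szA_ne_top (c : ℕ) (u : Bool) (v : AbsoluteValue K ℝ) (z : K) : szA c u v z ≠ ⊤ := by
  unfold szA ecst
  refine ENNReal.mul_ne_top ?_ ENNReal.ofReal_ne_top
  split
  · exact ENNReal.natCast_ne_top c
  · exact ENNReal.one_ne_top

lemma one_le_szA {c : ℕ} (hc : 1 ≤ c) (u : Bool) (v : AbsoluteValue K ℝ) (z : K) : 1 ≤ szA c u v z := by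
  refine one_le_mul_of_one_le_of_one_le (one_le_ecst (by exact_mod_cast hc)) ?_
  rw [ENNReal.one_le_ofReal]; exact le_max_left _ _

open PowerSeries in
theorem local_exp {F : Polynomial K} (hF : F.natDegree ≤ 6) {CF : ℕ} (hB : Bd F CF) : ∃ c : ℕ, 1 ≤ c ∧ ∀ z0 y0 : K, y0 ^ 2 = F.eval z0 →
    ∃ Y : K⟦X⟧, constantCoeff Y = y0 ∧ Y ^ 2 = F.eval₂ (C (R := K)) (C z0 + C (4 * y0 ^ 2) * X) ∧
    ∀ u v (h : Pl u v), (plN h).ps ((szA c u v z0)⁻¹ ^ 5) (C z0 + C (4 * y0 ^ 2) * X) ≤ szA c u v z0 ∧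
      (plN h).ps ((szA c u v z0)⁻¹ ^ 5) Y ≤ szA c u v z0 ^ 3 := by
  obtain ⟨hCF, hB⟩ := hB
  refine ⟨256 * CF, by omega, fun z0 y0 hy => ?_⟩
  set t := 4 * y0 ^ 2 with ht
  set τ := Polynomial.taylor z0 F with hτ
  set W : K⟦X⟧ := (Polynomial.divX τ).eval₂ (C (R := K)) (C t * X) with hW
  obtain ⟨S, hS0, hS2, hSn⟩ := sqrt_exists W
  refine ⟨C y0 * S, by simp [hS0], ?_, ?_⟩
  · have e1 : F.eval₂ (C (R := K)) (C z0 + C t * X) = τ.eval₂ (C (R := K)) (C t * X) := by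
      rw [hτ, Polynomial.taylor_apply, Polynomial.eval₂_comp]
      simp [add_comm]
    have e2 := Polynomial.divX_mul_X_add τ
    rw [e1, ← e2, Polynomial.eval₂_add, Polynomial.eval₂_mul, Polynomial.eval₂_X, Polynomial.eval₂_C, ← hW,
      hτ, Polynomial.taylor_coeff_zero, ← hy, mul_pow, hS2, ht]
    simp only [map_mul, map_pow, map_ofNat]
    ring
  · intro u v h
    set ν := plN h with hν
    set A := szA (256 * CF) u v z0 with hA
    set Pn := ENNReal.ofReal (max 1 (v z0)) with hPn
    have hAP : A = ecst u (256 * CF) * Pn := by rw [hA, szA]; push_cast; rfl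
    have hAt : A ≠ ⊤ := szA_ne_top _ _ _ _
    have hA1 : 1 ≤ A := one_le_szA (by omega) _ _ _
    have hP1 : 1 ≤ Pn := by rw [hPn, ENNReal.one_le_ofReal]; exact le_max_left _ _
    have hPt : Pn ≠ ⊤ := ENNReal.ofReal_ne_top
    have hP0 : Pn ≠ 0 := (zero_lt_one.trans_le hP1).ne'
    set r := A⁻¹ ^ 5 with hr
    have hrx : ∀ x y : ℝ≥0∞, x ≤ y * A ^ 5 → x * r ≤ y := by
      intro x y hxy
      rw [hr, ← ENNReal.inv_pow, ← div_eq_mul_inv]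
      exact ENNReal.div_le_of_le_mul hxy
    have hc1 : (1 : ℝ≥0∞) ≤ CF := by exact_mod_cast hCF
    have hcc : ∀ a : ℝ≥0∞, a ≤ 256 * CF → a ≤ (256 * CF) ^ 5 := fun a ha =>
      ha.trans (le_self_pow₀ (one_le_mul_of_one_le_of_one_le (by norm_num) hc1) (by norm_num))
    have f1 : ν z0 ≤ Pn := by rw [hν, plN_apply]; exact ENNReal.ofReal_le_ofReal (le_max_right _ _)
    have fF := hB u v h
    have f2 : ν (y0 ^ 2) ≤ Pn ^ 6 * ecst u CF := by
      rw [hy]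
      exact (poly_eval_le ν F hF f1 hP1).trans (mul_le_mul' le_rfl fF)
    have f3 : ν y0 ≤ ecst u CF * Pn ^ 3 := by
      refine (ENNReal.pow_le_pow_left_iff (n := 2) (by norm_num)).1 ?_
      have e : ν y0 ^ 2 = ν (y0 ^ 2) := by
        rw [hν, plN_apply, plN_apply, map_pow, ENNReal.ofReal_pow (v.nonneg _)]
      rw [e]
      refine f2.trans ?_
      rw [mul_pow, ← pow_mul, mul_comm]
      exact mul_le_mul' (le_self_pow₀ (one_le_ecst hc1) (by norm_num)) le_rfl
    have f4 : ν t ≤ ecst u (4 * CF) * Pn ^ 6 := by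
      refine (ν.mul' _ _).trans ?_
      have : ν (4 : K) ≤ ecst u 4 := by simpa using ν.natCast_le 4
      refine (mul_le_mul' this f2).trans (le_of_eq ?_)
      rw [ecst_mul]; ring
    have hA5 : A ^ 5 = ecst u ((256 * CF) ^ 5) * Pn ^ 5 := by rw [hAP, mul_pow, ecst_pow]
    have f5 : ν.ps r (C t * X) ≤ Pn := by
      refine ((ν.ps r).mul' _ _).trans ((mul_le_mul' (ν.ps_C r t) (ν.ps_X r)).trans (hrx _ _ ?_))
      refine f4.trans ?_
      rw [hA5, show Pn * (ecst u ((256 * (CF:ℝ≥0∞)) ^ 5) * Pn ^ 5) = ecst u ((256 * CF) ^ 5) * Pn ^ 6 by ring]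
      refine mul_le_mul' (ecst_mono (hcc _ ?_)) le_rfl
      gcongr; norm_num
    have f6 : Pn * ν.ps r W ≤ ecst u (64 * CF) * Pn ^ 6 := by
      have h1 : ν.ps r W ≤ ν.poly Pn (Polynomial.divX τ) := by
        refine ((ν.ps r).eval₂_le _ _ _).trans ?_
        refine le_trans (SubNorm.poly_mono (ν' := ν) (fun a => ν.ps_C r a) _ _) ?_
        exact ν.poly_radius_mono f5 _
      refine (mul_le_mul' le_rfl h1).trans ((poly_divX_le ν Pn τ).trans ((poly_taylor_le ν F hF f1 hP1).trans ?_))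
      refine (mul_le_mul' le_rfl fF).trans (le_of_eq ?_)
      rw [mul_pow, ← ecst_pow, ecst_mul]
      norm_num; ring
    have f7 : r * ν.ps r W ≤ ecst u (1 / 4) := by
      rw [mul_comm]
      apply hrx
      refine (ENNReal.mul_le_mul_iff_right hP0 hPt).1 (f6.trans ?_)
      rw [hA5, show Pn * (ecst u (1 / 4) * (ecst u ((256 * (CF:ℝ≥0∞)) ^ 5) * Pn ^ 5)) = ecst u (1 / 4) * ecst u ((256 * CF) ^ 5) * Pn ^ 6 by ring]
      rw [← ecst_mul]
      refine mul_le_mul' (ecst_mono ?_) le_rfl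
      refine le_trans ?_ (mul_le_mul' le_rfl (hcc _ le_rfl))
      have : (1 / 4 : ℝ≥0∞) * (256 * CF) = 64 * CF := by
        rw [← mul_assoc]
        congr 1
        rw [show (256 : ℝ≥0∞) = 4 * 64 by norm_num, ← mul_assoc, one_div, ENNReal.inv_mul_cancel (by norm_num) (by norm_num), one_mul]
      rw [this]
    have f8 := hSn u ν r f7
    constructor
    · refine ((ν.ps r).add' _ _).trans ((oadd_le ((ν.ps_C r z0).trans f1) f5).trans ?_)
      rw [hAP]
      refine mul_le_mul' (ecst_mono ?_) le_rfl
      calc (2 : ℝ≥0∞) ≤ 256 * 1 := by norm_num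
        _ ≤ _ := by gcongr
    · refine ((ν.ps r).mul' _ _).trans ((mul_le_mul' ((ν.ps_C r y0).trans f3) f8).trans ?_)
      rw [hAP, mul_pow, ← ecst_pow, show ecst u (CF:ℝ≥0∞) * Pn ^ 3 * ecst u 2 = (ecst u CF * ecst u 2) * Pn ^ 3 by ring, ← ecst_mul]
      refine mul_le_mul' (ecst_mono ?_) le_rfl
      calc (CF : ℝ≥0∞) * 2 ≤ 256 * CF := by rw [mul_comm]; gcongr; norm_num
        _ ≤ _ := le_self_pow₀ (one_le_mul_of_one_le_of_one_le (by norm_num) hc1) (by norm_num)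
end
end
end Mord

set_option linter.unusedSectionVars false
set_option linter.style.longLine false

namespace Mord
open scoped ENNReal

noncomputable section

abbrev L2 (K : Type*) [Field K] := PowerSeries (PowerSeries K)

section
variable {K : Type*} [Field K]

def cf (i j : ℕ) (f : L2 K) : K := PowerSeries.coeff i (PowerSeries.coeff j f)

/-- inclusion of series in the first variable -/
abbrev in1 : PowerSeries K →+* L2 K := PowerSeries.C
/-- inclusion of series in the second variable -/
abbrev in2 : PowerSeries K →+* L2 K := PowerSeries.map PowerSeries.C

def Th (Z1 Z2 : PowerSeries K) : P2 K →+* L2 K :=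
  Polynomial.eval₂RingHom (in1.comp (Polynomial.eval₂RingHom PowerSeries.C Z1)) (in2 Z2)

lemma Th_z1 (Z1 Z2 : PowerSeries K) : Th Z1 Z2 (Polynomial.C Polynomial.X) = in1 Z1 := by simp [Th]
lemma Th_z2 (Z1 Z2 : PowerSeries K) : Th Z1 Z2 Polynomial.X = in2 Z2 := by simp [Th]
lemma Th_F1 (Z1 Z2 : PowerSeries K) (F : Polynomial K) : Th Z1 Z2 (F1 F) = in1 (F.eval₂ PowerSeries.C Z1) := by simp [Th]
lemma Th_F2 (Z1 Z2 : PowerSeries K) (F : Polynomial K) : Th Z1 Z2 (F2 F) = in2 (F.eval₂ PowerSeries.C Z2) := by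
  have : (Th Z1 Z2).comp (Polynomial.mapRingHom Polynomial.C) = (in2).comp (Polynomial.eval₂RingHom PowerSeries.C Z2) := by
    ext <;> simp [Th]
  exact congrArg (fun f => f F) this

def Lam (Z1 Z2 Y1 Y2 : PowerSeries K) (G : Q4 K) : L2 K :=
  Th Z1 Z2 (G 0) + Th Z1 Z2 (G 1) * in1 Y1 + Th Z1 Z2 (G 2) * in2 Y2 + Th Z1 Z2 (G 3) * (in1 Y1 * in2 Y2)

section
variable {Z1 Z2 y1 y2 : PowerSeries K} {F : Polynomial K} (h1 : y1 ^ 2 = F.eval₂ PowerSeries.C Z1)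
  (h2 : y2 ^ 2 = F.eval₂ PowerSeries.C Z2)
include h1 h2

lemma Lam_smul (c : P2 K) (G : Q4 K) : Lam Z1 Z2 y1 y2 (c • G) = Th Z1 Z2 c * Lam Z1 Z2 y1 y2 G := by
  simp only [Lam, Pi.smul_apply, smul_eq_mul, map_mul]; ring

lemma Lam_T (G : Q4 K) : Lam Z1 Z2 y1 y2 (T F G) = (in1 y1 + in2 y2) * Lam Z1 Z2 y1 y2 G := by
  have e1 := Th_F1 Z1 Z2 F
  have e2 := Th_F2 Z1 Z2 F
  rw [← h1, map_pow] at e1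
  rw [← h2, map_pow] at e2
  simp only [Lam, T, LinearMap.coe_mk, AddHom.coe_mk, Matrix.cons_val, map_add, map_mul, e1, e2]
  ring

lemma Lam_T' (G : Q4 K) : Lam Z1 Z2 y1 y2 (T' F G) = (in1 y1 * in2 Z2 ^ 3 + in2 y2 * in1 Z1 ^ 3) * Lam Z1 Z2 y1 y2 G := by
  have e1 := Th_F1 Z1 Z2 F
  have e2 := Th_F2 Z1 Z2 F
  rw [← h1, map_pow] at e1
  rw [← h2, map_pow] at e2
  rw [T'_apply]
  simp only [Lam, Matrix.cons_val, map_add, map_mul, map_pow, e1, e2, Th_z1, Th_z2]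
  ring

lemma Lam_Tpow (G : Q4 K) (d : ℕ) : Lam Z1 Z2 y1 y2 ((T F ^ d) G) = (in1 y1 + in2 y2) ^ d * Lam Z1 Z2 y1 y2 G := by
  induction d with
  | zero => simp
  | succ d ih => rw [pow_succ', Module.End.mul_apply, Lam_T h1 h2, ih]; ring

lemma Lam_T'pow (G : Q4 K) (d : ℕ) :
    Lam Z1 Z2 y1 y2 ((T' F ^ d) G) = (in1 y1 * in2 Z2 ^ 3 + in2 y2 * in1 Z1 ^ 3) ^ d * Lam Z1 Z2 y1 y2 G := by
  induction d with
  | zero => simp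
  | succ d ih => rw [pow_succ', Module.End.mul_apply, Lam_T' h1 h2, ih]; ring

lemma Lam_dvd_Nm (G : Q4 K) : Lam Z1 Z2 y1 y2 G ∣ Th Z1 Z2 (Nm F G) := by
  have e1 := Th_F1 Z1 Z2 F
  have e2 := Th_F2 Z1 Z2 F
  rw [← h1, map_pow] at e1
  rw [← h2, map_pow] at e2
  refine ⟨(Th Z1 Z2 (G 0) + Th Z1 Z2 (G 1) * in1 y1 - Th Z1 Z2 (G 2) * in2 y2 - Th Z1 Z2 (G 3) * (in1 y1 * in2 y2)) *
    (Th Z1 Z2 (na F G) - Th Z1 Z2 (nb F G) * in1 y1), ?_⟩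
  simp only [Lam, Nm, na, nb, map_add, map_mul, map_pow, map_sub, map_ofNat, e1, e2]
  ring
end

/-! coefficients -/

lemma cf_mul (i j : ℕ) (f g : L2 K) : cf i j (f * g) =
    ∑ x ∈ Finset.HasAntidiagonal.antidiagonal j, ∑ y ∈ Finset.HasAntidiagonal.antidiagonal i, cf y.1 x.1 f * cf y.2 x.2 g := by
  unfold cf
  rw [PowerSeries.coeff_mul, map_sum]
  refine Finset.sum_congr rfl fun x _ => ?_
  rw [PowerSeries.coeff_mul]

def c0 : L2 K →+* K := (PowerSeries.constantCoeff (R := K)).comp (PowerSeries.constantCoeff (R := PowerSeries K))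

lemma cf_zero (f : L2 K) : cf 0 0 f = c0 f := by simp [cf, c0]

lemma cf_mul_min {a b : ℕ} (ha : 0 < a) (hb : 0 < b) {i j : ℕ} {f : L2 K} (hmin : ∀ i' j', cf i' j' f ≠ 0 → a * i + b * j ≤ a * i' + b * j')
    (g : L2 K) : cf i j (f * g) = cf i j f * c0 g := by
  rw [cf_mul, Finset.sum_eq_single (j, 0), Finset.sum_eq_single (i, 0), cf_zero]
  · rintro ⟨p, q⟩ hpq hne
    rw [Finset.HasAntidiagonal.mem_antidiagonal] at hpq
    simp only at hpq ⊢
    by_cases h : cf p j f = 0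
    · rw [h, zero_mul]
    · exfalso
      have := hmin _ _ h
      have h3 : a * i ≤ a * p := by omega
      have h4 := Nat.le_of_mul_le_mul_left h3 ha
      apply hne
      ext <;> simp <;> omega
  · intro h
    exact absurd (Finset.HasAntidiagonal.mem_antidiagonal.2 (by simp)) h
  · rintro ⟨p, q⟩ hpq hne
    rw [Finset.HasAntidiagonal.mem_antidiagonal] at hpq
    simp only at hpq ⊢
    refine Finset.sum_eq_zero fun y hy => ?_
    rw [Finset.HasAntidiagonal.mem_antidiagonal] at hy
    by_cases h : cf y.1 p f = 0
    · rw [h, zero_mul]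
    · exfalso
      have := hmin _ _ h
      have h3 : a * y.1 ≤ a * i := Nat.mul_le_mul_left a (by omega)
      have h5 : b * j ≤ b * p := by omega
      have h4 := Nat.le_of_mul_le_mul_left h5 hb
      apply hne
      ext <;> simp <;> omega
  · intro h
    exact absurd (Finset.HasAntidiagonal.mem_antidiagonal.2 (by simp)) h

lemma isUnit_L2 {b : L2 K} (hb : c0 b ≠ 0) : IsUnit b := by
  rw [PowerSeries.isUnit_iff_constantCoeff, PowerSeries.isUnit_iff_constantCoeff, isUnit_iff_ne_zero]
  exact hb

lemma cf_eq_of_mul_eq {a b : ℕ} (ha : 0 < a) (hb : 0 < b) {i j : ℕ} {f : L2 K} (hmin : ∀ i' j', cf i' j' f ≠ 0 → a * i + b * j ≤ a * i' + b * j')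
    {g p q : L2 K} (hq : c0 q ≠ 0) (h : p * f = q * g) : cf i j f * c0 p = cf i j g * c0 q := by
  obtain ⟨w, hw⟩ := isUnit_L2 hq
  have e : g = f * (p * ↑(w⁻¹)) := by
    rw [← mul_assoc, mul_comm f p, h, ← hw, mul_assoc, mul_comm g, ← mul_assoc, Units.mul_inv, one_mul]
  rw [e, cf_mul_min ha hb hmin, map_mul]
  have e2 : c0 (↑w⁻¹ : L2 K) * c0 q = 1 := by rw [← hw, ← map_mul, Units.inv_mul, map_one]
  rw [mul_assoc, mul_assoc, e2, mul_one]

lemma exists_min {a b : ℕ} {f g : L2 K} (hdvd : f ∣ g) {i j : ℕ} (h : cf i j g ≠ 0) :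
    ∃ i0 j0, cf i0 j0 f ≠ 0 ∧ (∀ i' j', cf i' j' f ≠ 0 → a * i0 + b * j0 ≤ a * i' + b * j') ∧ a * i0 + b * j0 ≤ a * i + b * j := by
  classical
  obtain ⟨q, rfl⟩ := hdvd
  have hex : ∃ n, ∃ i0 j0, cf i0 j0 f ≠ 0 ∧ a * i0 + b * j0 = n ∧ n ≤ a * i + b * j := by
    rw [cf_mul] at h
    obtain ⟨x, hx, h⟩ := Finset.exists_ne_zero_of_sum_ne_zero h
    obtain ⟨y, hy, h⟩ := Finset.exists_ne_zero_of_sum_ne_zero h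
    rw [Finset.HasAntidiagonal.mem_antidiagonal] at hx hy
    refine ⟨_, y.1, x.1, left_ne_zero_of_mul h, rfl, ?_⟩
    exact Nat.add_le_add (Nat.mul_le_mul_left a (by omega)) (Nat.mul_le_mul_left b (by omega))
  obtain ⟨i0, j0, h1, h2, h3⟩ := Nat.find_spec hex
  refine ⟨i0, j0, h1, fun i' j' h' => ?_, by omega⟩
  by_contra hlt
  push Not at hlt
  have := Nat.find_min' hex ⟨i', j', h', rfl, by omega⟩
  omega

/-- relation with translation -/
lemma cf_Th (ζ1 ζ2 t1 t2 : K) (p : P2 K) (i j : ℕ) :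
    cf i j (Th (PowerSeries.C ζ1 + PowerSeries.C t1 * PowerSeries.X) (PowerSeries.C ζ2 + PowerSeries.C t2 * PowerSeries.X) p) =
      t1 ^ i * t2 ^ j * ((sh ζ1 ζ2 p).coeff j).coeff i := by
  have e : Th (PowerSeries.C ζ1 + PowerSeries.C t1 * PowerSeries.X) (PowerSeries.C ζ2 + PowerSeries.C t2 * PowerSeries.X) =
      (Th (PowerSeries.C t1 * PowerSeries.X) (PowerSeries.C t2 * PowerSeries.X)).comp (sh ζ1 ζ2) := by
    refine Polynomial.ringHom_ext' ?_ ?_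
    · refine Polynomial.ringHom_ext' ?_ ?_
      · ext x; simp [Th, sh]
      · simp [Th, sh, add_comm]
    · simp [Th, sh, add_comm]
  rw [e, RingHom.comp_apply]
  generalize sh ζ1 ζ2 p = q
  induction q using Polynomial.induction_on' with
  | add q q' h h' =>
    have : ∀ f g : L2 K, cf i j (f + g) = cf i j f + cf i j g := fun f g => by simp [cf]
    rw [map_add, this, h, h', Polynomial.coeff_add, Polynomial.coeff_add]; ring
  | monomial n c =>
    have hin : ∀ k, PowerSeries.coeff k (c.eval₂ PowerSeries.C (PowerSeries.C t1 * PowerSeries.X)) = t1 ^ k * c.coeff k := by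
      intro k
      induction c using Polynomial.induction_on' with
      | add q q' h h' => rw [Polynomial.eval₂_add, map_add, h, h', Polynomial.coeff_add]; ring
      | monomial n c =>
        rw [Polynomial.eval₂_monomial, mul_pow, ← map_pow, PowerSeries.coeff_C_mul, PowerSeries.coeff_C_mul, PowerSeries.coeff_X_pow, Polynomial.coeff_monomial]
        by_cases hk : k = n
        · subst hk; simp [mul_comm]
        · simp [hk, Ne.symm hk]
    have h3 : Th (PowerSeries.C t1 * PowerSeries.X) (PowerSeries.C t2 * PowerSeries.X) (Polynomial.monomial n c) =
       PowerSeries.C (c.eval₂ PowerSeries.C (PowerSeries.C t1 * PowerSeries.X) * PowerSeries.C (t2 ^ n)) * PowerSeries.X ^ n := by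
      simp [Th, mul_pow, mul_assoc]
    rw [h3, cf, PowerSeries.coeff_C_mul, PowerSeries.coeff_X_pow, Polynomial.coeff_monomial]
    by_cases hk : j = n
    · subst hk
      simp only [if_true, mul_one]
      rw [PowerSeries.coeff_mul_C, hin]; ring
    · simp [hk, Ne.symm hk]
end
end
end Mord

set_option linter.unusedSectionVars false
set_option linter.style.longLine false

namespace Mord
open scoped ENNReal

noncomputable section

section
variable {K : Type*} [Field K] {u : Bool} (ν : SubNorm u K)

lemma N2_radius {A1 A2 : ℝ≥0∞} (h1 : 1 ≤ A1) (h2 : 1 ≤ A2) {a b : ℕ} {p : P2 K} (ha : Wt 1 0 a p) (hb : Wt 0 1 b p) :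
    (ν.poly A1).poly A2 p ≤ A1 ^ a * A2 ^ b * N2 ν p := by
  have hN : N2 ν p = osum u fun j => ν.poly 1 (p.coeff j) := by
    rw [N2, SubNorm.poly_apply]; simp
  rw [hN, SubNorm.poly_apply, ← osum_mul_left]
  refine osum_mono fun j => ?_
  by_cases hj : j ≤ b
  · have hd : (p.coeff j).natDegree ≤ a := by
      rw [Polynomial.natDegree_le_iff_coeff_eq_zero]
      intro i hi
      exact ha i j (by push_cast; omega)
    have := ν.poly_radius (le_refl A1) h1 (p.coeff j) hd
    calc ν.poly A1 (p.coeff j) * A2 ^ j ≤ (A1 ^ a * ν.poly 1 (p.coeff j)) * A2 ^ b := by gcongr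
      _ = _ := by ring
  · have : p.coeff j = 0 := by
      ext i
      rw [hb i j (by push_cast; omega)]; simp
    rw [this, SubNorm.zero']; simp

variable {r1 r2 A1 A2 : ℝ≥0∞} (h1 : 1 ≤ A1) (h2 : 1 ≤ A2) {Z1 Z2 Y1 Y2 : PowerSeries K}

lemma ps2_in1 (f : PowerSeries K) : (ν.ps r1).ps r2 (in1 f) ≤ ν.ps r1 f := (ν.ps r1).ps_C _ _
lemma ps2_in2 (f : PowerSeries K) : (ν.ps r1).ps r2 (in2 f) ≤ ν.ps r2 f := by
  rw [SubNorm.ps_apply, SubNorm.ps_apply ν]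
  refine osum_mono fun k => ?_
  rw [PowerSeries.coeff_map]
  gcongr
  exact ν.ps_C _ _

variable (hZ1 : ν.ps r1 Z1 ≤ A1) (hZ2 : ν.ps r2 Z2 ≤ A2) (hY1 : ν.ps r1 Y1 ≤ A1 ^ 3) (hY2 : ν.ps r2 Y2 ≤ A2 ^ 3)
include h1 h2 hZ1 hZ2

lemma Th_le {a b : ℕ} {p : P2 K} (ha : Wt 1 0 a p) (hb : Wt 0 1 b p) :
    (ν.ps r1).ps r2 (Th Z1 Z2 p) ≤ A1 ^ a * A2 ^ b * N2 ν p := by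
  refine le_trans ?_ (N2_radius ν h1 h2 ha hb)
  refine (((ν.ps r1).ps r2).eval₂_le _ (in2 Z2) p).trans ?_
  refine (SubNorm.poly_radius_mono _ ((ps2_in2 ν Z2).trans hZ2) p).trans ?_
  refine SubNorm.poly_mono (fun q => ?_) _ _
  refine (ps2_in1 ν (r1 := r1) (r2 := r2) (q.eval₂ PowerSeries.C Z1)).trans ?_
  refine ((ν.ps r1).eval₂_le _ Z1 q).trans ?_
  refine (SubNorm.poly_radius_mono _ hZ1 q).trans ?_
  exact SubNorm.poly_mono (fun a => ν.ps_C _ _) _ _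

lemma Th_mul_le {a b : ℕ} {p : P2 K} (e1 e2 : ℕ) (ha : Wt 1 0 (a - e1) p) (hb : Wt 0 1 (b - e2) p) {w : L2 K}
    (hw : (ν.ps r1).ps r2 w ≤ A1 ^ e1 * A2 ^ e2) :
    (ν.ps r1).ps r2 (Th Z1 Z2 p * w) ≤ A1 ^ a * A2 ^ b * N2 ν p := by
  by_cases hp : p = 0
  · subst hp; simp [SubNorm.zero']
  have h1' : e1 ≤ a := by
    by_contra hlt
    apply hp
    ext j i
    rw [ha i j (by omega)]; simp
  have h2' : e2 ≤ b := by
    by_contra hlt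
    apply hp
    ext j i
    rw [hb i j (by omega)]; simp
  refine (((ν.ps r1).ps r2).mul' _ _).trans ?_
  have := Th_le ν h1 h2 hZ1 hZ2 (a := a - e1) (b := b - e2) (p := p) (by rwa [Nat.cast_sub h1']) (by rwa [Nat.cast_sub h2'])
  refine (mul_le_mul' this hw).trans (le_of_eq ?_)
  obtain ⟨k, rfl⟩ := Nat.exists_eq_add_of_le h1'
  obtain ⟨l, rfl⟩ := Nat.exists_eq_add_of_le h2'
  simp only [Nat.add_sub_cancel_left]
  ring

include hY1 hY2

lemma Lam_le {m1 m2 : ℕ} {G : Q4 K} (hG1 : QW 1 0 m1 G) (hG2 : QW 0 1 m2 G) :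
    (ν.ps r1).ps r2 (Lam Z1 Z2 Y1 Y2 G) ≤ ecst u 4 * (A1 ^ m1 * A2 ^ m2 * QN ν G) := by
  set ν2 := (ν.ps r1).ps r2 with hν2
  obtain ⟨a0, a1, a2, a3⟩ := hG1
  obtain ⟨b0, b1, b2, b3⟩ := hG2
  have hy1 : ν2 (in1 Y1) ≤ A1 ^ 3 := (ps2_in1 ν Y1).trans hY1
  have hy2 : ν2 (in2 Y2) ≤ A2 ^ 3 := (ps2_in2 ν Y2).trans hY2
  have t0 := Th_mul_le ν h1 h2 hZ1 hZ2 (a := m1) (b := m2) (p := G 0) 0 0 (by simpa using a0) (by simpa using b0) (w := 1)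
    (by simpa using ν2.one')
  have t1 := Th_mul_le ν h1 h2 hZ1 hZ2 (a := m1) (b := m2) (p := G 1) 3 0 (by simpa using a1) (by simpa using b1) (w := in1 Y1)
    (by simpa using hy1)
  have t2 := Th_mul_le ν h1 h2 hZ1 hZ2 (a := m1) (b := m2) (p := G 2) 0 3 (by simpa using a2) (by simpa using b2) (w := in2 Y2)
    (by simpa using hy2)
  have t3 := Th_mul_le ν h1 h2 hZ1 hZ2 (a := m1) (b := m2) (p := G 3) 3 3 (by simpa using a3) (by simpa using b3) (w := in1 Y1 * in2 Y2)
    ((ν2.mul' _ _).trans (mul_le_mul' hy1 hy2))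
  rw [mul_one] at t0
  have key : ∀ i, A1 ^ m1 * A2 ^ m2 * N2 ν (G i) ≤ ecst u 1 * (A1 ^ m1 * A2 ^ m2 * QN ν G) := fun i => by
    have := le_QN ν G i
    have e : ecst u 1 = 1 := by unfold ecst; split <;> rfl
    rw [e, one_mul]
    gcongr
  have s1 := (ν2.add' (Th Z1 Z2 (G 0)) (Th Z1 Z2 (G 1) * in1 Y1)).trans (oadd_le' (t0.trans (key 0)) (t1.trans (key 1)))
  have s2 := (ν2.add' _ (Th Z1 Z2 (G 2) * in2 Y2)).trans (oadd_le' s1 (t2.trans (key 2)))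
  have s3 := (ν2.add' _ (Th Z1 Z2 (G 3) * (in1 Y1 * in2 Y2))).trans (oadd_le' s2 (t3.trans (key 3)))
  have e : (1 + 1 + 1 + 1 : ℝ≥0∞) = 4 := by norm_num
  rw [e] at s3
  exact s3
end

lemma cf_le {K : Type*} [Field K] {u : Bool} (ν : SubNorm u K) {A1 A2 : ℝ≥0∞} (h1 : 1 ≤ A1) (h2 : 1 ≤ A2) (h1t : A1 ≠ ⊤) (h2t : A2 ≠ ⊤)
    (f : L2 K) (i j : ℕ) : ν (cf i j f) ≤ (ν.ps (A1⁻¹ ^ 5)).ps (A2⁻¹ ^ 5) f * A1 ^ (5 * i) * A2 ^ (5 * j) := by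
  have e1 := (ν.ps (A1⁻¹ ^ 5)).coeff_le_ps (A2⁻¹ ^ 5) f j
  have e2 := ν.coeff_le_ps (A1⁻¹ ^ 5) (PowerSeries.coeff j f) i
  have c1 : (A1⁻¹ ^ 5) ^ i * A1 ^ (5 * i) = 1 := by
    rw [← pow_mul, ← mul_pow, ENNReal.inv_mul_cancel (by positivity) h1t, one_pow]
  have c2 : (A2⁻¹ ^ 5) ^ j * A2 ^ (5 * j) = 1 := by
    rw [← pow_mul, ← mul_pow, ENNReal.inv_mul_cancel (by positivity) h2t, one_pow]
  calc ν (cf i j f) = (ν (cf i j f) * (A1⁻¹ ^ 5) ^ i) * (A2⁻¹ ^ 5) ^ j * A1 ^ (5 * i) * A2 ^ (5 * j) := by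
        calc _ = ν (cf i j f) * 1 * 1 := by simp
          _ = ν (cf i j f) * ((A1⁻¹ ^ 5) ^ i * A1 ^ (5 * i)) * ((A2⁻¹ ^ 5) ^ j * A2 ^ (5 * j)) := by rw [c1, c2]
          _ = _ := by ring
    _ ≤ ((ν.ps (A1⁻¹ ^ 5)) (PowerSeries.coeff j f)) * (A2⁻¹ ^ 5) ^ j * A1 ^ (5 * i) * A2 ^ (5 * j) := by
        gcongr
        exact e2
    _ ≤ _ := by gcongr
end
end Mord

set_option linter.unusedSectionVars false
set_option linter.style.longLine false

namespace Mord
open scoped ENNReal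
open Height

noncomputable section

section
variable {K : Type*} [Field K] [NumberField K]

def box (w z1 z2 : K) (n1 n2 : ℕ) : Fin 2 × Fin 2 → K := w • fun a => (![z1, 1] ^ n1 : Fin 2 → K) a.1 * (![z2, 1] ^ n2 : Fin 2 → K) a.2

lemma vec1_ne (z : K) (n : ℕ) : (![z, 1] ^ n : Fin 2 → K) ≠ 0 := fun h => by
  have := congrFun h 1
  simp at this

lemma box_ne {w : K} (hw : w ≠ 0) (z1 z2 : K) (n1 n2 : ℕ) : box w z1 z2 n1 n2 ≠ 0 := fun h => by
  have := congrFun h (1, 1)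
  simp [box, hw] at this

lemma logHeight_box {w : K} (hw : w ≠ 0) (z1 z2 : K) (n1 n2 : ℕ) :
    logHeight (box w z1 z2 n1 n2) = n1 * logHeight₁ z1 + n2 * logHeight₁ z2 := by
  rw [box, logHeight_smul_eq_logHeight _ hw, logHeight_fun_mul_eq (vec1_ne _ _) (vec1_ne _ _), logHeight_pow, logHeight_pow,
    ← logHeight₁_eq_logHeight, ← logHeight₁_eq_logHeight]

lemma max_pow_mem (v : AbsoluteValue K ℝ) (z : K) (n : ℕ) : ∃ a : Fin 2, max 1 (v z) ^ n = v ((![z, 1] ^ n : Fin 2 → K) a) := by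
  rcases le_total 1 (v z) with h | h
  · exact ⟨0, by simp [max_eq_right h]⟩
  · exact ⟨1, by simp [max_eq_left h]⟩

lemma le_box (v : AbsoluteValue K ℝ) (w z1 z2 : K) (n1 n2 : ℕ) :
    v w * (max 1 (v z1) ^ n1 * max 1 (v z2) ^ n2) ≤ ⨆ a, v (box w z1 z2 n1 n2 a) := by
  obtain ⟨a, ha⟩ := max_pow_mem v z1 n1
  obtain ⟨b, hb⟩ := max_pow_mem v z2 n2
  rw [ha, hb, ← map_mul, ← map_mul]
  exact Finite.le_ciSup (fun a => v (box w z1 z2 n1 n2 a)) (a, b)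

lemma box_le (v : AbsoluteValue K ℝ) (w z1 z2 : K) (n1 n2 : ℕ) (a : Fin 2 × Fin 2) :
    v (box w z1 z2 n1 n2 a) ≤ v w * (max 1 (v z1) ^ n1 * max 1 (v z2) ^ n2) := by
  obtain ⟨a, b⟩ := a
  have key : ∀ (z : K) (n : ℕ) (a : Fin 2), v ((![z, 1] ^ n : Fin 2 → K) a) ≤ max 1 (v z) ^ n := by
    intro z n a
    fin_cases a
    · simp only [Pi.pow_apply, map_pow]
      exact pow_le_pow_left₀ (v.nonneg _) (le_max_right _ _) _
    · simpa using one_le_pow₀ (le_max_left 1 (v z))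
  simp only [box, Pi.smul_apply, smul_eq_mul, map_mul]
  gcongr
  · exact key _ _ _
  · exact key _ _ _

/-- the Vojta vector -/
def mv (z1 y1 z2 y2 : K) : Fin 6 → K :=
  ![z1 - z2, (z1 - z2) * z1 ^ 2, (z1 - z2) * z2 ^ 2, (z1 - z2) * (z1 ^ 2 * z2 ^ 2), y1 + y2, y1 * z2 ^ 3 + y2 * z1 ^ 3]

lemma mv_ne {z1 z2 : K} (h : z1 ≠ z2) (y1 y2 : K) : mv z1 y1 z2 y2 ≠ 0 := fun e => by
  have := congrFun e 0
  simp [mv, sub_eq_zero, h] at this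

lemma plN_mul {u : Bool} {v : AbsoluteValue K ℝ} (h : Pl u v) (x y : K) : plN h (x * y) = plN h x * plN h y := by
  rw [plN_apply, plN_apply, plN_apply, map_mul, ENNReal.ofReal_mul (v.nonneg _)]
lemma plN_pow {u : Bool} {v : AbsoluteValue K ℝ} (h : Pl u v) (x : K) (n : ℕ) : plN h (x ^ n) = plN h x ^ n := by
  rw [plN_apply, plN_apply, map_pow, ENNReal.ofReal_pow (v.nonneg _)]

theorem vojta_key {F : Polynomial K} (hF : F.natDegree ≤ 6) {CF : ℕ} (hB : Bd F CF) : ∃ c : ℕ, 1 ≤ c ∧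
    ∀ z1 y1 z2 y2 : K, y1 ^ 2 = F.eval z1 → y2 ^ 2 = F.eval z2 → y1 ≠ 0 → y2 ≠ 0 → z1 ≠ z2 →
    ∀ (m1 m2 d : ℕ) (S : ℝ), 1 ≤ S → ∀ (A : Aux F m1 m2 d S) (D1 D2 : ℕ), 0 < D1 → 0 < D2 → ∀ θ : ℝ,
    ¬ Ix (1 / D1) (1 / D2) θ (sh z1 z2 A.R) →
    ∃ i j : ℕ, (i : ℝ) / D1 + j / D2 < θ ∧
      d * logHeight (mv z1 y1 z2 y2) ≤ (m1 + 2 * d + 5 * i) * logHeight₁ z1 + (m2 + 2 * d + 5 * j) * logHeight₁ z2 +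
        totalWeight K * (Real.log 4 + Real.log S + (m1 + m2 + 4 * d + 5 * i + 5 * j) * Real.log c) := by
  obtain ⟨c, hc, hloc⟩ := local_exp hF hB
  refine ⟨c, hc, ?_⟩
  intro z1 y1 z2 y2 e1 e2 hy1 hy2 hz m1 m2 d S hS A D1 D2 hD1 hD2 θ hI
  obtain ⟨Y1, c1, q1, n1⟩ := hloc z1 y1 e1
  obtain ⟨Y2, c2, q2, n2⟩ := hloc z2 y2 e2
  set Z1 : PowerSeries K := PowerSeries.C z1 + PowerSeries.C (4 * y1 ^ 2) * PowerSeries.X with hZ1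
  set Z2 : PowerSeries K := PowerSeries.C z2 + PowerSeries.C (4 * y2 ^ 2) * PowerSeries.X with hZ2
  unfold Ix at hI
  push Not at hI
  obtain ⟨i', j', hne, hlt⟩ := hI
  have h40 : (4 : K) ≠ 0 := by norm_num
  have hcf : cf i' j' (Th Z1 Z2 A.R) ≠ 0 := by
    rw [hZ1, hZ2, cf_Th]
    refine mul_ne_zero (mul_ne_zero ?_ ?_) hne <;> exact pow_ne_zero _ (mul_ne_zero h40 (pow_ne_zero _ ‹_›))
  have hTh : Th Z1 Z2 (Polynomial.X - Polynomial.C Polynomial.X) = in2 Z2 - in1 Z1 := by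
    rw [map_sub, Th_z1, Th_z2]
  have c0Z1 : c0 (in1 Z1) = z1 := by simp [c0, hZ1]
  have c0Z2 : c0 (in2 Z2) = z2 := by
    rw [c0, RingHom.comp_apply, ← PowerSeries.coeff_zero_eq_constantCoeff_apply (R := PowerSeries K), PowerSeries.coeff_map]; simp [hZ2]
  have c0Y1 : c0 (in1 Y1) = y1 := by simp [c0, c1]
  have c0Y2 : c0 (in2 Y2) = y2 := by
    rw [c0, RingHom.comp_apply, ← PowerSeries.coeff_zero_eq_constantCoeff_apply (R := PowerSeries K), PowerSeries.coeff_map]; simp [c2]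
  have hT0 : c0 (Th Z1 Z2 (Polynomial.X - Polynomial.C Polynomial.X)) = z2 - z1 := by
    rw [hTh, map_sub, c0Z1, c0Z2]
  have hz' : z2 - z1 ≠ 0 := sub_ne_zero.2 (Ne.symm hz)
  have hdvd : Lam Z1 Z2 Y1 Y2 A.G ∣ Th Z1 Z2 A.R := by
    have h1 := Lam_dvd_Nm q1 q2 A.G
    rw [A.hR, map_mul, map_pow] at h1
    have hu : IsUnit (Th Z1 Z2 (Polynomial.X - Polynomial.C Polynomial.X) ^ (2 * d)) :=
      (isUnit_L2 (by rw [hT0]; exact hz')).pow _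
    exact (hu.dvd_mul_left).1 h1
  obtain ⟨i, j, hg, hmin, hle⟩ := exists_min (a := D2) (b := D1) hdvd hcf
  refine ⟨i, j, ?_, ?_⟩
  · have hD1' : (0 : ℝ) < D1 := by exact_mod_cast hD1
    have hD2' : (0 : ℝ) < D2 := by exact_mod_cast hD2
    have hle' : (D2 : ℝ) * i + D1 * j ≤ D2 * i' + D1 * j' := by exact_mod_cast hle
    have a1 : (i : ℝ) / D1 + j / D2 = (D2 * i + D1 * j) / (D1 * D2) := by field_simp
    have a2 : 1 / (D1 : ℝ) * i' + 1 / D2 * j' = (D2 * i' + D1 * j') / (D1 * D2) := by field_simp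
    rw [a1]
    rw [a2] at hlt
    refine lt_of_le_of_lt ?_ hlt
    gcongr
  set g := cf i j (Lam Z1 Z2 Y1 Y2 A.G) with hgdef
  have hH : g * (y1 + y2) ^ d = cf i j (Lam Z1 Z2 Y1 Y2 A.H) * (z2 - z1) ^ d := by
    have h1 := Lam_Tpow q1 q2 A.G d
    rw [A.hH, Lam_smul q1 q2, map_pow] at h1
    have := cf_eq_of_mul_eq hD2 hD1 hmin (by rw [map_pow, hT0]; exact pow_ne_zero _ hz') h1.symm
    rwa [map_pow, map_pow, hT0, map_add, c0Y1, c0Y2] at this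
  have hJ : g * (y1 * z2 ^ 3 + y2 * z1 ^ 3) ^ d = cf i j (Lam Z1 Z2 Y1 Y2 A.J) * (z2 - z1) ^ d := by
    have h1 := Lam_T'pow q1 q2 A.G d
    rw [A.hJ, Lam_smul q1 q2, map_pow] at h1
    have := cf_eq_of_mul_eq hD2 hD1 hmin (by rw [map_pow, hT0]; exact pow_ne_zero _ hz') h1.symm
    rwa [map_pow, map_pow, hT0, map_add, map_mul, map_mul, map_pow, map_pow, c0Y1, c0Y2, c0Z1, c0Z2] at this
  set N1 := m1 + 2 * d + 5 * i with hN1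
  set N2' := m2 + 2 * d + 5 * j with hN2
  have hcR : (1 : ℝ) ≤ c := by exact_mod_cast hc
  have hzz : (z1 - z2) ^ d ≠ 0 := pow_ne_zero _ (sub_ne_zero.2 hz)
  have main : logHeight (g • (mv z1 y1 z2 y2) ^ d) ≤ logHeight (box ((z1 - z2) ^ d) z1 z2 N1 N2') +
      totalWeight K * Real.log (4 * S * (c : ℝ) ^ (N1 + N2')) := by
    refine logHeight_le_of_local ?_ (box_ne hzz _ _ _ _) ?_ ?_
    · intro e
      have := congrFun e 0
      simp only [Pi.smul_apply, Pi.pow_apply, mv, Matrix.cons_val, Pi.zero_apply, smul_eq_mul] at this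
      exact mul_ne_zero hg hzz this
    · have := one_le_pow₀ hcR (n := N1 + N2')
      nlinarith
    intro u v h k
    set A1 := szA c u v z1 with hA1
    set A2 := szA c u v z2 with hA2
    have o1 : 1 ≤ A1 := one_le_szA hc _ _ _
    have o2 : 1 ≤ A2 := one_le_szA hc _ _ _
    have t1 : A1 ≠ ⊤ := szA_ne_top _ _ _ _
    have t2 : A2 ≠ ⊤ := szA_ne_top _ _ _ _
    have hc1 : (1 : ℝ≥0∞) ≤ (c : ℝ≥0∞) := by exact_mod_cast hc
    have hv1 : plN h z1 ≤ A1 := by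
      rw [plN_apply]
      calc ENNReal.ofReal (v z1) ≤ 1 * ENNReal.ofReal (max 1 (v z1)) := by
            rw [one_mul]; exact ENNReal.ofReal_le_ofReal (le_max_right _ _)
        _ ≤ _ := mul_le_mul' (one_le_ecst hc1) le_rfl
    have hv2 : plN h z2 ≤ A2 := by
      rw [plN_apply]
      calc ENNReal.ofReal (v z2) ≤ 1 * ENNReal.ofReal (max 1 (v z2)) := by
            rw [one_mul]; exact ENNReal.ofReal_le_ofReal (le_max_right _ _)
        _ ≤ _ := mul_le_mul' (one_le_ecst hc1) le_rfl
    obtain ⟨nZ1, nY1⟩ := n1 u v h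
    obtain ⟨nZ2, nY2⟩ := n2 u v h
    have bG : plN h g ≤ ecst u 4 * (A1 ^ m1 * A2 ^ m2 * ecst u (ENNReal.ofReal S)) * A1 ^ (5 * i) * A2 ^ (5 * j) := by
      refine (cf_le (plN h) o1 o2 t1 t2 _ i j).trans ?_
      gcongr
      refine (Lam_le (plN h) o1 o2 nZ1 nZ2 nY1 nY2 A.G1 A.G2).trans ?_
      gcongr
      exact A.sG u v h
    have bH : plN h (cf i j (Lam Z1 Z2 Y1 Y2 A.H)) ≤
        ecst u 4 * (A1 ^ (m1 + 2 * d) * A2 ^ (m2 + 2 * d) * ecst u (ENNReal.ofReal S)) * A1 ^ (5 * i) * A2 ^ (5 * j) := by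
      refine (cf_le (plN h) o1 o2 t1 t2 _ i j).trans ?_
      gcongr
      refine (Lam_le (plN h) o1 o2 nZ1 nZ2 nY1 nY2 (m1 := m1 + 2 * d) (m2 := m2 + 2 * d) (by exact_mod_cast A.H1) (by exact_mod_cast A.H2)).trans ?_
      gcongr
      exact A.sH u v h
    have bJ : plN h (cf i j (Lam Z1 Z2 Y1 Y2 A.J)) ≤
        ecst u 4 * (A1 ^ (m1 + 2 * d) * A2 ^ (m2 + 2 * d) * ecst u (ENNReal.ofReal S)) * A1 ^ (5 * i) * A2 ^ (5 * j) := by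
      refine (cf_le (plN h) o1 o2 t1 t2 _ i j).trans ?_
      gcongr
      refine (Lam_le (plN h) o1 o2 nZ1 nZ2 nY1 nY2 (m1 := m1 + 2 * d) (m2 := m2 + 2 * d) (by exact_mod_cast A.J1) (by exact_mod_cast A.J2)).trans ?_
      gcongr
      exact A.sJ u v h
    set P : ℝ≥0∞ := ecst u 4 * (A1 ^ N1 * A2 ^ N2' * ecst u (ENNReal.ofReal S)) with hP
    have hP1 : ecst u 4 * (A1 ^ (m1 + 2 * d) * A2 ^ (m2 + 2 * d) * ecst u (ENNReal.ofReal S)) * A1 ^ (5 * i) * A2 ^ (5 * j) = P := by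
      rw [hP, hN1, hN2]; ring
    rw [hP1] at bH bJ
    have hneg : plN h ((z2 - z1) ^ d) = plN h ((z1 - z2) ^ d) := by
      rw [plN_pow, plN_pow, ← neg_sub z1 z2, SubNorm.neg']
    have small : ∀ q : K, plN h q ≤ A1 ^ 2 * A2 ^ 2 → plN h (g * ((z1 - z2) * q) ^ d) ≤ plN h ((z1 - z2) ^ d) * P := by
      intro q hq
      rw [mul_pow, mul_left_comm, plN_mul, plN_mul, plN_pow h q]
      gcongr
      rw [← hP1]
      calc plN h g * plN h q ^ d ≤ (ecst u 4 * (A1 ^ m1 * A2 ^ m2 * ecst u (ENNReal.ofReal S)) * A1 ^ (5 * i) * A2 ^ (5 * j)) * (A1 ^ 2 * A2 ^ 2) ^ d := by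
            gcongr
        _ = _ := by ring
    have fin : plN h ((g • (mv z1 y1 z2 y2) ^ d) k) ≤ plN h ((z1 - z2) ^ d) * P := by
      simp only [Pi.smul_apply, Pi.pow_apply, smul_eq_mul]
      have o1' := one_le_pow₀ o1 (n := 2)
      have o2' := one_le_pow₀ o2 (n := 2)
      have w1 : plN h (z1 ^ 2) ≤ A1 ^ 2 := by rw [plN_pow]; gcongr
      have w2 : plN h (z2 ^ 2) ≤ A2 ^ 2 := by rw [plN_pow]; gcongr
      fin_cases k
      · have := small 1 ((plN h).one'.trans (one_le_mul_of_one_le_of_one_le o1' o2'))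
        simpa [mv] using this
      · have := small (z1 ^ 2) (w1.trans (by simpa using mul_le_mul' (le_refl (A1 ^ 2)) o2'))
        simpa [mv] using this
      · have := small (z2 ^ 2) (w2.trans (by simpa using mul_le_mul' o1' (le_refl (A2 ^ 2))))
        simpa [mv] using this
      · have := small (z1 ^ 2 * z2 ^ 2) (by rw [plN_mul]; gcongr)
        simpa [mv] using this
      · show plN h (g * (y1 + y2) ^ d) ≤ _
        rw [hH, plN_mul, hneg, mul_comm]
        gcongr
      · show plN h (g * (y1 * z2 ^ 3 + y2 * z1 ^ 3) ^ d) ≤ _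
        rw [hJ, plN_mul, hneg, mul_comm]
        gcongr
    have hPe : P = ecst u (ENNReal.ofReal (4 * S * (c : ℝ) ^ (N1 + N2'))) * ENNReal.ofReal (max 1 (v z1) ^ N1 * max 1 (v z2) ^ N2') := by
      have hc' : ENNReal.ofReal (c : ℝ) = (c : ℝ≥0∞) := by simp
      rw [hP, hA1, hA2]
      unfold szA
      rw [ENNReal.ofReal_mul (by positivity), ENNReal.ofReal_mul (by positivity), ENNReal.ofReal_mul (by positivity),
        ENNReal.ofReal_pow (by positivity), ENNReal.ofReal_pow (by positivity), ENNReal.ofReal_pow (by positivity), hc',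
        ecst_mul, ecst_mul, ecst_pow]
      have h4 : ENNReal.ofReal 4 = 4 := by simp
      rw [h4]
      ring
    rw [hPe, plN_apply, plN_apply, ecst_ofReal, ← ENNReal.ofReal_mul' (by positivity), ← ENNReal.ofReal_mul (by positivity),
      ENNReal.ofReal_le_ofReal_iff'] at fin
    have hlb := le_box v ((z1 - z2) ^ d) z1 z2 N1 N2'
    have hcst : 0 ≤ cst u (4 * S * (c : ℝ) ^ (N1 + N2')) := by unfold cst; split <;> positivity
    have fin2 : v ((g • (mv z1 y1 z2 y2) ^ d) k) ≤ cst u (4 * S * (c : ℝ) ^ (N1 + N2')) *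
        (v ((z1 - z2) ^ d) * (max 1 (v z1) ^ N1 * max 1 (v z2) ^ N2')) := by
      rcases fin with f | f
      · refine f.trans (le_of_eq (by ring))
      · refine f.trans (by positivity)
    exact fin2.trans (mul_le_mul_of_nonneg_left hlb hcst)
  rw [logHeight_smul_eq_logHeight _ hg, logHeight_pow, logHeight_box hzz] at main
  have hcp : (0 : ℝ) < c := by linarith
  rw [Real.log_mul (by positivity) (by positivity), Real.log_mul (by positivity) (by positivity), Real.log_pow] at main
  rw [hN1, hN2] at main
  push_cast at main
  refine main.trans (le_of_eq ?_)
  ring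
end
end
end Mord

set_option linter.unusedSectionVars false
set_option linter.style.longLine false

namespace Mord
open scoped ENNReal
open Height

noncomputable section

lemma logS_bound (CF : ℕ) (hCF : 1 ≤ CF) (c : ℝ) (hc : 1 ≤ c) : ∃ C : ℝ, 0 ≤ C ∧ ∀ (m2 d p q : ℕ) (s S : ℝ), 1 ≤ s → 1 ≤ d → p < q → s ≤ d →
    (p : ℝ) ≤ 24 * s * (q - p) → (q : ℝ) ≤ 16 * s * d ^ 2 → (m2 : ℝ) ≤ 2 * d →
    S = 32 * (4 * CF) ^ (5 + 4 * m2 + 5 * d) * (q * (c * (c * q * (4 * CF) ^ (m2 + 3 * d)) ^ ((p : ℝ) / (q - p)))) ^ 4 →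
    1 ≤ S ∧ Real.log S ≤ C * (s * d) := by
  set L := Real.log (4 * CF) with hL
  have hCF' : (1 : ℝ) ≤ CF := by exact_mod_cast hCF
  have hL0 : 0 ≤ L := Real.log_nonneg (by linarith)
  have hlc : 0 ≤ Real.log c := Real.log_nonneg hc
  refine ⟨Real.log 32 + 18 * L + 4 * (19 + Real.log c + 24 * (Real.log c + 19 + 5 * L)), by
    have := Real.log_nonneg (show (1 : ℝ) ≤ 32 by norm_num); positivity, ?_⟩
  intro m2 d p q s S hs hd hpq hsd hp hq hm2 hS
  have hd' : (1 : ℝ) ≤ d := by exact_mod_cast hd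
  have hq1 : (1 : ℝ) ≤ q := by exact_mod_cast (by omega : 1 ≤ q)
  have hpq' : (p : ℝ) < q := by exact_mod_cast hpq
  have hqp : (0 : ℝ) < q - p := by linarith
  set e := (p : ℝ) / (q - p) with he
  have he0 : 0 ≤ e := by positivity
  have he1 : e ≤ 24 * s := by rw [he, div_le_iff₀ hqp]; exact hp
  have h4 : (1 : ℝ) ≤ 4 * CF := by linarith
  set B := c * q * (4 * (CF : ℝ)) ^ (m2 + 3 * d) with hB
  have hB1 : 1 ≤ B := by
    have := one_le_pow₀ h4 (n := m2 + 3 * d)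
    have h2 : 1 ≤ c * q := one_le_mul_of_one_le_of_one_le hc hq1
    exact one_le_mul_of_one_le_of_one_le h2 this
  have hBe : 1 ≤ B ^ e := Real.one_le_rpow hB1 he0
  have hin : 1 ≤ (q : ℝ) * (c * B ^ e) := one_le_mul_of_one_le_of_one_le hq1 (one_le_mul_of_one_le_of_one_le hc hBe)
  constructor
  · rw [hS]
    have := one_le_pow₀ h4 (n := 5 + 4 * m2 + 5 * d)
    have h2 := one_le_pow₀ hin (n := 4)
    exact one_le_mul_of_one_le_of_one_le (by linarith) h2
  · have hlq : Real.log q ≤ 19 * d := by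
      have h1 : Real.log q ≤ Real.log (16 * d ^ 3) := by
        refine Real.log_le_log (by linarith) (hq.trans ?_)
        nlinarith [mul_le_mul_of_nonneg_right hsd (by positivity : (0 : ℝ) ≤ 16 * d ^ 2)]
      rw [Real.log_mul (by norm_num) (by positivity), Real.log_pow] at h1
      have h2 : Real.log d ≤ d - 1 := Real.log_le_sub_one_of_pos (by linarith)
      have h3 : Real.log 16 ≤ 16 - 1 := Real.log_le_sub_one_of_pos (by norm_num)
      push_cast at h1
      linarith
    have hlB : Real.log B ≤ (Real.log c + 19 + 5 * L) * d := by
      rw [hB, Real.log_mul (by positivity) (by positivity), Real.log_mul (by positivity) (by positivity), Real.log_pow]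
      push_cast
      rw [← hL]
      nlinarith [mul_le_mul_of_nonneg_right hm2 hL0, mul_le_mul_of_nonneg_left hd' hlc]
    have hlB0 : 0 ≤ Real.log B := Real.log_nonneg hB1
    rw [hS, Real.log_mul (by positivity) (by positivity), Real.log_mul (by positivity) (by positivity), Real.log_pow, Real.log_pow, ← hL,
      Real.log_mul (by positivity) (by positivity), Real.log_mul (by positivity) (by positivity), Real.log_rpow (by linarith)]
    push_cast
    have hsd1 : (d : ℝ) ≤ s * d := by nlinarith
    have hsd2 : (1 : ℝ) ≤ s * d := by linarith
    have a1 : Real.log 32 ≤ Real.log 32 * (s * d) := le_mul_of_one_le_right (Real.log_nonneg (by norm_num)) hsd2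
    have a2 : (5 + 4 * m2 + 5 * d) * L ≤ 18 * L * (s * d) := by
      nlinarith [mul_le_mul_of_nonneg_right hm2 hL0, mul_le_mul_of_nonneg_left hsd1 hL0, mul_le_mul_of_nonneg_left hsd2 hL0]
    have a3 : Real.log q ≤ 19 * (s * d) := by linarith
    have a4 : Real.log c ≤ Real.log c * (s * d) := le_mul_of_one_le_right hlc hsd2
    have a5 : e * Real.log B ≤ 24 * (Real.log c + 19 + 5 * L) * (s * d) := by
      calc e * Real.log B ≤ (24 * s) * ((Real.log c + 19 + 5 * L) * d) := by gcongr
        _ = _ := by ring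
    linarith

variable {K : Type*} [Field K] [NumberField K]

set_option maxHeartbeats 1000000 in
theorem vojta {F F' : Polynomial K} {r : K} (hfac : F = (Polynomial.X - Polynomial.C r) * F') (hr : F'.eval r ≠ 0) (hF : F.natDegree ≤ 6)
    {CF : ℕ} (hB : Bd F CF) : ∃ H0 s0 : ℝ, 1 ≤ H0 ∧ 1 ≤ s0 ∧ ∀ z1 y1 z2 y2 : K, y1 ^ 2 = F.eval z1 → y2 ^ 2 = F.eval z2 → y1 ≠ 0 → y2 ≠ 0 → z1 ≠ z2 →
      H0 ≤ logHeight₁ z1 → ∀ s : ℝ, s0 ≤ s → logHeight₁ z2 = s ^ 2 * logHeight₁ z1 →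
      logHeight (mv z1 y1 z2 y2) ≤ 5 / 2 * (logHeight₁ z1 + logHeight₁ z2) + 1.96 * (s * logHeight₁ z1) := by
  obtain ⟨c1, hc1, haux⟩ := aux_exists' hfac hr hF hB
  obtain ⟨c2, hc2, hkey⟩ := vojta_key hF hB
  obtain ⟨C, hC, hlogS⟩ := logS_bound CF hB.1 c1 hc1
  set w : ℝ := ((totalWeight K : ℕ) : ℝ) with hw
  have hw0 : 0 ≤ w := by positivity
  have hc2' : (1 : ℝ) ≤ c2 := by exact_mod_cast hc2
  have hlc2 : 0 ≤ Real.log c2 := Real.log_nonneg hc2'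
  refine ⟨1 + 10000000 * (w * (20 + C)) + 100 * (w * (Real.log 4 + C + 20 * Real.log c2)), 50, ?_, by norm_num, ?_⟩
  · have := Real.log_nonneg (show (1 : ℝ) ≤ 4 by norm_num)
    have : 0 ≤ w * (20 + C) := by positivity
    have : 0 ≤ w * (Real.log 4 + C + 20 * Real.log c2) := by positivity
    linarith
  intro z1 y1 z2 y2 e1 e2 hy1 hy2 hz hH s hs hh
  set h1 := logHeight₁ z1 with hh1
  have hl4 := Real.log_nonneg (show (1 : ℝ) ≤ 4 by norm_num)
  have hwa : 0 ≤ w * (20 + C) := by positivity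
  have hwb : 0 ≤ w * (Real.log 4 + C + 20 * Real.log c2) := by positivity
  have h1p : 1 ≤ h1 := by linarith
  have hs0 : 0 < s := by linarith
  -- parameters
  obtain ⟨d, hd⟩ : ∃ d : ℕ, 1000 * s ≤ d := exists_nat_ge _
  set t : ℝ := d / s with ht
  have hst : s * t = d := by rw [ht]; field_simp
  have htp : 1000 ≤ t := by rw [ht, le_div_iff₀ hs0]; exact hd
  have hdp : (50000 : ℝ) ≤ d := by linarith
  have htd : t * 50 ≤ d := by linarith [mul_le_mul_of_nonneg_right hs (by linarith : 0 ≤ t)]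
  have hdsd : (d : ℝ) * 50 ≤ s * d := by linarith [mul_le_mul_of_nonneg_right hs (by linarith : 0 ≤ (d : ℝ))]
  have hd2s : (d : ℝ) ^ 2 * 50 ≤ s * d ^ 2 := by linarith [mul_le_mul_of_nonneg_right hs (by positivity : 0 ≤ (d : ℝ) ^ 2)]
  obtain ⟨m1, hm1, hm1'⟩ : ∃ m : ℕ, 0.95 * (s * d) + 0.5 * d ≤ m ∧ (m : ℝ) ≤ 0.95 * (s * d) + 0.5 * d + 1 :=
    ⟨⌈0.95 * (s * d) + 0.5 * (d : ℝ)⌉₊, Nat.le_ceil _, (Nat.ceil_lt_add_one (by positivity)).le⟩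
  obtain ⟨m2, hm2, hm2'⟩ : ∃ m : ℕ, 0.95 * t + 0.5 * d ≤ m ∧ (m : ℝ) ≤ 0.95 * t + 0.5 * d + 1 :=
    ⟨⌈0.95 * t + 0.5 * (d : ℝ)⌉₊, Nat.le_ceil _, (Nat.ceil_lt_add_one (by positivity)).le⟩
  have hm1R : (2 : ℝ) ≤ m1 := by linarith
  have hm2R : (2 : ℝ) ≤ m2 := by linarith
  have hm1N : 2 ≤ m1 := by exact_mod_cast hm1R
  have hm2N : 2 ≤ m2 := by exact_mod_cast hm2R
  have hd1 : 1 ≤ d := by have : (1 : ℝ) ≤ d := by linarith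
                         exact_mod_cast this
  obtain ⟨p, hp⟩ : ∃ p : ℕ, p + 3 * d = 2 * d * (m1 + m2) + 2 * d ^ 2 := by
    refine ⟨2 * d * (m1 + m2) + 2 * d ^ 2 - 3 * d, Nat.sub_add_cancel ?_⟩
    have := Nat.mul_le_mul_left d (show 3 ≤ 2 * (m1 + m2) by omega)
    linarith [Nat.zero_le (2 * d ^ 2)]
  set q := (2 * m1 - 1) * (2 * m2 - 1) with hq
  have hqR : (q : ℝ) = (2 * m1 - 1) * (2 * m2 - 1) := by
    rw [hq, Nat.cast_mul, Nat.cast_sub (by omega), Nat.cast_sub (by omega)]; push_cast; ring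
  have hpR : (p : ℝ) + 3 * d = 2 * d * (m1 + m2) + 2 * d ^ 2 := by exact_mod_cast hp
  have hm1s : (m1 : ℝ) ≤ 2 * (s * d) := by linarith
  have hm2s : (m2 : ℝ) ≤ 2 * d := by linarith
  have hprod : 3.61 * (d : ℝ) ^ 2 ≤ (2 * m1 - d) * (2 * m2 - d) := by
    have a1 : 1.9 * (s * d) ≤ 2 * m1 - d := by linarith
    have a2 : 1.9 * t ≤ 2 * (m2 : ℝ) - d := by linarith
    have := mul_le_mul a1 a2 (by positivity) (by linarith [show 0 ≤ s * (d : ℝ) by positivity])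
    have e : 1.9 * (s * d) * (1.9 * t) = 3.61 * (s * t) * d := by ring
    rw [e, hst] at this
    linarith
  have hsdd : 1000 * (s * d) ≤ (d : ℝ) ^ 2 := by linarith [mul_le_mul_of_nonneg_right hd (by linarith : 0 ≤ (d : ℝ))]
  have hqp : 0.5 * (d : ℝ) ^ 2 ≤ q - p := by
    have e : (q : ℝ) - p = (2 * m1 - d) * (2 * m2 - d) - 3 * d ^ 2 - 2 * (m1 + m2) + 1 + 3 * d := by
      rw [hqR]; linear_combination -hpR
    rw [e]; linarith
  have hpq : p < q := by
    have hd2p : 0 < (d : ℝ) ^ 2 := by positivity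
    have : (p : ℝ) < q := by linarith
    exact_mod_cast this
  obtain ⟨S, hS⟩ : ∃ S : ℝ, S = 32 * (4 * CF) ^ (5 + 4 * m2 + 5 * d) * (q * (c1 * (c1 * q * (4 * CF) ^ (m2 + 3 * d)) ^ ((p : ℝ) / (q - p)))) ^ 4 := ⟨_, rfl⟩
  have hp24 : (p : ℝ) ≤ 24 * s * (q - p) := by
    have a1 : (p : ℝ) ≤ 12 * (s * d ^ 2) := by
      have : (d : ℝ) * (m1 + m2) ≤ d * (2 * (s * d) + 2 * d) := by gcongr
      linarith
    linarith [mul_le_mul_of_nonneg_left hqp (by positivity : 0 ≤ 24 * s)]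
  have hq16 : (q : ℝ) ≤ 16 * s * d ^ 2 := by
    rw [hqR]
    have := mul_le_mul hm1s hm2s (by positivity) (by positivity)
    linarith
  obtain ⟨hS1, hSl⟩ := hlogS m2 d p q s S (by linarith) hd1 hpq (by linarith) hp24 hq16 hm2s hS
  obtain ⟨A⟩ := haux m1 m2 d p q S hm1N hm2N hp hq hpq hS
  -- bidegree of R
  have hDle : 2 * d ≤ 4 * m1 ∧ 2 * d ≤ 4 * m2 := by
    constructor
    · have : 2 * (d : ℝ) ≤ 4 * m1 := by linarith
      exact_mod_cast this
    · have : 2 * (d : ℝ) ≤ 4 * m2 := by linarith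
      exact_mod_cast this
  set D1 := 4 * m1 - 2 * d with hD1
  set D2 := 4 * m2 - 2 * d with hD2
  have hD1R : (D1 : ℝ) = 4 * m1 - 2 * d := by rw [hD1, Nat.cast_sub hDle.1]; push_cast; ring
  have hD2R : (D2 : ℝ) = 4 * m2 - 2 * d := by rw [hD2, Nat.cast_sub hDle.2]; push_cast; ring
  have hD1a : 3.8 * (s * d) ≤ D1 := by rw [hD1R]; linarith
  have hD2a : 3.8 * t ≤ D2 := by rw [hD2R]; linarith
  have hD1b : (D1 : ℝ) ≤ 4 * (s * d) := by rw [hD1R]; linarith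
  have hD2b : (D2 : ℝ) ≤ 4 * t := by rw [hD2R]; linarith
  have hD1p : (0 : ℝ) < D1 := by linarith
  have hD2p : (0 : ℝ) < D2 := by linarith
  have hD1N : 0 < D1 := by exact_mod_cast hD1p
  have hD2N : 0 < D2 := by exact_mod_cast hD2p
  have hD21 : D2 ≤ D1 := by
    have : (D2 : ℝ) ≤ D1 := by linarith
    exact_mod_cast this
  have hts : t * 2500 ≤ s * d := by linarith
  have hratio : (D2 : ℝ) / D1 ≤ 0.001 := by
    rw [div_le_iff₀ hD1p]; linarith
  have hX : 0 < s * d * h1 := by positivity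
  have hDh2 : D2 * logHeight₁ z2 ≤ 4 * (s * d * h1) := by
    rw [hh]
    calc (D2 : ℝ) * (s ^ 2 * h1) ≤ 4 * t * (s ^ 2 * h1) := by gcongr
      _ = 4 * (s * (s * t) * h1) := by ring
      _ = _ := by rw [hst]
  have hDh2' : 3.8 * (s * d * h1) ≤ D2 * logHeight₁ z2 := by
    rw [hh]
    calc 3.8 * (s * d * h1) = 3.8 * t * (s ^ 2 * h1) := by rw [← hst]; ring
      _ ≤ _ := by gcongr
  have hDh1 : D1 * h1 ≤ 4 * (s * d * h1) := by
    calc (D1 : ℝ) * h1 ≤ 4 * (s * d) * h1 := by gcongr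
      _ = _ := by ring
  have hDh1' : 3.8 * (s * d * h1) ≤ D1 * h1 := by
    calc 3.8 * (s * d * h1) = 3.8 * (s * d) * h1 := by ring
      _ ≤ _ := by gcongr
  have hI : ¬ Ix (1 / D1) (1 / D2) 0.002 (sh z1 z2 A.R) := by
    intro hI
    have hR := roth A.R_ne (D1 := D1) (D2 := D2) (by have := A.R1; rw [hD1, Nat.cast_sub hDle.1]; push_cast; exact this)
      (by have := A.R2; rw [hD2, Nat.cast_sub hDle.2]; push_cast; exact this) hD2N hD21 hS1 A.sR (by rw [← hh1]; linarith)
      (by rw [hh]; positivity) (θ := 0.002) (by linarith) (by norm_num) hI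
    have b1 : (0.001 : ℝ) ^ 2 / 8 ≤ (0.002 - (D2 : ℝ) / D1) ^ 2 / 8 := by gcongr; linarith
    have b2 : 1 / (D1 * logHeight₁ z1) + 1 / (D2 * logHeight₁ z2) ≤ 1 / (s * d * h1) := by
      have x1 : 1 / (D1 * logHeight₁ z1) ≤ 1 / (3.8 * (s * d * h1)) := by rw [← hh1]; gcongr
      have x2 : 1 / (D2 * logHeight₁ z2) ≤ 1 / (3.8 * (s * d * h1)) := by gcongr
      have x3 : 1 / (3.8 * (s * d * h1)) = (1 / 3.8) * (1 / (s * d * h1)) := by field_simp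
      have x4 : 0 ≤ 1 / (s * d * h1) := by positivity
      rw [x3] at x1 x2
      linarith
    have b3 : w * (5 * D1 + Real.log S) ≤ w * (20 + C) * (s * d) := by
      rw [mul_assoc]
      gcongr
      linarith
    have b4 : w * (5 * D1 + Real.log S) * (1 / (D1 * logHeight₁ z1) + 1 / (D2 * logHeight₁ z2)) ≤ w * (20 + C) * (s * d) * (1 / (s * d * h1)) := by
      gcongr
    have b5 : w * (20 + C) * (s * d) * (1 / (s * d * h1)) = w * (20 + C) / h1 := by
      field_simp
    have b6 : (0.001 : ℝ) ^ 2 / 8 ≤ w * (20 + C) / h1 := by linarith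
    rw [le_div_iff₀ (by linarith)] at b6
    norm_num at b6
    linarith
  obtain ⟨i, j, hij, hfin⟩ := hkey z1 y1 z2 y2 e1 e2 hy1 hy2 hz m1 m2 d S hS1 A D1 D2 hD1N hD2N 0.002 hI
  have hi0 : 0 ≤ (i : ℝ) / D1 := by positivity
  have hj0 : 0 ≤ (j : ℝ) / D2 := by positivity
  have hih : (i : ℝ) * h1 + j * logHeight₁ z2 ≤ 0.008 * (s * d * h1) := by
    have x1 : (i : ℝ) * h1 = i / D1 * (D1 * h1) := by field_simp
    have x2 : (j : ℝ) * logHeight₁ z2 = j / D2 * (D2 * logHeight₁ z2) := by field_simp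
    rw [x1, x2]
    have y1 : (i : ℝ) / D1 * (D1 * h1) ≤ i / D1 * (4 * (s * d * h1)) := by gcongr
    have y2 : (j : ℝ) / D2 * (D2 * logHeight₁ z2) ≤ j / D2 * (4 * (s * d * h1)) := by gcongr
    linarith [mul_le_mul_of_nonneg_right hij.le (by linarith : 0 ≤ 4 * (s * d * h1))]
  have hi1 : (i : ℝ) ≤ 0.01 * (s * d) := by
    have x1 : (i : ℝ) = i / D1 * D1 := by field_simp
    rw [x1]
    have : (i : ℝ) / D1 * D1 ≤ 0.002 * (4 * (s * d)) := by gcongr; linarith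
    linarith [show 0 ≤ s * (d : ℝ) by positivity]
  have hj1 : (j : ℝ) ≤ 0.01 * (s * d) := by
    have x1 : (j : ℝ) = j / D2 * D2 := by field_simp
    rw [x1]
    have : (j : ℝ) / D2 * D2 ≤ 0.002 * (4 * t) := by gcongr; linarith
    linarith [show 0 ≤ s * (d : ℝ) by positivity]
  have hsd1 : 1 ≤ s * (d : ℝ) := by linarith
  have herr : w * (Real.log 4 + Real.log S + (m1 + m2 + 4 * d + 5 * i + 5 * j) * Real.log c2) ≤ 0.01 * (s * d * h1) := by
    have x1 : Real.log 4 ≤ Real.log 4 * (s * d) := le_mul_of_one_le_right hl4 hsd1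
    have x2 : (m1 + m2 + 4 * d + 5 * i + 5 * j) * Real.log c2 ≤ 20 * (s * d) * Real.log c2 := by
      gcongr; linarith
    have x3 : w * (Real.log 4 + Real.log S + (m1 + m2 + 4 * d + 5 * i + 5 * j) * Real.log c2) ≤ w * ((Real.log 4 + C + 20 * Real.log c2) * (s * d)) := by
      gcongr; linarith
    have x4 : w * (Real.log 4 + C + 20 * Real.log c2) ≤ 0.01 * h1 := by linarith
    have x5 := mul_le_mul_of_nonneg_right x4 (by positivity : 0 ≤ s * (d : ℝ))
    linarith
  have hmain : (m1 + 2 * d + 5 * i) * h1 + (m2 + 2 * d + 5 * j) * logHeight₁ z2 ≤ d * (5 / 2 * (h1 + logHeight₁ z2)) + 1.9 * (s * d * h1) + 0.01 * (s * d * h1) + 5 * (0.008 * (s * d * h1)) := by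
    have x1 : (m1 : ℝ) * h1 ≤ (0.95 * (s * d) + 0.5 * d + 1) * h1 := by gcongr
    have h2p : 0 ≤ logHeight₁ z2 := by rw [hh]; positivity
    have x2 : (m2 : ℝ) * logHeight₁ z2 ≤ (0.95 * t + 0.5 * d + 1) * logHeight₁ z2 := by gcongr
    have x3 : t * logHeight₁ z2 = s * d * h1 := by rw [hh, ← hst]; ring
    have x4 : h1 + logHeight₁ z2 ≤ 0.01 * (s * d * h1) := by
      rw [hh]
      have k1 := mul_le_mul_of_nonneg_left hd hs0.le
      have k2 := mul_le_mul_of_nonneg_left hs hs0.le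
      have : 1 + s ^ 2 ≤ 0.01 * (s * d) := by linarith
      linarith [mul_le_mul_of_nonneg_right this (by linarith : 0 ≤ h1)]
    linarith
  have hfin2 : d * logHeight (mv z1 y1 z2 y2) ≤ d * (5 / 2 * (h1 + logHeight₁ z2) + 1.96 * (s * h1)) := by
    linarith
  exact le_of_mul_le_mul_left hfin2 (by linarith)
end
end Mord

set_option linter.unusedSectionVars false
set_option linter.style.longLine false

namespace Mord
open Height WeierstrassCurve WeierstrassCurve.Affine

noncomputable section

/-- the curve `y² = (x-a)(x-b)(x-c)` -/
def EC {K : Type*} [Field K] (a b c : K) : WeierstrassCurve.Affine K :=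
  { a₁ := 0, a₂ := -(a + b + c), a₃ := 0, a₄ := a * b + b * c + c * a, a₆ := -(a * b * c) }

section
variable {K : Type*} [Field K] [CharZero K]

lemma EC_eq (a b c x y : K) : (EC a b c).Equation x y ↔ y ^ 2 = (x - a) * (x - b) * (x - c) := by
  rw [WeierstrassCurve.Affine.equation_iff]
  simp only [EC]
  constructor <;> intro h <;> linear_combination h

lemma EC_disc (a b c : K) : (EC a b c).Δ = 16 * ((a - b) * (b - c) * (c - a)) ^ 2 := by
  simp only [WeierstrassCurve.Δ, WeierstrassCurve.b₂, WeierstrassCurve.b₄, WeierstrassCurve.b₆, WeierstrassCurve.b₈, EC]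
  ring

lemma EC_ell {a b c : K} (hab : a ≠ b) (hbc : b ≠ c) (hca : c ≠ a) : (EC a b c).IsElliptic := by
  constructor
  rw [EC_disc]
  refine IsUnit.mk0 _ ?_
  have h1 := sub_ne_zero.2 hab
  have h2 := sub_ne_zero.2 hbc
  have h3 := sub_ne_zero.2 hca
  exact mul_ne_zero (by norm_num) (pow_ne_zero _ (mul_ne_zero (mul_ne_zero h1 h2) h3))

lemma EC_ns {a b c : K} (hab : a ≠ b) (hbc : b ≠ c) (hca : c ≠ a) {x y : K} (h : y ^ 2 = (x - a) * (x - b) * (x - c)) :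
    (EC a b c).Nonsingular x y := by
  have := EC_ell hab hbc hca
  have h1 := (EC_eq a b c x y).2 h
  exact (WeierstrassCurve.Affine.equation_iff_nonsingular).1 h1

lemma EC_negY (a b c x y : K) : (EC a b c).negY x y = -y := by
  simp [WeierstrassCurve.Affine.negY, EC]

open scoped Classical in
lemma addSub_sym2x {a b c : K} (hab : a ≠ b) (hbc : b ≠ c) (hca : c ≠ a) (P Q : (EC a b c).Point) :
    ∃ k : K, k ≠ 0 ∧ (fun i => ((EC a b c).addSubMap i).eval (P.sym2x Q)) = k • (P + Q).sym2x (P - Q) := by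
  have hE := EC_ell hab hbc hca
  have key : ∀ s t u : K, (fun i => ((EC a b c).addSubMap i).eval ![s, t, u]) =
      ![s ^ 2 - (EC a b c).b₄ * s * u - (EC a b c).b₆ * t * u - (EC a b c).b₈ * u ^ 2,
        2 * t * s + (EC a b c).b₂ * s * u + (EC a b c).b₄ * t * u + (EC a b c).b₆ * u ^ 2, t ^ 2 - 4 * s * u] := by
    intro s t u
    ext i
    fin_cases i <;> simp [addSubMap]
  have ne : ∀ s t u : K, ![s, t, u] ≠ 0 → (fun i => ((EC a b c).addSubMap i).eval ![s, t, u]) ≠ 0 := fun s t u h =>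
    addSubMap_ne_zero _ h
  rcases P with _ | ⟨x1, y1, h1⟩
  · rcases Q with _ | ⟨x2, y2, h2⟩
    · refine ⟨1, one_ne_zero, ?_⟩
      rw [← Point.zero_def]
      simp only [add_zero, sub_zero, Point.sym2x_zero_zero, key]
      ext i; fin_cases i <;> simp
    · refine ⟨1, one_ne_zero, ?_⟩
      rw [← Point.zero_def]
      simp only [zero_add, zero_sub, Point.sym2x_zero_some, Point.sym2x_neg_right, Point.sym2x_some_some, key]
      ext i; fin_cases i <;> simp <;> ring
  rcases Q with _ | ⟨x2, y2, h2⟩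
  · refine ⟨1, one_ne_zero, ?_⟩
    rw [← Point.zero_def]
    simp only [add_zero, sub_zero, Point.sym2x_some_zero, Point.sym2x_some_some, key]
    ext i; fin_cases i <;> simp <;> ring
  have e1 := (EC_eq a b c x1 y1).1 h1.1
  have e2 := (EC_eq a b c x2 y2).1 h2.1
  -- the doubling case
  have dbl : ∀ (x y : K) (h : (EC a b c).Nonsingular x y), ∃ k : K, k ≠ 0 ∧
      (fun i => ((EC a b c).addSubMap i).eval ![x * x, x + x, 1]) = k • (Point.some x y h + Point.some x y h).sym2x 0 := by
    intro x y h
    have e := (EC_eq a b c x y).1 h.1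
    by_cases hy : y = 0
    · have : Point.some x y h + Point.some x y h = 0 := Point.add_of_Y_eq rfl (by rw [EC_negY, hy, neg_zero])
      rw [this, Point.sym2x_zero_zero]
      have h3 := ne (x * x) (x + x) 1 (by intro h; have := congrFun h 2; simp at this)
      rw [key] at h3 ⊢
      refine ⟨(x * x) ^ 2 - (EC a b c).b₄ * (x * x) * 1 - (EC a b c).b₆ * (x + x) * 1 - (EC a b c).b₈ * 1 ^ 2, ?_, ?_⟩
      rotate_left
      · ext i
        fin_cases i
        · simp only [Fin.zero_eta, Matrix.cons_val_zero, Pi.smul_apply, smul_eq_mul, mul_one]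
        · simp [EC, WeierstrassCurve.b₂, WeierstrassCurve.b₄, WeierstrassCurve.b₆]
          rw [hy] at e
          linear_combination (-4) * e
        · simp; ring
      · intro h0
        apply h3
        ext i
        fin_cases i
        · simpa using h0
        · simp [EC, WeierstrassCurve.b₂, WeierstrassCurve.b₄, WeierstrassCurve.b₆]
          rw [hy] at e
          linear_combination (-4) * e
        · simp; ring
    · have hne : y ≠ (EC a b c).negY x y := by
        rw [EC_negY]; intro h; apply hy
        have : 2 * y = 0 := by linear_combination h
        simpa using this
      rw [Point.add_self_of_Y_ne hne, Point.sym2x_some_zero, key]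
      refine ⟨4 * y ^ 2, mul_ne_zero (by norm_num) (pow_ne_zero _ hy), ?_⟩
      have hs : (EC a b c).slope x x y y = (3 * x ^ 2 + 2 * (-(a + b + c)) * x + (a * b + b * c + c * a)) / (2 * y) := by
        rw [slope_of_Y_ne rfl hne, EC_negY]; simp only [EC]; congr 1 <;> ring
      rw [hs]
      ext i
      fin_cases i
      · simp [EC, WeierstrassCurve.b₂, WeierstrassCurve.b₄, WeierstrassCurve.b₆, WeierstrassCurve.b₈, addX]
        field_simp
        rw [e]; ring
      · simp [EC, WeierstrassCurve.b₂, WeierstrassCurve.b₄, WeierstrassCurve.b₆]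
        rw [e]; ring
      · simp; ring
  by_cases hx : x1 = x2
  · have hy := Y_eq_of_X_eq h1.1 h2.1 hx
    subst hx
    rcases hy with hy | hy
    · subst hy
      obtain ⟨k, hk, hk2⟩ := dbl x1 y1 h1
      exact ⟨k, hk, by rw [sub_self, ← hk2, Point.sym2x_some_some]⟩
    · have hh : Point.some x1 y2 h2 = - Point.some x1 y1 h1 := by
        rw [Point.neg_some, Point.some.injEq]; exact ⟨rfl, by rw [hy, negY_negY]⟩
      obtain ⟨k, hk, hk2⟩ := dbl x1 y1 h1
      refine ⟨k, hk, ?_⟩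
      rw [hh, sub_neg_eq_add, add_neg_cancel, Point.sym2x_comm 0, ← hk2, Point.sym2x_neg_right, Point.sym2x_some_some]
  · have hd : x1 - x2 ≠ 0 := sub_ne_zero.2 hx
    refine ⟨(x1 - x2) ^ 2, pow_ne_zero _ hd, ?_⟩
    rw [sub_eq_add_neg (Point.some x1 y1 h1), Point.neg_some, Point.add_of_X_ne hx, Point.add_of_X_ne hx, Point.sym2x_some_some, Point.sym2x_some_some, key,
      slope_of_X_ne hx, slope_of_X_ne hx, EC_negY]
    ext i
    fin_cases i
    · simp [EC, WeierstrassCurve.b₂, WeierstrassCurve.b₄, WeierstrassCurve.b₆, WeierstrassCurve.b₈, addX]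
      field_simp
      have p1 : y1 ^ 4 = ((x1 - a) * (x1 - b) * (x1 - c)) ^ 2 := by rw [← e1]; ring
      have p2 : y2 ^ 4 = ((x2 - a) * (x2 - b) * (x2 - c)) ^ 2 := by rw [← e2]; ring
      ring_nf
      simp only [p1, p2, e1, e2]
      ring
    · simp [EC, WeierstrassCurve.b₂, WeierstrassCurve.b₄, WeierstrassCurve.b₆, WeierstrassCurve.b₈, addX]
      field_simp
      linear_combination (-2) * e1 - 2 * e2
    · simp; ring
end

section
variable {K : Type*} [Field K] [NumberField K]

/-- naive height -/
def nh {a b c : K} (P : (EC a b c).Point) : ℝ := logHeight P.xRep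

lemma nh_zero {a b c : K} : nh (0 : (EC a b c).Point) = 0 := by
  simp only [nh, Point.xRep_zero]
  rw [← logHeight₁_div_eq_logHeight]; simp

lemma nh_some {a b c x y : K} (h) : nh (Point.some x y h : (EC a b c).Point) = logHeight₁ x := by
  simp only [nh, Point.xRep_some]
  rw [logHeight₁_eq_logHeight]

lemma nh_neg {a b c : K} (P : (EC a b c).Point) : nh (-P) = nh P := by simp [nh]

lemma nh_nonneg {a b c : K} (P : (EC a b c).Point) : 0 ≤ nh P := logHeight_nonneg _

open scoped Classical in
theorem nh_par {a b c : K} (hab : a ≠ b) (hbc : b ≠ c) (hca : c ≠ a) :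
    ∃ C, ∀ P Q : (EC a b c).Point, |nh (P + Q) + nh (P - Q) - 2 * (nh P + nh Q)| ≤ C := by
  have := EC_ell hab hbc hca
  obtain ⟨C1, h1⟩ := (EC a b c).abs_logHeight_addSubMap_sub_two_mul_logHeight_le
  obtain ⟨C2, h2⟩ := Height.abs_logHeight_sym2_sub_le K
  have h3 : ∀ P Q : (EC a b c).Point, |logHeight (P.sym2x Q) - (nh P + nh Q)| ≤ C2 := by
    intro P Q
    have e : ∀ P : (EC a b c).Point, P.xRep = ![P.xRep 0, P.xRep 1] := fun P => by
      ext i; fin_cases i <;> rfl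
    have := @h2 (P.xRep 0) (P.xRep 1) (Q.xRep 0) (Q.xRep 1) (by rw [← e]; exact P.xRep_ne_zero) (by rw [← e]; exact Q.xRep_ne_zero)
    rw [← e, ← e] at this
    exact this
  refine ⟨C1 + 3 * C2, fun P Q => ?_⟩
  obtain ⟨k, hk, hk2⟩ := addSub_sym2x hab hbc hca P Q
  have a1 := h1 (P.sym2x Q)
  rw [hk2, logHeight_smul_eq_logHeight _ hk] at a1
  have a2 := h3 P Q
  have a3 := h3 (P + Q) (P - Q)
  rw [abs_le] at *
  constructor <;> linarith [a1.1, a1.2, a2.1, a2.2, a3.1, a3.2]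

lemma nh_northcott (a b c : K) : Northcott (nh : (EC a b c).Point → ℝ) := by
  constructor
  intro B
  have h1 := NumberField.finite_setOfPred_logHeight₁_le K B
  refine Set.Finite.of_finite_fibers (fun P : (EC a b c).Point => P.xRep) ?_ ?_
  · refine ((h1.image (fun x => ![x, 1])).union (Set.finite_singleton ![1, 0])).subset ?_
    rintro _ ⟨P, hP, rfl⟩
    rcases P with _ | ⟨x, y, h⟩
    · right; rfl
    · left
      exact ⟨x, by simpa [nh_some] using hP, by simp⟩
  · rintro _ ⟨P, hP, rfl⟩
    refine (Set.toFinite {P, -P}).subset ?_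
    rintro Q ⟨_, hQ⟩
    exact Point.eq_or_eq_neg_of_xRep_eq_xRep hQ
end
end
end Mord

set_option linter.unusedSectionVars false
set_option linter.style.longLine false

namespace Mord
open Filter Topology

noncomputable section

theorem canonical {G : Type*} [AddCommGroup G] (h : G → ℝ) (h0 : ∀ x, 0 ≤ h x) (C : ℝ)
    (hC : ∀ x y, |h (x + y) + h (x - y) - 2 * (h x + h y)| ≤ C) :
    ∃ q : G → ℝ, (∀ x, 0 ≤ q x) ∧ (∀ x y, q (x + y) + q (x - y) = 2 * (q x + q y)) ∧ ∃ C', ∀ x, |q x - h x| ≤ C' := by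
  have hC0 : 0 ≤ C := (abs_nonneg _).trans (hC 0 0)
  have hz : |h 0| ≤ C := by
    have := hC 0 0
    rw [abs_le] at *
    simp only [add_zero, sub_zero] at this
    constructor <;> linarith [h0 0]
  have hd : ∀ x, |h (x + x) - 4 * h x| ≤ 2 * C := by
    intro x
    have := hC x x
    rw [sub_self] at this
    rw [abs_le] at *
    constructor <;> linarith
  set a : G → ℕ → ℝ := fun x n => h (2 ^ n • x) / 4 ^ n with ha
  have hstep : ∀ x n, dist (a x n) (a x (n + 1)) ≤ (C / 2) * (1 / 4) ^ n := by
    intro x n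
    rw [dist_comm, Real.dist_eq]
    have e : (2 ^ (n + 1) • x : G) = 2 ^ n • x + 2 ^ n • x := by rw [pow_succ, mul_comm, mul_smul, two_nsmul]
    have e2 : a x (n + 1) - a x n = (h (2 ^ n • x + 2 ^ n • x) - 4 * h (2 ^ n • x)) / (4 * 4 ^ n) := by
      simp only [ha, e]; field_simp; ring
    rw [e2, abs_div, abs_of_pos (by positivity : (0:ℝ) < 4 * 4 ^ n), div_le_iff₀ (by positivity)]
    calc _ ≤ 2 * C := hd _
      _ = _ := by rw [one_div, inv_pow]; field_simp; ring
  have hcau : ∀ x, CauchySeq (a x) := fun x => cauchySeq_of_le_geometric (1 / 4) (C / 2) (by norm_num) (hstep x)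
  choose q hq using fun x => cauchySeq_tendsto_of_complete (hcau x)
  refine ⟨q, ?_, ?_, ?_⟩
  · intro x
    exact ge_of_tendsto' (hq x) fun n => div_nonneg (h0 _) (by positivity)
  · intro x y
    have h1 : Tendsto (fun n => a (x + y) n + a (x - y) n - 2 * (a x n + a y n)) atTop (𝓝 (q (x + y) + q (x - y) - 2 * (q x + q y))) :=
      ((hq _).add (hq _)).sub (((hq _).add (hq _)).const_mul 2)
    have h2 : Tendsto (fun n : ℕ => C * (1 / 4 : ℝ) ^ n) atTop (𝓝 (C * 0)) :=
      (tendsto_pow_atTop_nhds_zero_of_lt_one (by norm_num) (by norm_num)).const_mul C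
    rw [mul_zero] at h2
    have h3 : Tendsto (fun n => a (x + y) n + a (x - y) n - 2 * (a x n + a y n)) atTop (𝓝 0) := by
      refine squeeze_zero_norm (fun n => ?_) h2
      have := hC (2 ^ n • x) (2 ^ n • y)
      have e : a (x + y) n + a (x - y) n - 2 * (a x n + a y n) =
        (h (2 ^ n • x + 2 ^ n • y) + h (2 ^ n • x - 2 ^ n • y) - 2 * (h (2 ^ n • x) + h (2 ^ n • y))) * (1 / 4) ^ n := by
        simp only [ha, smul_add, smul_sub, one_div, inv_pow]; ring
      rw [e, Real.norm_eq_abs, abs_mul, abs_of_pos (by positivity : (0:ℝ) < (1 / 4) ^ n)]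
      exact mul_le_mul_of_nonneg_right this (by positivity)
    have := tendsto_nhds_unique h1 h3
    linarith
  · refine ⟨(C / 2) / (1 - 1 / 4), fun x => ?_⟩
    have := dist_le_of_le_geometric_of_tendsto₀ (1 / 4) (C / 2) (by norm_num) (hstep x) (hq x)
    rw [dist_comm, Real.dist_eq] at this
    simpa [ha] using this

open scoped MatrixOrder ComplexOrder in
lemma psd_fac {r : ℕ} {A : Matrix (Fin r) (Fin r) ℝ} (hA : A.PosSemidef) : ∃ B : Matrix (Fin r) (Fin r) ℝ, A = star B * B :=
  CStarAlgebra.nonneg_iff_eq_star_mul_self.mp hA.nonneg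

section
variable {G : Type*} [AddCommGroup G] (q : G → ℝ) (hpar : ∀ x y, q (x + y) + q (x - y) = 2 * (q x + q y))
include hpar

lemma q_zero : q 0 = 0 := by have := hpar 0 0; simp at this; linarith

lemma q_neg (x : G) : q (-x) = q x := by
  have := hpar 0 x; simp [q_zero q hpar] at this; linarith

lemma q_add3 (x y z : G) : q (x + y + z) = q (x + z) + q (x + y) + q (y + z) - q x - q y - q z := by
  have A := hpar (x + z) y
  have B := hpar x (y - z)
  have C := hpar (x + y) z
  have D := hpar y z
  rw [show x + z + y = x + y + z by abel, show x + z - y = x - y + z by abel] at A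
  rw [show x + (y - z) = x + y - z by abel, show x - (y - z) = x - y + z by abel] at B
  linarith

/-- associated bilinear form -/
def bil : G →+ G →+ ℝ :=
  AddMonoidHom.mk' (fun x => AddMonoidHom.mk' (fun y => q (x + y) - q x - q y) (by
      intro y z
      have := q_add3 q hpar x y z
      rw [← add_assoc]; linarith)) (by
    intro x y
    ext z
    have := q_add3 q hpar x y z
    simp only [AddMonoidHom.mk'_apply, AddMonoidHom.add_apply]
    linarith)

lemma bil_apply (x y : G) : bil q hpar x y = q (x + y) - q x - q y := rfl

lemma bil_self (x : G) : bil q hpar x x = 2 * q x := by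
  have := hpar x x
  rw [sub_self, q_zero q hpar] at this
  rw [bil_apply]; linarith

lemma bil_sum {r : ℕ} (g : Fin r → G) (n m : Fin r → ℤ) :
    bil q hpar (∑ i, n i • g i) (∑ j, m j • g j) = ∑ i, ∑ j, (n i : ℝ) * m j * bil q hpar (g i) (g j) := by
  have h1 : bil q hpar (∑ i, n i • g i) = ∑ i, bil q hpar (n i • g i) := map_sum _ _ _
  rw [h1, AddMonoidHom.finsetSum_apply]
  refine Finset.sum_congr rfl fun i _ => ?_
  rw [map_sum]
  refine Finset.sum_congr rfl fun j _ => ?_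
  rw [map_zsmul, map_zsmul, AddMonoidHom.smul_apply]
  simp only [zsmul_eq_mul]; ring

lemma gram_psd (hq : ∀ x, 0 ≤ q x) {r : ℕ} (g : Fin r → G) :
    (Matrix.of fun i j => bil q hpar (g i) (g j)).PosSemidef := by
  refine Matrix.PosSemidef.of_dotProduct_mulVec_nonneg ?_ ?_
  · refine Matrix.ext fun i j => ?_
    simp [Matrix.conjTranspose_apply, bil_apply, add_comm (g i)]
    ring
  · intro t
    have e : ∀ t : Fin r → ℝ, star t ⬝ᵥ (Matrix.of fun i j => bil q hpar (g i) (g j)).mulVec t =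
        ∑ i, ∑ j, t i * t j * bil q hpar (g i) (g j) := by
      intro t
      simp only [dotProduct, Matrix.mulVec, Finset.mul_sum]
      refine Finset.sum_congr rfl fun i _ => Finset.sum_congr rfl fun j _ => ?_
      simp; ring
    rw [e]
    have lim : Tendsto (fun n : ℕ => ∑ i, ∑ j, ((⌊(n : ℝ) * t i⌋ : ℝ) / n) * ((⌊(n : ℝ) * t j⌋ : ℝ) / n) * bil q hpar (g i) (g j)) atTop
        (𝓝 (∑ i, ∑ j, t i * t j * bil q hpar (g i) (g j))) := by
      have h1 : ∀ s : ℝ, Tendsto (fun n : ℕ => (⌊(n : ℝ) * s⌋ : ℝ) / n) atTop (𝓝 s) := by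
        intro s
        have h2 : Tendsto (fun n : ℕ => (1 : ℝ) / n) atTop (𝓝 0) := tendsto_one_div_atTop_nhds_zero_nat
        rw [tendsto_iff_norm_sub_tendsto_zero]
        refine squeeze_zero' (Eventually.of_forall fun n => norm_nonneg _) ?_ h2
        filter_upwards [eventually_gt_atTop 0] with n hn
        have hn' : (0 : ℝ) < n := by exact_mod_cast hn
        rw [Real.norm_eq_abs, abs_le, neg_le_sub_iff_le_add, sub_le_iff_le_add, ← add_div, div_le_iff₀ hn', le_div_iff₀ hn']
        have a1 := Int.floor_le ((n : ℝ) * s)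
        have a2 := Int.lt_floor_add_one ((n : ℝ) * s)
        constructor
        · linarith
        · rw [add_mul, one_div, inv_mul_cancel₀ hn'.ne']; linarith
      refine tendsto_finsetSum _ fun i _ => tendsto_finsetSum _ fun j _ => ?_
      exact ((h1 _).mul (h1 _)).mul_const _
    refine ge_of_tendsto' lim fun n => ?_
    have : ∑ i, ∑ j, ((⌊(n : ℝ) * t i⌋ : ℝ) / n) * ((⌊(n : ℝ) * t j⌋ : ℝ) / n) * bil q hpar (g i) (g j) =
        (2 * q (∑ i, ⌊(n : ℝ) * t i⌋ • g i)) / n ^ 2 := by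
      rw [← bil_self q hpar, bil_sum, Finset.sum_div]
      refine Finset.sum_congr rfl fun i _ => ?_
      rw [Finset.sum_div]
      refine Finset.sum_congr rfl fun j _ => ?_
      ring
    rw [this]
    exact div_nonneg (mul_nonneg (by norm_num) (hq _)) (by positivity)

theorem pigeon (hq : ∀ x, 0 ≤ q x) (hfg : AddGroup.FG G) (u : ℕ → G) (hu : Tendsto (fun n => q (u n)) atTop atTop)
    (ε A H : ℝ) (hε : 0 < ε) :
    ∃ i j, H ≤ q (u i) ∧ A * q (u i) ≤ q (u j) ∧ 2 * (1 - ε) * √(q (u i) * q (u j)) ≤ q (u i + u j) - q (u i) - q (u j) := by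
  have hfin : Module.Finite ℤ G := Module.Finite.iff_addGroup_fg.2 hfg
  obtain ⟨r, g, hg⟩ := Module.Finite.exists_fin (R := ℤ) (M := G)
  have hrep : ∀ x : G, ∃ n : Fin r → ℤ, ∑ i, n i • g i = x := fun x => by
    have : x ∈ Submodule.span ℤ (Set.range g) := by rw [hg]; trivial
    exact (Submodule.mem_span_range_iff_exists_fun ℤ).1 this
  choose n hn using hrep
  obtain ⟨M, hM⟩ := psd_fac (gram_psd q hpar hq g)
  set φ : G → EuclideanSpace ℝ (Fin r) := fun x => WithLp.toLp 2 (M.mulVec (fun i => (n x i : ℝ))) with hφ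
  have hin : ∀ x y, inner ℝ (φ x) (φ y) = q (x + y) - q x - q y := by
    intro x y
    rw [← bil_apply q hpar]
    conv_rhs => rw [← hn x, ← hn y]
    rw [bil_sum]
    have e : ∀ i j, bil q hpar (g i) (g j) = ∑ k, M k i * M k j := by
      intro i j
      have := congrFun (congrFun hM i) j
      simpa [Matrix.mul_apply] using this
    simp only [hφ, e, PiLp.inner_apply, Matrix.mulVec, dotProduct]
    simp only [RCLike.inner_apply, conj_trivial]
    calc _ = ∑ k, ∑ i, ∑ j, (n x i : ℝ) * n y j * (M k i * M k j) := by
          refine Finset.sum_congr rfl fun k _ => ?_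
          rw [mul_comm, Finset.sum_mul_sum]
          refine Finset.sum_congr rfl fun i _ => Finset.sum_congr rfl fun j _ => ?_
          ring
      _ = _ := by
          rw [Finset.sum_comm]
          refine Finset.sum_congr rfl fun i _ => ?_
          rw [Finset.sum_comm]
          refine Finset.sum_congr rfl fun j _ => ?_
          rw [Finset.mul_sum]
  have hns : ∀ x, ‖φ x‖ ^ 2 = 2 * q x := by
    intro x
    rw [← real_inner_self_eq_norm_sq, hin, ← bil_apply q hpar, bil_self]
  set w : ℕ → EuclideanSpace ℝ (Fin r) := fun k => (‖φ (u k)‖)⁻¹ • φ (u k) with hw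
  have hwb : ∀ k, w k ∈ Metric.closedBall (0 : EuclideanSpace ℝ (Fin r)) 1 := by
    intro k
    rw [mem_closedBall_zero_iff, hw, norm_smul, norm_inv, norm_norm]
    exact inv_mul_le_one
  obtain ⟨z, -, ψ, hψ, hlim⟩ := (isCompact_closedBall (0 : EuclideanSpace ℝ (Fin r)) 1).tendsto_subseq hwb
  obtain ⟨N, hN⟩ := (Metric.cauchySeq_iff.1 hlim.cauchySeq) (√(2 * ε)) (Real.sqrt_pos.2 (by positivity))
  have hu' := hu.comp hψ.tendsto_atTop
  obtain ⟨i, hi1, hi2⟩ := ((eventually_ge_atTop N).and (hu'.eventually_ge_atTop (max H 1))).exists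
  obtain ⟨j, hj1, hj2⟩ := ((eventually_ge_atTop N).and (hu'.eventually_ge_atTop (max (A * q (u (ψ i))) 1))).exists
  have hd := hN i hi1 j hj1
  simp only [Function.comp] at hi2 hj2 hd
  refine ⟨ψ i, ψ j, (le_max_left _ _).trans hi2, (le_max_left _ _).trans hj2, ?_⟩
  set x := u (ψ i)
  set y := u (ψ j)
  have hx : 0 < q x := lt_of_lt_of_le one_pos ((le_max_right _ _).trans hi2)
  have hy : 0 < q y := lt_of_lt_of_le one_pos ((le_max_right _ _).trans hj2)
  have nx : ‖φ x‖ = √(2 * q x) := by rw [← hns, Real.sqrt_sq (norm_nonneg _)]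
  have ny : ‖φ y‖ = √(2 * q y) := by rw [← hns, Real.sqrt_sq (norm_nonneg _)]
  have px : 0 < ‖φ x‖ := by rw [nx]; positivity
  have py : 0 < ‖φ y‖ := by rw [ny]; positivity
  have h5 : ‖w (ψ i) - w (ψ j)‖ ^ 2 ≤ 2 * ε := by
    rw [dist_eq_norm] at hd
    calc _ ≤ (√(2 * ε)) ^ 2 := pow_le_pow_left₀ (norm_nonneg _) hd.le 2
      _ = _ := Real.sq_sqrt (by positivity)
  have h6 : ‖w (ψ i)‖ = 1 := by rw [hw]; simp only [norm_smul, norm_inv, norm_norm]; exact inv_mul_cancel₀ px.ne'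
  have h7 : ‖w (ψ j)‖ = 1 := by rw [hw]; simp only [norm_smul, norm_inv, norm_norm]; exact inv_mul_cancel₀ py.ne'
  rw [norm_sub_sq_real, h6, h7] at h5
  have h8 : inner ℝ (w (ψ i)) (w (ψ j)) = (‖φ x‖ * ‖φ y‖)⁻¹ * (q (x + y) - q x - q y) := by
    simp only [hw]
    rw [real_inner_smul_left, real_inner_smul_right, hin, mul_inv]; ring
  have h9 : 1 - ε ≤ (‖φ x‖ * ‖φ y‖)⁻¹ * (q (x + y) - q x - q y) := by rw [← h8]; linarith
  rw [inv_mul_eq_div, le_div_iff₀ (mul_pos px py)] at h9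
  have h10 : ‖φ x‖ * ‖φ y‖ = 2 * √(q x * q y) := by
    rw [nx, ny, ← Real.sqrt_mul (by positivity), show 2 * q x * (2 * q y) = 2 ^ 2 * (q x * q y) by ring, Real.sqrt_mul (by positivity), Real.sqrt_sq (by norm_num)]
  rw [h10] at h9
  linarith
end
end
end Mord

set_option linter.unusedSectionVars false
set_option linter.style.longLine false

namespace Mord
open IsDedekindDomain NumberField
open scoped WithZero nonZeroDivisors

noncomputable section

def FinMod {K : Type*} [Field K] (A : Set K) : Prop :=
  ∃ T : Set K, T.Finite ∧ (∀ t ∈ T, t ≠ 0) ∧ ∀ u ∈ A, ∃ t ∈ T, ∃ z, z ≠ 0 ∧ u = t * z ^ 2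

section
variable {K : Type*} [Field K]

lemma FinMod.step {A B : Set K} (hB : FinMod B) (hA : ∀ u ∈ A, u ≠ 0) {D : Type*} [Finite D] (f : K → D)
    (h : ∀ u ∈ A, ∀ u' ∈ A, f u = f u' → ∃ z, z ≠ 0 ∧ ∃ b ∈ B, u * u' = b * z ^ 2) : FinMod A := by
  classical
  obtain ⟨T, hT, hT0, hTB⟩ := hB
  have : ∀ d : D, ∃ r : K, r ≠ 0 ∧ ∀ u ∈ A, f u = d → r ∈ A ∧ f r = d := by
    intro d
    by_cases hd : ∃ u ∈ A, f u = d
    · obtain ⟨u, hu, hud⟩ := hd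
      exact ⟨u, hA u hu, fun _ _ _ => ⟨hu, hud⟩⟩
    · refine ⟨1, one_ne_zero, fun u hu hud => absurd ⟨u, hu, hud⟩ hd⟩
  choose r hr0 hr using this
  refine ⟨(fun p : K × D => p.1 * r p.2) '' (T ×ˢ Set.univ), (hT.prod Set.finite_univ).image _, ?_, ?_⟩
  · rintro _ ⟨⟨t, d⟩, ⟨ht, -⟩, rfl⟩
    exact mul_ne_zero (hT0 t ht) (hr0 d)
  · intro u hu
    obtain ⟨h1, h2⟩ := hr (f u) u hu rfl
    obtain ⟨z, hz, b, hb, e⟩ := h u hu (r (f u)) h1 h2.symm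
    obtain ⟨t, ht, z', hz', e'⟩ := hTB b hb
    have h0 := hr0 (f u)
    refine ⟨t * r (f u), ⟨(t, f u), ⟨ht, trivial⟩, rfl⟩, z * z' / r (f u), div_ne_zero (mul_ne_zero hz hz') h0, ?_⟩
    generalize r (f u) = ρ at *
    rw [e'] at e
    field_simp
    linear_combination e

lemma FinMod.sq {A B : Set K} (hB : FinMod B) (h : ∀ u ∈ A, ∃ z, z ≠ 0 ∧ ∃ b ∈ B, u = b * z ^ 2) : FinMod A := by
  obtain ⟨T, hT, hT0, hTB⟩ := hB
  refine ⟨T, hT, hT0, fun u hu => ?_⟩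
  obtain ⟨z, hz, b, hb, e⟩ := h u hu
  obtain ⟨t, ht, z', hz', e'⟩ := hTB b hb
  exact ⟨t, ht, z * z', mul_ne_zero hz hz', by rw [e, e']; ring⟩

end

section
variable (K : Type*) [Field K] [NumberField K]

lemma finMod_units : FinMod {u : K | ∃ ε : (𝓞 K)ˣ, u = ((ε : 𝓞 K) : K)} := by
  have : Group.FG (𝓞 K)ˣ := Group.fg_iff_monoid_fg.2 inferInstance
  have hfi := Subgroup.finiteIndex_range_powMonoidHom_of_fg (𝓞 K)ˣ (n := 2) two_ne_zero
  have hfin : Finite ((𝓞 K)ˣ ⧸ (powMonoidHom (α := (𝓞 K)ˣ) 2).range) := inferInstance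
  set r : (𝓞 K)ˣ ⧸ (powMonoidHom (α := (𝓞 K)ˣ) 2).range → K := fun c => ((c.out : 𝓞 K) : K) with hr
  refine ⟨Set.range r, Set.finite_range r, ?_, ?_⟩
  · rintro _ ⟨c, rfl⟩
    simp [hr]
  · rintro _ ⟨ε, rfl⟩
    refine ⟨_, ⟨QuotientGroup.mk ε, rfl⟩, ?_⟩
    have h1 : (QuotientGroup.mk (Quotient.out (QuotientGroup.mk ε : (𝓞 K)ˣ ⧸ (powMonoidHom (α := (𝓞 K)ˣ) 2).range)) : (𝓞 K)ˣ ⧸ (powMonoidHom (α := (𝓞 K)ˣ) 2).range) = QuotientGroup.mk ε := QuotientGroup.out_eq' _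
    obtain ⟨δ, hδ⟩ := QuotientGroup.eq.1 h1
    refine ⟨((δ : 𝓞 K) : K), by simp, ?_⟩
    have h2 : ε = Quotient.out (QuotientGroup.mk ε : (𝓞 K)ˣ ⧸ (powMonoidHom (α := (𝓞 K)ˣ) 2).range) * δ ^ 2 := by
      rw [powMonoidHom_apply] at hδ
      rw [hδ]; group
    conv_lhs => rw [h2]
    simp [hr]

lemma finMod_ideal : FinMod {u : K | u ≠ 0 ∧ ∃ m : 𝓞 K, u = (m : K) ∧ ∃ J : Ideal (𝓞 K), Ideal.span {m} = J ^ 2} := by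
  classical
  refine FinMod.step (finMod_units K) (fun u hu => hu.1) (D := ClassGroup (𝓞 K))
    (fun u => if h : ∃ J : (Ideal (𝓞 K))⁰, ∃ m : 𝓞 K, u = (m : K) ∧ Ideal.span {m} = (J : Ideal (𝓞 K)) ^ 2 then ClassGroup.mk0 h.choose else 1) ?_
  have key : ∀ u ∈ {u : K | u ≠ 0 ∧ ∃ m : 𝓞 K, u = (m : K) ∧ ∃ J : Ideal (𝓞 K), Ideal.span {m} = J ^ 2},
      ∃ J : (Ideal (𝓞 K))⁰, ∃ m : 𝓞 K, u = (m : K) ∧ Ideal.span {m} = (J : Ideal (𝓞 K)) ^ 2 := by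
    rintro u ⟨h0, m, hm, J, hJ⟩
    refine ⟨⟨J, mem_nonZeroDivisors_of_ne_zero ?_⟩, m, hm, hJ⟩
    rintro rfl
    have : m = 0 := by simpa using hJ
    simp [this] at hm; exact h0 hm
  intro u hu u' hu' hf
  simp only [dif_pos (key u hu), dif_pos (key u' hu')] at hf
  obtain ⟨m, hm, hJ⟩ := (key u hu).choose_spec
  obtain ⟨m', hm', hJ'⟩ := (key u' hu').choose_spec
  obtain ⟨x, y, hx, hy, e⟩ := ClassGroup.mk0_eq_mk0_iff.1 hf
  have e2 : Ideal.span {x ^ 2 * m} = Ideal.span {y ^ 2 * m'} := by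
    have := congrArg (· ^ 2) e
    simp only [mul_pow, ← hJ, ← hJ', Ideal.span_singleton_pow, Ideal.span_singleton_mul_span_singleton] at this
    exact this
  obtain ⟨ε, hε⟩ := Ideal.span_singleton_eq_span_singleton.1 e2
  have hx' : (x : K) ≠ 0 := by simpa using hx
  have hy' : (y : K) ≠ 0 := by simpa using hy
  refine ⟨u * x / y, div_ne_zero (mul_ne_zero hu.1 hx') hy', ((ε : 𝓞 K) : K), ⟨ε, rfl⟩, ?_⟩
  have h3 : (x : K) ^ 2 * m * ((ε : 𝓞 K) : K) = y ^ 2 * m' := by exact_mod_cast congrArg (algebraMap (𝓞 K) K) hε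
  rw [← hm, ← hm'] at h3
  field_simp
  linear_combination (-u) * h3

lemma exp_sq (n : ℤ) : (∃ w : ℤᵐ⁰, WithZero.exp n = w ^ 2) ↔ Even n := by
  constructor
  · rintro ⟨w, hw⟩
    have hw0 : w ≠ 0 := by rintro rfl; simp at hw
    rw [← WithZero.exp_log hw0, ← WithZero.exp_nsmul, WithZero.exp_inj] at hw
    exact ⟨WithZero.log w, by rw [hw]; simp; ring⟩
  · rintro ⟨k, rfl⟩
    exact ⟨WithZero.exp k, by rw [← WithZero.exp_nsmul]; congr 1; simp; ring⟩

lemma finMod_even : FinMod {u : K | u ≠ 0 ∧ ∀ v : HeightOneSpectrum (𝓞 K), ∃ w : ℤᵐ⁰, v.valuation K u = w ^ 2} := by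
  refine FinMod.sq (finMod_ideal K) ?_
  rintro u ⟨h0, hu⟩
  obtain ⟨m, n, hn, e⟩ := IsFractionRing.div_surjective (A := 𝓞 K) u
  have hn0 : n ≠ 0 := nonZeroDivisors.ne_zero hn
  have hn' : (n : K) ≠ 0 := by simpa using hn0
  have hm' : (m : K) ≠ 0 := by rintro h; apply h0; rw [← e]; simp only [RingOfIntegers.coe_eq_algebraMap] at h; rw [h, zero_div]
  have hm0 : m ≠ 0 := by simpa using hm'
  have hmn : m * n ≠ 0 := mul_ne_zero hm0 hn0
  refine ⟨(n : K)⁻¹, inv_ne_zero hn', (m : K) * n, ⟨mul_ne_zero hm' hn', m * n, by simp, ?_⟩, by rw [← e]; field_simp⟩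
  have hev : ∀ v : HeightOneSpectrum (𝓞 K), Even ((Associates.mk v.asIdeal).count (Associates.mk (Ideal.span {m * n} : Ideal (𝓞 K))).factors) := by
    intro v
    obtain ⟨w, hw⟩ := hu v
    have h1 : v.valuation K ((m * n : 𝓞 K) : K) = (w * v.valuation K n) ^ 2 := by
      rw [mul_pow, ← hw, ← map_pow, ← map_mul, ← e]
      congr 1
      push_cast
      field_simp
    rw [HeightOneSpectrum.valuation_of_algebraMap, HeightOneSpectrum.intValuation_if_neg _ hmn] at h1
    have := (exp_sq _).1 ⟨_, h1⟩
    simpa using this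
  have hI : (Ideal.span {m * n} : Ideal (𝓞 K)) ≠ 0 := by simpa using hmn
  refine ⟨∏ᶠ v : HeightOneSpectrum (𝓞 K), v.asIdeal ^ ((Associates.mk v.asIdeal).count (Associates.mk (Ideal.span {m * n} : Ideal (𝓞 K))).factors / 2), ?_⟩
  rw [finprod_pow]
  · conv_lhs => rw [← Ideal.finprod_heightOneSpectrum_factorization hI]
    refine finprod_congr fun v => ?_
    rw [HeightOneSpectrum.maxPowDividing, ← pow_mul, Nat.div_mul_cancel (hev v).two_dvd]
  · refine Set.Finite.subset (Associates.finite_factors hI) ?_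
    intro v hv h
    apply hv
    have : (Associates.mk v.asIdeal).count (Associates.mk (Ideal.span {m * n} : Ideal (𝓞 K))).factors = 0 := by exact_mod_cast h
    simp [this]

theorem finMod_S (N : 𝓞 K) (hN : N ≠ 0) : FinMod {u : K | u ≠ 0 ∧ ∀ v : HeightOneSpectrum (𝓞 K), N ∉ v.asIdeal → ∃ w : ℤᵐ⁰, v.valuation K u = w ^ 2} := by
  classical
  set S := {v : HeightOneSpectrum (𝓞 K) | N ∈ v.asIdeal} with hS
  have hfin : S.Finite := by
    have := Ideal.finite_factors (I := Ideal.span {N}) (by simpa using hN)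
    refine this.subset fun v hv => ?_
    rw [Set.mem_ofPred_eq, Ideal.dvd_span_singleton]; exact hv
  have := hfin.to_subtype
  refine FinMod.step (finMod_even K) (fun u hu => hu.1) (D := S → Prop)
    (fun u v => ∃ w : ℤᵐ⁰, v.1.valuation K u = w ^ 2) ?_
  intro u hu u' hu' hf
  refine ⟨1, one_ne_zero, u * u', ⟨mul_ne_zero hu.1 hu'.1, fun v => ?_⟩, by ring⟩
  rw [map_mul]
  by_cases hv : N ∈ v.asIdeal
  · have := congrFun hf ⟨v, hv⟩
    simp only [eq_iff_iff] at this
    have a1 := (Valuation.ne_zero_iff (v.valuation K)).2 hu.1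
    have a2 := (Valuation.ne_zero_iff (v.valuation K)).2 hu'.1
    rw [← WithZero.exp_log a1, ← WithZero.exp_log a2, exp_sq, exp_sq] at this
    rw [← WithZero.exp_log a1, ← WithZero.exp_log a2, ← WithZero.exp_add, exp_sq, Int.even_add]
    exact this
  · obtain ⟨w, hw⟩ := hu.2 v hv
    obtain ⟨w', hw'⟩ := hu'.2 v hv
    exact ⟨w * w', by rw [hw, hw', mul_pow]⟩

end
end
end Mord

set_option linter.unusedSectionVars false
set_option linter.style.longLine false

namespace Mord
open IsDedekindDomain NumberField
open scoped WithZero nonZeroDivisors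

noncomputable section

lemma val_even {K : Type*} [Field K] {Γ : Type*} [LinearOrderedCommGroupWithZero Γ] (v : Valuation K Γ) {ι : Type*} [Fintype ι] (α : ι → K)
    (h1 : ∀ i, v (α i) ≤ 1) (h2 : ∀ i j, i ≠ j → v (α i - α j) = 1) {c : K} (hc : v c = 1) {x y : K}
    (h : y ^ 2 = c * ∏ i, (x - α i)) (i : ι) : (1 < v x ∧ v (x - α i) = v x) ∨ ∃ w, v (x - α i) = w ^ 2 := by
  classical
  rcases lt_or_ge 1 (v x) with hx | hx
  · left
    refine ⟨hx, ?_⟩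
    exact Valuation.map_sub_eq_of_lt_left v (lt_of_le_of_lt (h1 i) hx)
  · right
    have hle : v (x - α i) ≤ 1 := (v.map_sub _ _).trans (max_le hx (h1 i))
    rcases hle.lt_or_eq with hlt | heq
    · refine ⟨v y, ?_⟩
      rw [← map_pow, h, map_mul, hc, one_mul, map_prod, ← Finset.mul_prod_erase _ _ (Finset.mem_univ i), Finset.prod_eq_one, mul_one]
      intro j hj
      have hij : i ≠ j := (Finset.ne_of_mem_erase hj).symm
      have e : x - α j = (x - α i) + (α i - α j) := by ring
      rw [e, Valuation.map_add_eq_of_lt_right v (by rw [h2 i j hij]; exact hlt), h2 i j hij]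
    · exact ⟨1, by rw [heq, one_pow]⟩

section
variable {K : Type*} [Field K] [NumberField K]

lemma exists_N (s : Finset K) : ∃ N : 𝓞 K, N ≠ 0 ∧ ∀ v : HeightOneSpectrum (𝓞 K), N ∉ v.asIdeal → ∀ a ∈ s, a ≠ 0 → v.valuation K a = 1 := by
  classical
  induction s using Finset.induction_on with
  | empty => exact ⟨1, one_ne_zero, by simp⟩
  | insert a s ha ih =>
    obtain ⟨N, hN, h⟩ := ih
    by_cases h0 : a = 0
    · refine ⟨N, hN, fun v hv b hb hb0 => ?_⟩
      rcases Finset.mem_insert.1 hb with rfl | hb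
      · exact absurd h0 hb0
      · exact h v hv b hb hb0
    obtain ⟨m, n, hn, e⟩ := IsFractionRing.div_surjective (A := 𝓞 K) a
    have hn0 : n ≠ 0 := nonZeroDivisors.ne_zero hn
    have hm0 : m ≠ 0 := by rintro rfl; apply h0; rw [← e]; simp
    refine ⟨N * (m * n), mul_ne_zero hN (mul_ne_zero hm0 hn0), fun v hv b hb hb0 => ?_⟩
    have hv1 : N ∉ v.asIdeal := fun h => hv (Ideal.mul_mem_right _ _ h)
    have hv2 : m ∉ v.asIdeal := fun h => hv (Ideal.mul_mem_left _ _ (Ideal.mul_mem_right _ _ h))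
    have hv3 : n ∉ v.asIdeal := fun h => hv (Ideal.mul_mem_left _ _ (Ideal.mul_mem_left _ _ h))
    rcases Finset.mem_insert.1 hb with rfl | hb
    · rw [← e, map_div₀, (HeightOneSpectrum.valuation_eq_one_iff_notMem v).2 hv2, (HeightOneSpectrum.valuation_eq_one_iff_notMem v).2 hv3, div_one]
    · exact h v hv1 b hb hb0

lemma exists_N_roots {ι : Type*} [Fintype ι] (α : ι → K) (hα : Function.Injective α) (c : K) (hc : c ≠ 0) :
    ∃ N : 𝓞 K, N ≠ 0 ∧ ∀ v : HeightOneSpectrum (𝓞 K), N ∉ v.asIdeal →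
      (∀ i, v.valuation K (α i) ≤ 1) ∧ (∀ i j, i ≠ j → v.valuation K (α i - α j) = 1) ∧ v.valuation K c = 1 := by
  classical
  obtain ⟨N, hN, h⟩ := exists_N (insert c ((Finset.univ.image α) ∪ Finset.univ.image (fun p : ι × ι => α p.1 - α p.2)))
  refine ⟨N, hN, fun v hv => ⟨fun i => ?_, fun i j hij => ?_, ?_⟩⟩
  · by_cases h0 : α i = 0
    · rw [h0, map_zero]; exact zero_le_one
    · exact (h v hv (α i) (by simp) h0).le
  · exact h v hv _ (by
      refine Finset.mem_insert_of_mem (Finset.mem_union_right _ ?_)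
      exact Finset.mem_image.2 ⟨(i, j), Finset.mem_univ _, rfl⟩) (sub_ne_zero.2 fun e => hij (hα e))
  · exact h v hv c (by simp) hc
end

lemma FinMod.classify {K : Type*} [Field K] {A : Set K} (h : FinMod A) : ∃ g : K → K, ∃ T : Set K, T.Finite ∧
    (∀ u, u = 0 ∨ u ∈ A → g u ∈ T) ∧ ∀ u u', (u = 0 ∨ u ∈ A) → (u' = 0 ∨ u' ∈ A) → g u = g u' →
      (u = 0 ∧ u' = 0) ∨ ∃ w, w ≠ 0 ∧ u * u' = w ^ 2 := by
  classical
  obtain ⟨T, hT, hT0, hTA⟩ := h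
  choose! t ht z hz e using hTA
  refine ⟨fun u => if u = 0 then 0 else t u, insert 0 T, hT.insert 0, ?_, ?_⟩
  · intro u hu
    by_cases h0 : u = 0
    · simp [h0]
    · simp only [h0, if_false]; exact Set.mem_insert_of_mem _ (ht u (hu.resolve_left h0))
  · intro u u' hu hu' hg
    by_cases h0 : u = 0
    · by_cases h0' : u' = 0
      · exact Or.inl ⟨h0, h0'⟩
      · simp only [h0, h0', if_true, if_false] at hg
        exact absurd hg.symm (hT0 _ (ht u' (hu'.resolve_left h0')))
    · by_cases h0' : u' = 0
      · simp only [h0, h0', if_true, if_false] at hg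
        exact absurd hg (hT0 _ (ht u (hu.resolve_left h0)))
      · simp only [h0, h0', if_false] at hg
        have a := hu.resolve_left h0
        have a' := hu'.resolve_left h0'
        right
        refine ⟨t u * z u * z u', mul_ne_zero (mul_ne_zero (hT0 _ (ht u a)) (hz u a)) (hz u' a'), ?_⟩
        conv_lhs => rw [e u a, e u' a', ← hg]
        ring
end
end Mord

set_option linter.unusedSectionVars false
set_option linter.style.longLine false

namespace Mord
open Height WeierstrassCurve WeierstrassCurve.Affine
open IsDedekindDomain NumberField
open scoped WithZero Classical

noncomputable section

section
variable {K : Type*} [Field K] [CharZero K] {a b c : K} (hab : a ≠ b) (hbc : b ≠ c) (hca : c ≠ a)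
include hab hbc hca

lemma halve {x y r s t : K} (h) (hr : x - a = r ^ 2) (hs : x - b = s ^ 2) (ht : x - c = t ^ 2) :
    ∃ R : (EC a b c).Point, R + R = Point.some x y h := by
  have main : ∀ r s t : K, x - a = r ^ 2 → x - b = s ^ 2 → x - c = t ^ 2 → y = r * s * t → ∃ R : (EC a b c).Point, R + R = Point.some x y h := by
    clear hr hs ht r s t
    intro r s t hr hs ht hy
    have h1 : r + s ≠ 0 := by
      intro h; apply hab; linear_combination hs - hr + (s - r) * h
    have h2 : s + t ≠ 0 := by
      intro h; apply hbc; linear_combination ht - hs + (t - s) * h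
    have h3 : t + r ≠ 0 := by
      intro h; apply hca; linear_combination hr - ht + (r - t) * h
    have ea : a = x - r ^ 2 := by linear_combination -hr
    have eb : b = x - s ^ 2 := by linear_combination -hs
    have ec : c = x - t ^ 2 := by linear_combination -ht
    have hy' : (r + s) * (s + t) * (t + r) ≠ 0 := mul_ne_zero (mul_ne_zero h1 h2) h3
    have ns : (EC a b c).Nonsingular (x + r * s + s * t + t * r) ((r + s) * (s + t) * (t + r)) :=
      EC_ns hab hbc hca (by rw [ea, eb, ec]; ring)
    refine ⟨Point.some _ _ ns, ?_⟩
    have hne : (r + s) * (s + t) * (t + r) ≠ (EC a b c).negY (x + r * s + s * t + t * r) ((r + s) * (s + t) * (t + r)) := by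
      rw [EC_negY]; intro h
      apply hy'
      have : 2 * ((r + s) * (s + t) * (t + r)) = 0 := by linear_combination h
      simpa using this
    have hsl : (EC a b c).slope (x + r * s + s * t + t * r) (x + r * s + s * t + t * r) ((r + s) * (s + t) * (t + r)) ((r + s) * (s + t) * (t + r)) = r + s + t := by
      rw [slope_of_Y_ne rfl hne, EC_negY, div_eq_iff (by rw [sub_neg_eq_add, ← two_mul]; exact mul_ne_zero two_ne_zero hy')]
      simp only [EC]
      rw [ea, eb, ec]; ring
    rw [Point.add_self_of_Y_ne hne, Point.some.injEq, hsl]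
    constructor
    · simp only [addX, EC]; rw [ea, eb, ec]; ring
    · rw [addY, EC_negY, negAddY]
      simp only [addX, EC]; rw [hy, ea, eb, ec]; ring
  have e := (EC_eq a b c x y).1 h.1
  rw [hr, hs, ht] at e
  have e2 : y ^ 2 = (r * s * t) ^ 2 := by rw [e]; ring
  rcases sq_eq_sq_iff_eq_or_eq_neg.1 e2 with e3 | e3
  · exact main r s t hr hs ht e3
  · exact main (-r) s t (by rw [hr]; ring) hs ht (by rw [e3]; ring)

lemma same_class {x1 y1 x2 y2 : K} (n1) (n2) (ha : ∃ w, w ≠ 0 ∧ (x1 - a) * (x2 - a) = w ^ 2) (hb : ∃ w, w ≠ 0 ∧ (x1 - b) * (x2 - b) = w ^ 2)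
    (hc : ∃ w, w ≠ 0 ∧ (x1 - c) * (x2 - c) = w ^ 2) : ∃ R : (EC a b c).Point, R + R = Point.some x1 y1 n1 + Point.some x2 y2 n2 := by
  by_cases hxy : x1 = x2 ∧ y1 = (EC a b c).negY x2 y2
  · refine ⟨0, ?_⟩
    rw [Point.add_of_Y_eq hxy.1 hxy.2, add_zero]
  rw [Point.add_some hxy]
  set ℓ := (EC a b c).slope x1 x2 y1 y2 with hℓ
  have hp := addPolynomial_slope n1.1 n2.1 hxy
  rw [← hℓ, addPolynomial_eq] at hp
  have key : ∀ e : K, (e - a) * (e - b) * (e - c) = 0 → (∃ w, w ≠ 0 ∧ (x1 - e) * (x2 - e) = w ^ 2) →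
      ∃ r, (EC a b c).addX x1 x2 ℓ - e = r ^ 2 := by
    rintro e he ⟨w, hw, hww⟩
    have := congrArg (Polynomial.eval e) hp
    simp only [Polynomial.eval_neg, Cubic.toPoly, Polynomial.eval_add, Polynomial.eval_mul, Polynomial.eval_C, Polynomial.eval_pow, Polynomial.eval_X, Polynomial.eval_sub] at this
    simp only [EC] at this
    refine ⟨(y1 + ℓ * (e - x1)) / w, ?_⟩
    have h3 : w ^ 2 * ((EC a b c).addX x1 x2 ℓ - e) = (y1 + ℓ * (e - x1)) ^ 2 := by
      rw [← hww]
      simp only [EC]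
      linear_combination (-1) * this - he
    rw [div_pow, ← h3]
    field_simp
  obtain ⟨r, hr⟩ := key a (by ring) ha
  obtain ⟨s, hs⟩ := key b (by ring) hb
  obtain ⟨t, ht⟩ := key c (by ring) hc
  exact halve hab hbc hca _ hr hs ht
end

section
variable {K : Type*} [Field K] [NumberField K] {a b c : K} (hab : a ≠ b) (hbc : b ≠ c) (hca : c ≠ a)
include hab hbc hca

lemma x_sub_even : ∃ N : 𝓞 K, N ≠ 0 ∧ ∀ x y : K, y ^ 2 = (x - a) * (x - b) * (x - c) → ∀ i : Fin 3, x - ![a, b, c] i = 0 ∨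
      x - ![a, b, c] i ∈ {u : K | u ≠ 0 ∧ ∀ v : HeightOneSpectrum (𝓞 K), N ∉ v.asIdeal → ∃ w : ℤᵐ⁰, v.valuation K u = w ^ 2} := by
  have hinj : Function.Injective ![a, b, c] := by
    intro i j hij
    fin_cases i <;> fin_cases j <;> simp_all
  obtain ⟨N, hN, h⟩ := exists_N_roots ![a, b, c] hinj 1 one_ne_zero
  refine ⟨N, hN, fun x y e i => ?_⟩
  by_cases h0 : x - ![a, b, c] i = 0
  · exact Or.inl h0
  refine Or.inr ⟨h0, fun v hv => ?_⟩
  obtain ⟨g1, g2, g3⟩ := h v hv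
  have e' : y ^ 2 = 1 * ∏ i, (x - ![a, b, c] i) := by rw [e, Fin.prod_univ_three]; simp
  have hev := val_even (v.valuation K) ![a, b, c] g1 g2 g3 e'
  rcases hev i with ⟨hx, hxi⟩ | hw
  · refine ⟨v.valuation K y / v.valuation K x, ?_⟩
    have hall : ∀ j, v.valuation K (x - ![a, b, c] j) = v.valuation K x := by
      intro j
      exact Valuation.map_sub_eq_of_lt_left _ (lt_of_le_of_lt (g1 j) hx)
    have hx0 : v.valuation K x ≠ 0 := (zero_lt_one.trans hx).ne'
    rw [hxi, div_pow, ← map_pow, e', map_mul, map_one, one_mul, map_prod, Fin.prod_univ_three, hall, hall, hall]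
    field_simp
  · exact hw

theorem EC_fg : AddGroup.FG (EC a b c).Point := by
  obtain ⟨N, hN, hA⟩ := x_sub_even hab hbc hca
  obtain ⟨g, T, hT, hgT, hg⟩ := (finMod_S K N hN).classify
  set f : (EC a b c).Point → Option (K × K × K) := fun P => match P with
    | .zero => none
    | .some x y _ => some (g (x - a), g (x - b), g (x - c)) with hf
  have hrange : (Set.range f).Finite := by
    refine Set.Finite.subset (Set.Finite.insert none ((hT.prod (hT.prod hT)).image some)) ?_
    rintro _ ⟨P, rfl⟩
    rcases P with _ | ⟨x, y, h⟩
    · exact Or.inl rfl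
    · right
      have e := (EC_eq a b c x y).1 h.1
      exact ⟨_, ⟨hgT _ (hA x y e 0), hgT _ (hA x y e 1), hgT _ (hA x y e 2)⟩, rfl⟩
  have hclass : ∀ P Q, f P = f Q → ∃ R, R + R = P - Q := by
    have h2 : ∀ P Q : (EC a b c).Point, (∃ R, R + R = P + Q) → ∃ R, R + R = P - Q := by
      rintro P Q ⟨R, hR⟩
      exact ⟨R - Q, by rw [show R - Q + (R - Q) = R + R - Q - Q by abel, hR]; abel⟩
    intro P Q hPQ
    rcases P with _ | ⟨x1, y1, n1⟩ <;> rcases Q with _ | ⟨x2, y2, n2⟩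
    · exact ⟨0, by simp⟩
    · simp [hf] at hPQ
    · simp [hf] at hPQ
    · simp only [hf, Option.some.injEq, Prod.mk.injEq] at hPQ
      obtain ⟨p1, p2, p3⟩ := hPQ
      have e1 := (EC_eq a b c x1 y1).1 n1.1
      have e2 := (EC_eq a b c x2 y2).1 n2.1
      have bad : ∀ e, (e = a ∨ e = b ∨ e = c) → x1 - e = 0 ∧ x2 - e = 0 → ∃ R, R + R = Point.some x1 y1 n1 - Point.some x2 y2 n2 := by
        rintro e he ⟨u1, u2⟩
        have hx : x1 = x2 := by linear_combination u1 - u2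
        have hz : ∀ x y : K, x - e = 0 → y ^ 2 = (x - a) * (x - b) * (x - c) → y = 0 := by
          intro x y hx hy
          rw [sub_eq_zero] at hx
          have : y ^ 2 = 0 := by rw [hy, hx]; rcases he with rfl | rfl | rfl <;> ring
          exact pow_eq_zero_iff two_ne_zero |>.1 this
        have hy1 := hz x1 y1 u1 e1
        have hy2 := hz x2 y2 u2 e2
        subst hx hy1 hy2
        exact ⟨0, by simp⟩
      rcases hg _ _ (hA x1 y1 e1 0) (hA x2 y2 e2 0) p1 with u | w1
      · exact bad a (Or.inl rfl) u
      rcases hg _ _ (hA x1 y1 e1 1) (hA x2 y2 e2 1) p2 with u | w2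
      · exact bad b (Or.inr (Or.inl rfl)) u
      rcases hg _ _ (hA x1 y1 e1 2) (hA x2 y2 e2 2) p3 with u | w3
      · exact bad c (Or.inr (Or.inr rfl)) u
      exact h2 _ _ (same_class hab hbc hca n1 n2 w1 w2 w3)
  have hfi : (nsmulAddMonoidHom (α := (EC a b c).Point) 2).range.FiniteIndex := by
    rw [AddSubgroup.finiteIndex_iff_finite_quotient]
    have := hrange.to_subtype
    refine Finite.of_surjective (fun r : Set.range f => (QuotientAddGroup.mk r.2.choose : (EC a b c).Point ⧸ (nsmulAddMonoidHom (α := (EC a b c).Point) 2).range)) ?_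
    intro q
    obtain ⟨P, rfl⟩ := QuotientAddGroup.mk_surjective q
    refine ⟨⟨f P, P, rfl⟩, ?_⟩
    have hs : f (Exists.choose (⟨P, rfl⟩ : ∃ y, f y = f P)) = f P := Exists.choose_spec (⟨P, rfl⟩ : ∃ y, f y = f P)
    refine QuotientAddGroup.eq.2 ?_
    obtain ⟨R, hR⟩ := hclass P _ hs.symm
    refine ⟨R, ?_⟩
    rw [nsmulAddMonoidHom_apply, two_nsmul, hR]; abel
  obtain ⟨C, hC⟩ := nh_par hab hbc hca
  have := nh_northcott a b c
  exact AddCommGroup.fg_of_descent' hfi nh_nonneg hC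
end
end
end Mord

set_option linter.unusedSectionVars false
set_option linter.style.longLine false

namespace Mord

noncomputable section

section
variable {K : Type*} [Field K]

def NN (c3 c2 c1 c0 z1 y1 z2 y2 : K) : K := 2 * (y1 * y2) + c3 * (z1 ^ 2 * z2 ^ 2) * (z1 ^ 2 + z2 ^ 2) + 2 * (c2 * (z1 ^ 2 * z2 ^ 2)) + c1 * (z1 ^ 2 + z2 ^ 2) + 2 * c0
def NM (c3 c2 c1 c0 z1 y1 z2 y2 : K) : K := 2 * (z1 * y1 * (z2 * y2)) + c0 * (z1 ^ 2 + z2 ^ 2) + 2 * (c1 * (z1 ^ 2 * z2 ^ 2)) + c2 * (z1 ^ 2 * z2 ^ 2) * (z1 ^ 2 + z2 ^ 2) + 2 * (c3 * (z1 ^ 2 * z2 ^ 2) ^ 2)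
def DD (z1 z2 : K) : K := ((z1 - z2) * (z1 + z2)) ^ 2

structure LB (v : AbsoluteValue K ℝ) (L : ℝ) : Prop where
  one_le : 1 ≤ L
  add : ∀ x y, v (x + y) ≤ L * max (v x) (v y)
  two : v 2 ≤ L

variable {v : AbsoluteValue K ℝ} {L : ℝ}

lemma LB.addb (h : LB v L) {a b : ℕ} {x y : K} {t : ℝ} (ht : 0 ≤ t) (hx : v x ≤ L ^ a * t) (hy : v y ≤ L ^ b * t) :
    v (x + y) ≤ L ^ (a + b + 1) * t := by
  have h1 := h.one_le
  have h0 : 0 ≤ L := by linarith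
  have e1 : L ^ a ≤ L ^ (a + b) := pow_le_pow_right₀ h1 (by omega)
  have e2 : L ^ b ≤ L ^ (a + b) := pow_le_pow_right₀ h1 (by omega)
  calc v (x + y) ≤ L * max (v x) (v y) := h.add x y
    _ ≤ L * (L ^ (a + b) * t) := by
      refine mul_le_mul_of_nonneg_left (max_le (hx.trans ?_) (hy.trans ?_)) h0
      · exact mul_le_mul_of_nonneg_right e1 ht
      · exact mul_le_mul_of_nonneg_right e2 ht
    _ = _ := by ring

lemma LB.subb (h : LB v L) {a b : ℕ} {x y : K} {t : ℝ} (ht : 0 ≤ t) (hx : v x ≤ L ^ a * t) (hy : v y ≤ L ^ b * t) :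
    v (x - y) ≤ L ^ (a + b + 1) * t := by
  rw [sub_eq_add_neg]
  exact h.addb ht hx (by rw [v.map_neg]; exact hy)

lemma LB.mulb (h : LB v L) {a b : ℕ} {x y : K} {t t' : ℝ} (ht : 0 ≤ t) (hx : v x ≤ L ^ a * t) (hy : v y ≤ L ^ b * t') :
    v (x * y) ≤ L ^ (a + b) * (t * t') := by
  have h0 : 0 ≤ L := by linarith [h.one_le]
  rw [map_mul]
  calc v x * v y ≤ (L ^ a * t) * (L ^ b * t') := mul_le_mul hx hy (v.nonneg _) (by positivity)
    _ = _ := by ring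

lemma LB.mulc (h : LB v L) {a b : ℕ} {x y : K} {t : ℝ} (hx : v x ≤ L ^ a * 1) (hy : v y ≤ L ^ b * t) :
    v (x * y) ≤ L ^ (a + b) * t := by
  have := h.mulb zero_le_one hx hy
  rwa [one_mul] at this

lemma LB.powb (_h : LB v L) {a : ℕ} {x : K} {t : ℝ} (hx : v x ≤ L ^ a * t) (n : ℕ) :
    v (x ^ n) ≤ L ^ (a * n) * t ^ n := by
  rw [map_pow]
  calc v x ^ n ≤ (L ^ a * t) ^ n := pow_le_pow_left₀ (v.nonneg _) hx n
    _ = _ := by rw [mul_pow, ← pow_mul]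

lemma LB.mono (h : LB v L) {a b : ℕ} {x t t' : ℝ} (ht : 0 ≤ t) (hab : a ≤ b) (hx : x ≤ L ^ a * t) (htt : t ≤ t') : x ≤ L ^ b * t' := by
  have h1 := h.one_le
  calc x ≤ L ^ a * t := hx
    _ ≤ L ^ b * t' := mul_le_mul (pow_le_pow_right₀ h1 hab) htt ht (by positivity)

/-- the sixth degree value -/
lemma LB.yb (h : LB v L) {c3 c2 c1 c0 z y : K} (h3 : v c3 ≤ L) (h2 : v c2 ≤ L) (h1 : v c1 ≤ L) (h0 : v c0 ≤ L)
    (hy : y ^ 2 = c3 * (z ^ 2) ^ 3 + c2 * (z ^ 2) ^ 2 + c1 * z ^ 2 + c0) : v y ≤ L ^ 10 * max 1 (v z) ^ 3 := by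
  have hL := h.one_le
  set P := max 1 (v z) with hP
  have hP1 : 1 ≤ P := le_max_left _ _
  have hz : v z ≤ P := le_max_right _ _
  have hP0 : 0 ≤ P := by linarith
  have pp : ∀ k, k ≤ 6 → v z ^ k ≤ P ^ 6 := fun k hk =>
    (pow_le_pow_left₀ (v.nonneg _) hz k).trans (pow_le_pow_right₀ hP1 hk)
  have t0 : 0 ≤ P ^ 6 := by positivity
  have tm : ∀ c : K, v c ≤ L → ∀ k, k ≤ 6 → v (c * z ^ k) ≤ L ^ 1 * P ^ 6 := by
    intro c hc k hk
    rw [map_mul, map_pow, pow_one]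
    exact mul_le_mul hc (pp k hk) (by positivity) (by linarith)
  have e : v (y ^ 2) ≤ L ^ 7 * P ^ 6 := by
    have := h.addb t0 (h.addb t0 (h.addb t0 (tm c3 h3 6 le_rfl) (tm c2 h2 4 (by norm_num))) (tm c1 h1 2 (by norm_num))) (tm c0 h0 0 (by norm_num))
    rw [hy]
    convert this using 2
    ring
  rw [map_pow] at e
  have e2 : v y ^ 2 ≤ (L ^ 10 * P ^ 3) ^ 2 := by
    refine e.trans ?_
    rw [mul_pow, ← pow_mul, ← pow_mul]
    exact mul_le_mul_of_nonneg_right (pow_le_pow_right₀ hL (by norm_num)) t0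
  exact (pow_le_pow_iff_left₀ (v.nonneg _) (by positivity) two_ne_zero).1 e2

/-- both coordinates bounded -/
lemma LB.chartA (h : LB v L) {c3 c2 c1 c0 z1 y1 z2 y2 : K} (h3 : v c3 ≤ L) (h2 : v c2 ≤ L) (h1 : v c1 ≤ L) (h0 : v c0 ≤ L)
    (hy1 : y1 ^ 2 = c3 * (z1 ^ 2) ^ 3 + c2 * (z1 ^ 2) ^ 2 + c1 * z1 ^ 2 + c0)
    (hy2 : y2 ^ 2 = c3 * (z2 ^ 2) ^ 3 + c2 * (z2 ^ 2) ^ 2 + c1 * z2 ^ 2 + c0)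
    (hz1 : v z1 ≤ L) (hz2 : v z2 ≤ L) {m : ℝ} (hm1 : v (z1 - z2) ≤ m) (hm2 : v (y1 + y2) ≤ m) :
    ∀ a b, (a = NN c3 c2 c1 c0 z1 y1 z2 y2 ∨ a = DD z1 z2) → (b = NM c3 c2 c1 c0 z1 y1 z2 y2 ∨ b = DD z1 z2) →
      v (4 * a * b) ≤ L ^ 300 * (m ^ 4 * v (z1 + z2) ^ 2) := by
  have hL := h.one_le
  have hL0 : 0 ≤ L := by linarith
  have hm0 : 0 ≤ m := (v.nonneg _).trans hm1
  set s := z1 + z2 with hs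
  set d := z1 - z2 with hd
  set A := y1 + y2 with hA
  set Bq := z1 * y1 + z2 * y2 with hB
  set S := v s with hS
  have S0 : 0 ≤ S := v.nonneg _
  have bz1 : v z1 ≤ L ^ 1 * 1 := by simpa using hz1
  have bz2 : v z2 ≤ L ^ 1 * 1 := by simpa using hz2
  have b3 : v c3 ≤ L ^ 1 * 1 := by simpa using h3
  have b2 : v c2 ≤ L ^ 1 * 1 := by simpa using h2
  have b1 : v c1 ≤ L ^ 1 * 1 := by simpa using h1
  have bd : v d ≤ L ^ 0 * m := by simpa using hm1
  have bA : v A ≤ L ^ 0 * m := by simpa using hm2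
  have bs : v s ≤ L ^ 0 * S := by simp [hS]
  have bs' : v s ≤ L ^ 3 * 1 := h.addb zero_le_one bz1 bz2
  have b2' : v 2 ≤ L ^ 1 * 1 := by simpa using h.two
  have by2 : v y2 ≤ L ^ 13 * 1 := by
    have := h.yb h3 h2 h1 h0 hy2
    refine this.trans ?_
    have e : max 1 (v z2) ^ 3 ≤ L ^ 3 := pow_le_pow_left₀ (by positivity) (max_le hL hz2) 3
    calc L ^ 10 * max 1 (v z2) ^ 3 ≤ L ^ 10 * L ^ 3 := mul_le_mul_of_nonneg_left e (by positivity)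
      _ = _ := by ring
  have bB : v Bq ≤ L ^ 15 * m := by
    have e : Bq = z1 * A - y2 * d := by rw [hB, hA, hd]; ring
    rw [e]
    have := h.subb (by positivity) (h.mulb zero_le_one bz1 bA) (h.mulb zero_le_one by2 bd)
    simpa using this
  have bX : v (z1 ^ 2 + z2 ^ 2) ≤ L ^ 5 * 1 := by
    have := h.addb zero_le_one (by simpa using h.powb bz1 2 : v (z1 ^ 2) ≤ L ^ 2 * 1) (by simpa using h.powb bz2 2 : v (z2 ^ 2) ≤ L ^ 2 * 1)
    simpa using this
  have mo : ∀ {a : ℕ} (b : ℕ) {x t : ℝ}, 0 ≤ t → a ≤ b → x ≤ L ^ a * t → x ≤ L ^ b * t := fun {a} b {x t} ht hab hx => h.mono ht hab hx le_rfl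
  have bal : v (c3 * (z1 ^ 2 + z2 ^ 2) + c2) ≤ L ^ 8 * 1 := by
    have := h.addb zero_le_one (by simpa using h.mulb zero_le_one b3 bX : v (c3 * (z1 ^ 2 + z2 ^ 2)) ≤ L ^ (1 + 5) * 1) b2
    exact mo _ zero_le_one (by norm_num) this
  have bbe : v (c3 * (z1 ^ 2 + z2 ^ 2) ^ 2 + c2 * (z1 ^ 2 + z2 ^ 2) + c1) ≤ L ^ 22 * 1 := by
    have e1 : v (c3 * (z1 ^ 2 + z2 ^ 2) ^ 2) ≤ L ^ 11 * 1 := by simpa using h.mulb zero_le_one b3 (by simpa using h.powb bX 2 : v ((z1 ^ 2 + z2 ^ 2) ^ 2) ≤ L ^ 10 * 1)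
    have e2 : v (c2 * (z1 ^ 2 + z2 ^ 2)) ≤ L ^ 6 * 1 := by simpa using h.mulb zero_le_one b2 bX
    have := h.addb zero_le_one (h.addb zero_le_one e1 e2) b1
    exact mo _ zero_le_one (by norm_num) this
  set al := c3 * (z1 ^ 2 + z2 ^ 2) + c2 with hal
  set be := c3 * (z1 ^ 2 + z2 ^ 2) ^ 2 + c2 * (z1 ^ 2 + z2 ^ 2) + c1 with hbe
  set ph := c3 * (z1 ^ 4 + z1 ^ 2 * z2 ^ 2 + z2 ^ 4) + c2 * (z1 ^ 2 + z2 ^ 2) + c1 with hph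
  have bph : v ph ≤ L ^ 30 * 1 := by
    have e : ph = be - c3 * (z1 * z2) ^ 2 := by rw [hph, hbe]; ring
    have e1 : v (z1 * z2) ≤ L ^ 2 * 1 := by simpa using h.mulb zero_le_one bz1 bz2
    have e2 : v (c3 * (z1 * z2) ^ 2) ≤ L ^ 5 * 1 := by simpa using h.mulb zero_le_one b3 (by simpa using h.powb e1 2 : v ((z1 * z2) ^ 2) ≤ L ^ 4 * 1)
    rw [e]
    exact mo _ zero_le_one (by norm_num) (h.subb zero_le_one bbe e2)
  have hNN : NN c3 c2 c1 c0 z1 y1 z2 y2 = A ^ 2 - al * (d * s) ^ 2 := by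
    rw [NN, hA, hal, hd, hs]; linear_combination (-1) * hy1 - hy2
  have hNM : NM c3 c2 c1 c0 z1 y1 z2 y2 = Bq ^ 2 - be * (d * s) ^ 2 := by
    rw [NM, hB, hbe, hd, hs]; linear_combination (-z1 ^ 2) * hy1 - z2 ^ 2 * hy2
  have hDD : DD z1 z2 = (d * s) ^ 2 := rfl
  have hAB : 2 * (A * Bq) = s * (A ^ 2 + d ^ 2 * ph) := by
    rw [hA, hB, hs, hd, hph]; linear_combination (z1 - z2) * hy1 - (z1 - z2) * hy2
  have m2 : 0 ≤ m ^ 2 := by positivity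
  have bd2 : v (d ^ 2) ≤ L ^ 0 * m ^ 2 := by simpa using h.powb bd 2
  have bA2 : v (A ^ 2) ≤ L ^ 0 * m ^ 2 := by simpa using h.powb bA 2
  have bB2 : v (Bq ^ 2) ≤ L ^ 30 * m ^ 2 := by simpa using h.powb bB 2
  have bs2 : v (s ^ 2) ≤ L ^ 0 * S ^ 2 := by simpa using h.powb bs 2
  have bs2' : v (s ^ 2) ≤ L ^ 6 * 1 := by simpa using h.powb bs' 2
  have T0 : 0 ≤ m ^ 4 * S ^ 2 := by positivity
  have b4 : v 4 ≤ L ^ 2 * 1 := by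
    have := h.powb b2' 2
    norm_num at this
    simpa using this
  -- AB squared
  have bAB : v ((2 * (A * Bq)) ^ 2) ≤ L ^ 80 * (m ^ 4 * S ^ 2) := by
    have e1 : v (d ^ 2 * ph) ≤ L ^ 30 * m ^ 2 := by simpa using h.mulb m2 bd2 bph
    have e2 := h.mulb S0 bs (h.addb m2 bA2 e1)
    rw [← hAB] at e2
    have e3 := h.powb e2 2
    have : (S * m ^ 2) ^ 2 = m ^ 4 * S ^ 2 := by ring
    rw [this] at e3
    exact mo _ T0 (by norm_num) e3
  have bAd : v (A ^ 2 * (d * s) ^ 2) ≤ L ^ 0 * (m ^ 4 * S ^ 2) := by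
    have := h.mulb m2 bA2 (h.mulb m2 bd2 bs2)
    rw [mul_pow]; convert this using 2; ring
  have bBd : v (Bq ^ 2 * (d * s) ^ 2) ≤ L ^ 30 * (m ^ 4 * S ^ 2) := by
    have := h.mulb m2 bB2 (h.mulb m2 bd2 bs2)
    rw [mul_pow]; convert this using 2; ring
  have bdd : v ((d * s) ^ 2 * (d * s) ^ 2) ≤ L ^ 6 * (m ^ 4 * S ^ 2) := by
    have := h.mulb (by positivity) (h.mulb m2 bd2 bs2) (h.mulb m2 bd2 bs2')
    rw [mul_pow]; convert this using 2; ring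
  have four : ∀ {x : K} {n : ℕ}, v x ≤ L ^ n * (m ^ 4 * S ^ 2) → v (4 * x) ≤ L ^ (2 + n) * (m ^ 4 * S ^ 2) := by
    intro x n hx
    simpa using h.mulb zero_le_one b4 hx
  rintro a b (rfl | rfl) (rfl | rfl)
  · rw [hNN, hNM]
    have e : 4 * (A ^ 2 - al * (d * s) ^ 2) * (Bq ^ 2 - be * (d * s) ^ 2) =
        (2 * (A * Bq)) ^ 2 - 4 * (al * (Bq ^ 2 * (d * s) ^ 2)) - 4 * (be * (A ^ 2 * (d * s) ^ 2)) + 4 * ((al * be) * ((d * s) ^ 2 * (d * s) ^ 2)) := by ring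
    rw [e]
    have e1 := four (h.mulc bal bBd)
    have e2 := four (h.mulc bbe bAd)
    have e3 := four (h.mulc (h.mulc bal bbe) bdd)
    exact mo _ T0 (by norm_num) (h.addb T0 (h.subb T0 (h.subb T0 bAB e1) e2) e3)
  · rw [hNN, hDD]
    have e : 4 * (A ^ 2 - al * (d * s) ^ 2) * (d * s) ^ 2 =
       4 * (A ^ 2 * (d * s) ^ 2) - 4 * (al * ((d * s) ^ 2 * (d * s) ^ 2)) := by ring
    rw [e]
    have e1 := four bAd
    have e3 := four (h.mulc bal bdd)
    exact mo _ T0 (by norm_num) (h.subb T0 e1 e3)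
  · rw [hNM, hDD]
    have e : 4 * (d * s) ^ 2 * (Bq ^ 2 - be * (d * s) ^ 2) =
       4 * (Bq ^ 2 * (d * s) ^ 2) - 4 * (be * ((d * s) ^ 2 * (d * s) ^ 2)) := by ring
    rw [e]
    have e1 := four bBd
    have e3 := four (h.mulc bbe bdd)
    exact mo _ T0 (by norm_num) (h.subb T0 e1 e3)
  · rw [hDD, mul_assoc]
    exact mo _ T0 (by norm_num) (four bdd)
end
end
end Mord

set_option linter.unusedSectionVars false
set_option linter.style.longLine false

namespace Mord

noncomputable section

section
variable {K : Type*} [Field K]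
variable {v : AbsoluteValue K ℝ} {L : ℝ}

/-- both coordinates away from zero -/
lemma LB.chartB (h : LB v L) {c3 c2 c1 c0 z1 y1 z2 y2 : K} (h3 : v c3 ≤ L) (h2 : v c2 ≤ L) (h1 : v c1 ≤ L) (h0 : v c0 ≤ L)
    (hy1 : y1 ^ 2 = c3 * (z1 ^ 2) ^ 3 + c2 * (z1 ^ 2) ^ 2 + c1 * z1 ^ 2 + c0)
    (hy2 : y2 ^ 2 = c3 * (z2 ^ 2) ^ 3 + c2 * (z2 ^ 2) ^ 2 + c1 * z2 ^ 2 + c0)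
    (hz1 : 1 ≤ v z1) (hz2 : 1 ≤ v z2) {m : ℝ} (hm1 : v ((z1 - z2) * (z1 ^ 2 * z2 ^ 2)) ≤ m) (hm2 : v (y1 * z2 ^ 3 + y2 * z1 ^ 3) ≤ m) :
    ∀ a b, (a = NN c3 c2 c1 c0 z1 y1 z2 y2 ∨ a = DD z1 z2) → (b = NM c3 c2 c1 c0 z1 y1 z2 y2 ∨ b = DD z1 z2) →
      v (4 * a * b) * (v z1 ^ 6 * v z2 ^ 6) ≤ L ^ 300 * (m ^ 4 * v (z1 + z2) ^ 2) := by
  have n1 : z1 ≠ 0 := by rintro rfl; rw [map_zero] at hz1; linarith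
  have n2 : z2 ≠ 0 := by rintro rfl; rw [map_zero] at hz2; linarith
  have p1 : 0 < v z1 := by linarith
  have p2 : 0 < v z2 := by linarith
  have hL := h.one_le
  set W := v z1 * v z2 with hW
  have hW0 : 0 < W := mul_pos p1 p2
  have A := h.chartA (c3 := c0) (c2 := c1) (c1 := c2) (c0 := c3) (z1 := z1⁻¹) (z2 := z2⁻¹) (y1 := y1 / z1 ^ 3) (y2 := y2 / z2 ^ 3) h0 h1 h2 h3
    (by rw [div_pow, hy1]; field_simp; ring) (by rw [div_pow, hy2]; field_simp; ring)
    (by rw [map_inv₀]; exact (inv_le_one_of_one_le₀ hz1).trans hL) (by rw [map_inv₀]; exact (inv_le_one_of_one_le₀ hz2).trans hL)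
    (m := m / W ^ 3) (by
      have e : z1⁻¹ - z2⁻¹ = -(((z1 - z2) * (z1 ^ 2 * z2 ^ 2)) / (z1 * z2) ^ 3) := by field_simp; ring
      rw [e, v.map_neg, map_div₀, map_pow, map_mul v z1 z2]
      exact div_le_div_of_nonneg_right hm1 (by positivity)) (by
      have e : y1 / z1 ^ 3 + y2 / z2 ^ 3 = (y1 * z2 ^ 3 + y2 * z1 ^ 3) / (z1 * z2) ^ 3 := by field_simp
      rw [e, map_div₀, map_pow, map_mul v z1 z2]
      exact div_le_div_of_nonneg_right hm2 (by positivity))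
  have eNN : NN c0 c1 c2 c3 z1⁻¹ (y1 / z1 ^ 3) z2⁻¹ (y2 / z2 ^ 3) = NM c3 c2 c1 c0 z1 y1 z2 y2 / (z1 * z2) ^ 4 := by
    rw [NN, NM]; field_simp; ring
  have eNM : NM c0 c1 c2 c3 z1⁻¹ (y1 / z1 ^ 3) z2⁻¹ (y2 / z2 ^ 3) = NN c3 c2 c1 c0 z1 y1 z2 y2 / (z1 * z2) ^ 4 := by
    rw [NN, NM]; field_simp; ring
  have eDD : DD z1⁻¹ z2⁻¹ = DD z1 z2 / (z1 * z2) ^ 4 := by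
    rw [DD, DD]; field_simp; ring
  have es : z1⁻¹ + z2⁻¹ = (z1 + z2) / (z1 * z2) := by field_simp; ring
  rw [eNN, eNM, eDD, es] at A
  intro a b ha hb
  have B := A (b / (z1 * z2) ^ 4) (a / (z1 * z2) ^ 4) (by rcases hb with rfl | rfl <;> simp) (by rcases ha with rfl | rfl <;> simp)
  have e4 : 4 * (b / (z1 * z2) ^ 4) * (a / (z1 * z2) ^ 4) = 4 * a * b / (z1 * z2) ^ 8 := by field_simp
  rw [e4, map_div₀, map_pow, map_mul v z1 z2, map_div₀, map_mul v z1 z2, ← hW, div_le_iff₀ (by positivity)] at B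
  calc v (4 * a * b) * (v z1 ^ 6 * v z2 ^ 6) = v (4 * a * b) * W ^ 6 := by rw [hW]; ring
    _ ≤ (L ^ 300 * ((m / W ^ 3) ^ 4 * (v (z1 + z2) / W) ^ 2) * W ^ 8) * W ^ 6 := mul_le_mul_of_nonneg_right B (by positivity)
    _ = _ := by field_simp

/-- separated coordinates -/
lemma LB.chartC (h : LB v L) {c3 c2 c1 c0 z1 y1 z2 y2 : K} (h3 : v c3 ≤ L) (h2 : v c2 ≤ L) (h1 : v c1 ≤ L) (h0 : v c0 ≤ L)
    (hy1 : y1 ^ 2 = c3 * (z1 ^ 2) ^ 3 + c2 * (z1 ^ 2) ^ 2 + c1 * z1 ^ 2 + c0)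
    (hy2 : y2 ^ 2 = c3 * (z2 ^ 2) ^ 3 + c2 * (z2 ^ 2) ^ 2 + c1 * z2 ^ 2 + c0)
    (hd : max 1 (v z1) * max 1 (v z2) ≤ L * v (z1 - z2)) (hs : max 1 (v z1) * max 1 (v z2) ≤ L * v (z1 + z2))
    {m : ℝ} (hm : v (z1 - z2) * (max 1 (v z1) * max 1 (v z2)) ^ 2 ≤ m) :
    ∀ a b, (a = NN c3 c2 c1 c0 z1 y1 z2 y2 ∨ a = DD z1 z2) → (b = NM c3 c2 c1 c0 z1 y1 z2 y2 ∨ b = DD z1 z2) →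
      v (4 * a * b) * (max 1 (v z1) ^ 6 * max 1 (v z2) ^ 6) ≤ L ^ 300 * (m ^ 4 * v (z1 + z2) ^ 2) := by
  have hL := h.one_le
  have hL0 : 0 < L := by linarith
  have by1 := h.yb h3 h2 h1 h0 hy1
  have by2 := h.yb h3 h2 h1 h0 hy2
  set P := max 1 (v z1) with hP
  set Q := max 1 (v z2) with hQ
  have P1 : 1 ≤ P := le_max_left _ _
  have Q1 : 1 ≤ Q := le_max_left _ _
  have P0 : 0 < P := by linarith
  have Q0 : 0 < Q := by linarith
  have bz1 : v z1 ≤ L ^ 0 * P := by rw [pow_zero, one_mul]; exact le_max_right 1 (v z1)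
  have bz2 : v z2 ≤ L ^ 0 * Q := by rw [pow_zero, one_mul]; exact le_max_right 1 (v z2)
  set W := P * Q with hW
  have W0 : 0 < W := by positivity
  have W1 : 1 ≤ W := one_le_mul_of_one_le_of_one_le P1 Q1
  have T0 : 0 ≤ W ^ 4 := by positivity
  have b3 : v c3 ≤ L ^ 1 * 1 := by simpa using h3
  have b2 : v c2 ≤ L ^ 1 * 1 := by simpa using h2
  have b1 : v c1 ≤ L ^ 1 * 1 := by simpa using h1
  have b0 : v c0 ≤ L ^ 1 * 1 := by simpa using h0
  have b2' : v 2 ≤ L ^ 1 * 1 := by simpa using h.two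
  have mo : ∀ {a : ℕ} (b : ℕ) {x t t' : ℝ}, 0 ≤ t → a ≤ b → t ≤ t' → x ≤ L ^ a * t → x ≤ L ^ b * t' := fun {a} b {x t t'} ht hab htt hx => h.mono ht hab hx htt
  have WW : ∀ k l, k ≤ l → W ^ k ≤ W ^ l := fun k l hkl => pow_le_pow_right₀ W1 hkl
  have PW : P ≤ W := le_mul_of_one_le_right P0.le Q1
  have QW : Q ≤ W := le_mul_of_one_le_left Q0.le P1
  have bz1W : v z1 ≤ L ^ 0 * W := mo 0 P0.le le_rfl PW bz1
  have bz2W : v z2 ≤ L ^ 0 * W := mo 0 Q0.le le_rfl QW bz2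
  have bsq : v (z1 ^ 2 + z2 ^ 2) ≤ L ^ 1 * W ^ 2 := h.addb (a := 0) (b := 0) (by positivity) (h.powb bz1W 2) (h.powb bz2W 2)
  have bzz : v (z1 * z2) ≤ L ^ 0 * W := h.mulb P0.le bz1 bz2
  have bx : v (z1 ^ 2 * z2 ^ 2) ≤ L ^ 0 * W ^ 2 := by
    rw [← mul_pow]; simpa using h.powb bzz 2
  have bxx : v (z1 ^ 2 * z2 ^ 2 * (z1 ^ 2 + z2 ^ 2)) ≤ L ^ 1 * W ^ 4 := by
    have e : z1 ^ 2 * z2 ^ 2 * (z1 ^ 2 + z2 ^ 2) = (z1 ^ 2 * z1 ^ 2 * z2 ^ 2) + (z1 ^ 2 * z2 ^ 2 * z2 ^ 2) := by ring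
    rw [e]
    have q1 : v (z1 ^ 2 * z1 ^ 2 * z2 ^ 2) ≤ L ^ 0 * W ^ 4 := by
      have := h.mulb (by positivity) (h.powb bz1 4) (h.powb bz2 2)
      have e : z1 ^ 2 * z1 ^ 2 * z2 ^ 2 = z1 ^ 4 * z2 ^ 2 := by ring
      rw [e]
      refine mo 0 (by positivity) (by norm_num) ?_ this
      rw [hW, mul_pow]
      exact mul_le_mul_of_nonneg_left (pow_le_pow_right₀ Q1 (by norm_num)) (by positivity)
    have q2 : v (z1 ^ 2 * z2 ^ 2 * z2 ^ 2) ≤ L ^ 0 * W ^ 4 := by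
      have := h.mulb (by positivity) (h.powb bz1 2) (h.powb bz2 4)
      have e : z1 ^ 2 * z2 ^ 2 * z2 ^ 2 = z1 ^ 2 * z2 ^ 4 := by ring
      rw [e]
      refine mo 0 (by positivity) (by norm_num) ?_ this
      rw [hW, mul_pow]
      exact mul_le_mul_of_nonneg_right (pow_le_pow_right₀ P1 (by norm_num)) (by positivity)
    exact h.addb T0 q1 q2
  have byy : v (y1 * y2) ≤ L ^ 20 * W ^ 3 := by
    have := h.mulb (by positivity) by1 by2
    rwa [← mul_pow] at this
  have byz : v (z1 * y1 * (z2 * y2)) ≤ L ^ 20 * W ^ 4 := by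
    have := h.mulb W0.le bzz byy
    convert this using 2 <;> ring
  have bNN : v (NN c3 c2 c1 c0 z1 y1 z2 y2) ≤ L ^ 60 * W ^ 4 := by
    rw [NN]
    have t1 := mo 21 (by positivity) (by norm_num) (WW 3 4 (by norm_num)) (h.mulc b2' byy)
    have t2 := h.mulc b3 bxx
    have t3 := mo 2 (by positivity) (by norm_num) (WW 2 4 (by norm_num)) (h.mulc b2' (h.mulc b2 bx))
    have t4 := mo 2 (by positivity) (by norm_num) (WW 2 4 (by norm_num)) (h.mulc b1 bsq)
    have t5 : v (2 * c0) ≤ L ^ 2 * W ^ 4 := mo 2 zero_le_one (by norm_num) (one_le_pow₀ W1) (h.mulc b2' b0)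
    rw [← mul_assoc] at t2
    exact mo _ T0 (by norm_num) le_rfl (h.addb T0 (h.addb T0 (h.addb T0 (h.addb T0 t1 t2) t3) t4) t5)
  have bNM : v (NM c3 c2 c1 c0 z1 y1 z2 y2) ≤ L ^ 60 * W ^ 4 := by
    rw [NM]
    have t1 := h.mulc b2' byz
    have t2 := mo 2 (by positivity) (by norm_num) (WW 2 4 (by norm_num)) (h.mulc b0 bsq)
    have t3 := mo 2 (by positivity) (by norm_num) (WW 2 4 (by norm_num)) (h.mulc b2' (h.mulc b1 bx))
    have t4 := h.mulc b2 bxx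
    have t5 : v (2 * (c3 * (z1 ^ 2 * z2 ^ 2) ^ 2)) ≤ L ^ 2 * W ^ 4 := by
      have := h.mulc b2' (h.mulc b3 (h.powb bx 2))
      rw [← pow_mul] at this
      exact mo _ T0 (by norm_num) le_rfl this
    rw [← mul_assoc] at t4
    exact mo _ T0 (by norm_num) le_rfl (h.addb T0 (h.addb T0 (h.addb T0 (h.addb T0 t1 t2) t3) t4) t5)
  have bDD : v (DD z1 z2) ≤ L ^ 60 * W ^ 4 := by
    have e : DD z1 z2 = (z1 ^ 2 + z2 ^ 2) ^ 2 - 2 * (2 * (z1 ^ 2 * z2 ^ 2)) := by rw [DD]; ring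
    rw [e]
    have t1 := h.powb bsq 2
    rw [← pow_mul] at t1
    have t2 := h.mulc b2' (mo 2 (by positivity) (by norm_num) (WW 2 4 (by norm_num)) (h.mulc b2' bx))
    have e : (z1 ^ 2 + z2 ^ 2) ^ 2 - 2 * (2 * (z1 ^ 2 * z2 ^ 2)) = (z1 ^ 2 + z2 ^ 2) ^ 2 - 2 * (2 * (z1 ^ 2 * z2 ^ 2)) := rfl
    exact mo _ T0 (by norm_num) le_rfl (h.subb T0 t1 t2)
  have b4 : v 4 ≤ L ^ 2 * 1 := by
    have := h.powb b2' 2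
    norm_num at this
    simpa using this
  intro a b ha hb
  have ba : v a ≤ L ^ 60 * W ^ 4 := by rcases ha with rfl | rfl <;> assumption
  have bb : v b ≤ L ^ 60 * W ^ 4 := by rcases hb with rfl | rfl <;> assumption
  have t := h.mulb T0 (h.mulc b4 ba) bb
  have m1 : W ^ 3 ≤ L * m := by
    calc W ^ 3 = W * W ^ 2 := by ring
      _ ≤ (L * v (z1 - z2)) * W ^ 2 := mul_le_mul_of_nonneg_right hd (by positivity)
      _ = L * (v (z1 - z2) * W ^ 2) := by ring
      _ ≤ _ := mul_le_mul_of_nonneg_left hm hL0.le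
  have m0 : 0 ≤ m := le_trans (by positivity) hm
  calc v (4 * a * b) * (P ^ 6 * Q ^ 6) ≤ (L ^ (2 + 60 + 60) * (W ^ 4 * W ^ 4)) * (P ^ 6 * Q ^ 6) := mul_le_mul_of_nonneg_right t (by positivity)
    _ = L ^ 122 * ((W ^ 3) ^ 4 * W ^ 2) := by rw [hW]; ring
    _ ≤ L ^ 122 * ((L * m) ^ 4 * (L * v (z1 + z2)) ^ 2) := by
      refine mul_le_mul_of_nonneg_left ?_ (by positivity)
      exact mul_le_mul (pow_le_pow_left₀ (by positivity) m1 4) (pow_le_pow_left₀ W0.le hs 2) (by positivity) (by positivity)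
    _ = L ^ 128 * (m ^ 4 * v (z1 + z2) ^ 2) := by ring
    _ ≤ _ := mul_le_mul_of_nonneg_right (pow_le_pow_right₀ hL (by norm_num)) (by positivity)

lemma LB.all (h : LB v L) {c3 c2 c1 c0 z1 y1 z2 y2 : K} (h3 : v c3 ≤ L) (h2 : v c2 ≤ L) (h1 : v c1 ≤ L) (h0 : v c0 ≤ L)
    (hy1 : y1 ^ 2 = c3 * (z1 ^ 2) ^ 3 + c2 * (z1 ^ 2) ^ 2 + c1 * z1 ^ 2 + c0)
    (hy2 : y2 ^ 2 = c3 * (z2 ^ 2) ^ 3 + c2 * (z2 ^ 2) ^ 2 + c1 * z2 ^ 2 + c0)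
    {m : ℝ} (m1 : v (z1 - z2) ≤ m) (m2 : v ((z1 - z2) * z1 ^ 2) ≤ m) (m3 : v ((z1 - z2) * z2 ^ 2) ≤ m) (m4 : v ((z1 - z2) * (z1 ^ 2 * z2 ^ 2)) ≤ m)
    (m5 : v (y1 + y2) ≤ m) (m6 : v (y1 * z2 ^ 3 + y2 * z1 ^ 3) ≤ m) :
    ∀ a b, (a = NN c3 c2 c1 c0 z1 y1 z2 y2 ∨ a = DD z1 z2) → (b = NM c3 c2 c1 c0 z1 y1 z2 y2 ∨ b = DD z1 z2) →
      v (4 * a * b) * (max 1 (v z1) ^ 6 * max 1 (v z2) ^ 6) ≤ L ^ 312 * (m ^ 4 * v (z1 + z2) ^ 2) := by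
  have hL := h.one_le
  have hL0 : 0 < L := by linarith
  intro a b ha hb
  have mm : 0 ≤ m ^ 4 * v (z1 + z2) ^ 2 := by positivity
  have up : L ^ 300 * (m ^ 4 * v (z1 + z2) ^ 2) ≤ L ^ 312 * (m ^ 4 * v (z1 + z2) ^ 2) :=
    mul_le_mul_of_nonneg_right (pow_le_pow_right₀ hL (by norm_num)) mm
  have sep : ∀ x y : K, v x < 1 → L < v y → v y ≤ L * v (x + y) := by
    intro x y hx hy
    have e : v y ≤ L * max (v (x + y)) (v x) := by
      have := h.add (x + y) (-x)
      rwa [v.map_neg, add_neg_cancel_comm] at this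
    rcases le_total (v (x + y)) (v x) with hle | hle
    · rw [max_eq_right hle] at e
      have : L * v x ≤ L * 1 := mul_le_mul_of_nonneg_left hx.le hL0.le
      linarith
    · rwa [max_eq_left hle] at e
  have hmP : v (z1 - z2) * (max 1 (v z1) * max 1 (v z2)) ^ 2 ≤ m := by
    rw [map_mul, map_pow] at m2 m3
    rw [map_mul, map_mul, map_pow, map_pow] at m4
    rcases le_total 1 (v z1) with q1 | q1 <;> rcases le_total 1 (v z2) with q2 | q2
    · rw [max_eq_right q1, max_eq_right q2, mul_pow]; exact m4
    · rw [max_eq_right q1, max_eq_left q2, mul_one]; exact m2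
    · rw [max_eq_left q1, max_eq_right q2, one_mul]; exact m3
    · rw [max_eq_left q1, max_eq_left q2, mul_one, one_pow, mul_one]; exact m1
  by_cases hA : v z1 ≤ L ∧ v z2 ≤ L
  · have t := h.chartA h3 h2 h1 h0 hy1 hy2 hA.1 hA.2 m1 m5 a b ha hb
    have e1 : max 1 (v z1) ^ 6 ≤ L ^ 6 := pow_le_pow_left₀ (by positivity) (max_le hL hA.1) 6
    have e2 : max 1 (v z2) ^ 6 ≤ L ^ 6 := pow_le_pow_left₀ (by positivity) (max_le hL hA.2) 6
    calc _ ≤ (L ^ 300 * (m ^ 4 * v (z1 + z2) ^ 2)) * (L ^ 6 * L ^ 6) :=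
          mul_le_mul t (mul_le_mul e1 e2 (by positivity) (by positivity)) (by positivity) (mul_nonneg (pow_nonneg hL0.le _) mm)
      _ = _ := by ring
  by_cases hB : 1 ≤ v z1 ∧ 1 ≤ v z2
  · have t := h.chartB h3 h2 h1 h0 hy1 hy2 hB.1 hB.2 m4 m6 a b ha hb
    rw [max_eq_right hB.1, max_eq_right hB.2]
    exact t.trans up
  refine le_trans ?_ up
  have hcase : (v z1 < 1 ∧ L < v z2) ∨ (v z2 < 1 ∧ L < v z1) := by
    rw [not_and_or, not_le, not_le] at hA hB
    rcases hB with q | q <;> rcases hA with r | r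
    · linarith
    · exact Or.inl ⟨q, r⟩
    · exact Or.inr ⟨q, r⟩
    · linarith
  rcases hcase with ⟨q1, q2⟩ | ⟨q1, q2⟩
  · refine h.chartC h3 h2 h1 h0 hy1 hy2 ?_ ?_ hmP a b ha hb
    · rw [max_eq_left q1.le, max_eq_right (hL.trans q2.le), one_mul]
      have := sep (-z1) z2 (by rwa [v.map_neg]) q2
      rwa [neg_add_eq_sub, v.map_sub] at this
    · rw [max_eq_left q1.le, max_eq_right (hL.trans q2.le), one_mul]
      exact sep z1 z2 q1 q2
  · refine h.chartC h3 h2 h1 h0 hy1 hy2 ?_ ?_ hmP a b ha hb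
    · rw [max_eq_left q1.le, max_eq_right (hL.trans q2.le), mul_one]
      have := sep (-z2) z1 (by rwa [v.map_neg]) q2
      rwa [neg_add_eq_sub] at this
    · rw [max_eq_left q1.le, max_eq_right (hL.trans q2.le), mul_one, add_comm]
      exact sep z2 z1 q1 q2
end
end
end Mord

set_option linter.unusedSectionVars false
set_option linter.style.longLine false

namespace Mord
open Height NumberField Polynomial
open scoped ENNReal

noncomputable section

section
variable {K : Type*} [Field K] [NumberField K]

lemma int_bd (x : 𝓞 K) : ∃ C : ℝ, 2 ≤ C ∧ ∀ u v, Pl u v → v (x : K) ≤ cst u C := by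
  refine ⟨2 + ∑ φ : K →+* ℂ, ‖φ x‖, ?_, ?_⟩
  · have : 0 ≤ ∑ φ : K →+* ℂ, ‖φ x‖ := Finset.sum_nonneg fun _ _ => norm_nonneg _
    linarith
  · intro u v h
    cases u with
    | false => simpa [cst] using pl_false_integral h x
    | true =>
      obtain ⟨φ, hφ⟩ := pl_true_iff.1 h
      rw [hφ]
      have := Finset.single_le_sum (f := fun φ : K →+* ℂ => ‖φ x‖) (fun _ _ => norm_nonneg _) (Finset.mem_univ φ)
      simp only [cst, if_true]
      linarith

lemma Bd_of_int (F : K[X]) (h : ∀ k, ∃ x : 𝓞 K, (x : K) = F.coeff k) : ∃ CF : ℕ, Bd F CF := by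
  choose x hx using h
  choose C hC2 hC using fun k => int_bd (x k)
  refine ⟨∑ k ∈ Finset.range (F.natDegree + 1), ⌈C k⌉₊, ?_, ?_⟩
  · have h0 : 1 ≤ ⌈C 0⌉₊ := Nat.one_le_ceil_iff.2 (by linarith [hC2 0])
    exact h0.trans (Finset.single_le_sum (f := fun k => ⌈C k⌉₊) (fun _ _ => Nat.zero_le _) (by simp))
  · intro u v hv
    rw [SubNorm.poly_apply]
    cases u with
    | false =>
      simp only [osum, ecst, one_pow, mul_one, Bool.false_eq_true, if_false]
      refine iSup_le fun k => ?_
      rw [plN_apply, ← hx]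
      have := pl_false_integral hv (x k)
      simpa using this
    | true =>
      simp only [osum, ecst, one_pow, mul_one, if_true]
      rw [tsum_eq_sum (s := Finset.range (F.natDegree + 1))]
      · push_cast
        refine Finset.sum_le_sum fun k _ => ?_
        rw [plN_apply, ← hx, ← ENNReal.ofReal_natCast]
        refine ENNReal.ofReal_le_ofReal (((hC k) true v hv).trans ?_)
        simp only [cst, if_true]
        exact Nat.le_ceil _
      · intro k hk
        rw [plN_apply, F.coeff_eq_zero_of_natDegree_lt (by simpa using hk)]
        simp

lemma LB_of_pl {u v} (h : Pl (K := K) u v) {C : ℝ} (hC : 2 ≤ C) : LB v (cst u C) := by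
  cases u with
  | false =>
    have hn := pl_nonarch h
    refine ⟨by simp [cst], fun x y => ?_, ?_⟩
    · simpa [cst] using hn x y
    · have := pl_false_integral h 2
      have e2 : ((2 : 𝓞 K) : K) = 2 := map_ofNat (algebraMap (𝓞 K) K) 2
      rw [e2] at this
      simpa [cst] using this
  | true =>
    refine ⟨by simp only [cst, if_true]; linarith, fun x y => ?_, ?_⟩
    · simp only [cst, if_true]
      have h1 := v.add_le x y
      have h2 : 0 ≤ max (v x) (v y) := le_max_of_le_left (v.nonneg _)
      have h3 := le_max_left (v x) (v y)
      have h4 := le_max_right (v x) (v y)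
      nlinarith
    · simp only [cst, if_true]
      have h1 := v.add_le 1 1
      rw [one_add_one_eq_two, map_one] at h1
      linarith

theorem M_lower (c3 c2 c1 c0 : 𝓞 K) : ∃ C : ℝ, ∀ z1 y1 z2 y2 : K,
    y1 ^ 2 = c3 * (z1 ^ 2) ^ 3 + c2 * (z1 ^ 2) ^ 2 + c1 * z1 ^ 2 + c0 →
    y2 ^ 2 = c3 * (z2 ^ 2) ^ 3 + c2 * (z2 ^ 2) ^ 2 + c1 * z2 ^ 2 + c0 → z1 ^ 2 ≠ z2 ^ 2 →
    logHeight₁ (NN (c3 : K) c2 c1 c0 z1 y1 z2 y2 / DD z1 z2) + logHeight₁ (NM (c3 : K) c2 c1 c0 z1 y1 z2 y2 / DD z1 z2) + 6 * (logHeight₁ z1 + logHeight₁ z2)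
      ≤ 4 * logHeight (mv z1 y1 z2 y2) + C := by
  obtain ⟨C3, q3, h3⟩ := int_bd c3
  obtain ⟨C2, q2, h2⟩ := int_bd c2
  obtain ⟨C1, q1, h1⟩ := int_bd c1
  obtain ⟨C0, q0, h0⟩ := int_bd c0
  set B := C3 + C2 + C1 + C0 with hB
  have hB2 : 2 ≤ B := by linarith
  refine ⟨totalWeight K * Real.log (B ^ 312), ?_⟩
  intro z1 y1 z2 y2 e1 e2 hne
  have hd : z1 - z2 ≠ 0 := fun h => hne (by rw [sub_eq_zero.1 h])
  have hs : z1 + z2 ≠ 0 := fun h => hne (by rw [eq_neg_of_add_eq_zero_left h]; ring)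
  have hD : DD z1 z2 ≠ 0 := pow_ne_zero _ (mul_ne_zero hd hs)
  set N1 := NN (c3 : K) c2 c1 c0 z1 y1 z2 y2 with hN1
  set N2 := NM (c3 : K) c2 c1 c0 z1 y1 z2 y2 with hN2
  set D := DD z1 z2 with hDd
  have n1 : ![N1, D] ≠ 0 := fun h => hD (by simpa using congrFun h 1)
  have n2 : ![N2, D] ≠ 0 := fun h => hD (by simpa using congrFun h 1)
  have h4 : (4 : K) ≠ 0 := by norm_num
  have nb : box (4 : K) z1 z2 6 6 ≠ 0 := box_ne h4 z1 z2 6 6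
  have n12 : (fun a : Fin 2 × Fin 2 => ![N1, D] a.1 * ![N2, D] a.2) ≠ 0 := fun h => by
    have := congrFun h (1, 1)
    simp at this
    exact hD this
  have nx : (fun a : (Fin 2 × Fin 2) × (Fin 2 × Fin 2) => (fun a : Fin 2 × Fin 2 => ![N1, D] a.1 * ![N2, D] a.2) a.1 * box (4 : K) z1 z2 6 6 a.2) ≠ 0 := by
    obtain ⟨i, hi⟩ := Function.ne_iff.1 n12
    obtain ⟨j, hj⟩ := Function.ne_iff.1 nb
    exact fun h => (mul_ne_zero hi hj) (congrFun h (i, j))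
  have nm : mv z1 y1 z2 y2 ≠ 0 := mv_ne (sub_ne_zero.1 hd) y1 y2
  have nm4 : (z1 + z2) ^ 2 • (mv z1 y1 z2 y2) ^ 4 ≠ 0 := by
    obtain ⟨i, hi⟩ := Function.ne_iff.1 nm
    exact fun h => (mul_ne_zero (pow_ne_zero 2 hs) (pow_ne_zero 4 hi)) (congrFun h i)
  have key := logHeight_le_of_local nx nm4 (C := B ^ 312) (one_le_pow₀ (by linarith)) (by
    rintro u v hv ⟨⟨i, j⟩, k⟩
    have lb := LB_of_pl hv hB2
    have bc : ∀ {x : K} {c : ℝ}, v x ≤ cst u c → c ≤ B → v x ≤ cst u B := fun hx hc => hx.trans (cst_mono u hc)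
    obtain ⟨j0, hj0⟩ := Finite.exists_max (fun j => v (mv z1 y1 z2 y2 j))
    have all := lb.all (m := v (mv z1 y1 z2 y2 j0)) (bc (h3 u v hv) (by linarith)) (bc (h2 u v hv) (by linarith)) (bc (h1 u v hv) (by linarith)) (bc (h0 u v hv) (by linarith)) e1 e2
      (hj0 0) (hj0 1) (hj0 2) (hj0 3) (hj0 4) (hj0 5) (![N1, D] i) (![N2, D] j) (by fin_cases i <;> simp [hN1, hDd]) (by fin_cases j <;> simp [hN2, hDd])
    rw [cst_pow]
    have hb := box_le v (4 : K) z1 z2 6 6 k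
    have hsup : v (mv z1 y1 z2 y2 j0) ^ 4 * v (z1 + z2) ^ 2 ≤ ⨆ j, v (((z1 + z2) ^ 2 • (mv z1 y1 z2 y2) ^ 4) j) := by
      refine le_trans (le_of_eq ?_) (le_ciSup (Finite.bddAbove_range _) j0)
      simp only [Pi.smul_apply, Pi.pow_apply, smul_eq_mul, map_mul, map_pow]
      ring
    have L0 : 0 ≤ cst u B ^ 312 := pow_nonneg (by linarith [lb.one_le]) _
    refine le_trans ?_ (mul_le_mul_of_nonneg_left hsup L0)
    refine le_trans ?_ all
    simp only [map_mul]
    calc v (![N1, D] i) * v (![N2, D] j) * v (box (4 : K) z1 z2 6 6 k)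
        ≤ v (![N1, D] i) * v (![N2, D] j) * (v 4 * (max 1 (v z1) ^ 6 * max 1 (v z2) ^ 6)) :=
          mul_le_mul_of_nonneg_left hb (mul_nonneg (v.nonneg _) (v.nonneg _))
      _ = _ := by ring)
  rw [logHeight_fun_mul_eq n12 nb, logHeight_fun_mul_eq n1 n2, logHeight_box h4, logHeight_smul_eq_logHeight _ (pow_ne_zero 2 hs), logHeight_pow] at key
  rw [logHeight₁_div_eq_logHeight, logHeight₁_div_eq_logHeight]
  push_cast at key
  linarith
end
end
end Mord

set_option linter.unusedSectionVars false
set_option linter.style.longLine false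

namespace Mord
open Height NumberField Polynomial WeierstrassCurve WeierstrassCurve.Affine Filter
open scoped Classical

noncomputable section

lemma final_real {h1 h2 qi qj qs X M s C : ℝ} (hC : 0 ≤ C) (hi : |qi - 4 * h1| ≤ C) (hj : |qj - 4 * h2| ≤ C) (hqs : qs ≤ X + C)
    (hX : X + 6 * (h1 + h2) ≤ 4 * M + C) (hp : 2 * (1 - 1 / 100) * √(qi * qj) ≤ qs - qi - qj) (hs : h2 = s ^ 2 * h1) (hs1 : 1 ≤ s)
    (hh : 10000 * (C + 1) ≤ h1) (hM : M ≤ 5 / 2 * (h1 + h2) + 1.96 * (s * h1)) : False := by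
  rw [abs_le] at hi hj
  have h10 : 0 < h1 := by linarith
  have hsh : h1 ≤ s * h1 := le_mul_of_one_le_left h10.le hs1
  have hs2 : h1 ≤ h2 := by rw [hs]; exact le_mul_of_one_le_left h10.le (one_le_pow₀ hs1)
  have a1 : 3.99 * h1 ≤ qi := by linarith
  have a2 : 3.99 * h2 ≤ qj := by linarith
  have a3 : 3.99 * (s * h1) ≤ √(qi * qj) := by
    refine Real.le_sqrt_of_sq_le ?_
    calc (3.99 * (s * h1)) ^ 2 = (3.99 * h1) * (3.99 * h2) := by rw [hs]; ring
      _ ≤ qi * qj := mul_le_mul a1 a2 (by linarith) (by linarith)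
  linarith

section
variable {K : Type*} [Field K] [NumberField K]

lemma h1_bd (r z : K) (hr : r ≠ 0) (hz : z ≠ 0) : |logHeight₁ (r / z ^ 2) - 2 * logHeight₁ z| ≤ logHeight₁ r := by
  have e1 : logHeight₁ (r / z ^ 2) ≤ logHeight₁ r + 2 * logHeight₁ z := by
    rw [div_eq_mul_inv]
    refine (logHeight₁_mul_le _ _).trans ?_
    rw [logHeight₁_inv, logHeight₁_pow]; push_cast; linarith
  have e2 : 2 * logHeight₁ z ≤ logHeight₁ r + logHeight₁ (r / z ^ 2) := by
    have e : z ^ 2 = r * (r / z ^ 2)⁻¹ := by field_simp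
    have := logHeight₁_mul_le r (r / z ^ 2)⁻¹
    rw [← e, logHeight₁_inv, logHeight₁_pow] at this
    push_cast at this; linarith
  rw [abs_le]; constructor <;> linarith

lemma heights_tendsto (B : K → Set K) (hB : ∀ z, (B z).Finite) (p : ℕ → K × K) (hp : Function.Injective p) (hpB : ∀ n, (p n).2 ∈ B (p n).1) :
    Tendsto (fun n => logHeight₁ (p n).1) atTop atTop := by
  rw [← Nat.cofinite_eq_atTop, tendsto_atTop]
  intro T
  rw [eventually_cofinite]
  have fz := NumberField.finite_setOfPred_logHeight₁_le K T
  have : (⋃ z ∈ {z : K | logHeight₁ z ≤ T}, ({z} ×ˢ B z : Set (K × K))).Finite :=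
    Set.Finite.biUnion fz fun z _ => (Set.finite_singleton z).prod (hB z)
  refine (this.preimage (f := p) hp.injOn).subset ?_
  intro n hn
  simp only [Set.mem_ofPred_eq, not_le] at hn
  simp only [Set.mem_preimage, Set.mem_iUnion]
  exact ⟨(p n).1, hn.le, rfl, hpB n⟩

lemma sq_finite (t : K) : {y : K | y ^ 2 = t}.Finite := by
  have : (X ^ 2 - C t : K[X]) ≠ 0 := (monic_X_pow_sub_C t two_ne_zero).ne_zero
  refine (Polynomial.finite_setOfPred_isRoot this).subset ?_
  intro y hy
  simp only [Set.mem_ofPred_eq] at hy ⊢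
  simp [hy]

set_option maxHeartbeats 3200000 in
theorem bielliptic_finite (a b c : 𝓞 K) (e : K) (he : e ^ 2 = a) (ha : (a : K) ≠ 0) (hb : (b : K) ≠ 0) (hc : (c : K) ≠ 0)
    (hab : (a : K) ≠ b) (hbc : (b : K) ≠ c) (hca : (c : K) ≠ a) :
    {p : K × K | p.2 ^ 2 = (p.1 ^ 2 - a) * (p.1 ^ 2 - b) * (p.1 ^ 2 - c)}.Finite := by
  by_contra hinf
  have hinf : Set.Infinite {p : K × K | p.2 ^ 2 = (p.1 ^ 2 - a) * (p.1 ^ 2 - b) * (p.1 ^ 2 - c)} := hinf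
  have hbad : {p : K × K | p.2 ^ 2 = (p.1 ^ 2 - a) * (p.1 ^ 2 - b) * (p.1 ^ 2 - c) ∧ (p.1 = 0 ∨ p.2 = 0)}.Finite := by
    have f1 := sq_finite (-((a : K) * b * c))
    have f2 := ((sq_finite (a : K)).union (sq_finite (b : K))).union (sq_finite (c : K))
    refine (((Set.finite_singleton (0 : K)).prod f1).union (f2.prod (Set.finite_singleton (0 : K)))).subset ?_
    rintro ⟨z, y⟩ ⟨h, h' | h'⟩
    · simp only at h h'
      subst h'
      left
      refine ⟨rfl, ?_⟩
      show y ^ 2 = _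
      rw [h]; ring
    · simp only at h h'
      subst h'
      right
      refine ⟨?_, rfl⟩
      have h2 : (z ^ 2 - (a : K)) * (z ^ 2 - b) * (z ^ 2 - c) = 0 := by rw [← h]; ring
      rcases mul_eq_zero.1 h2 with h3 | h3
      · rcases mul_eq_zero.1 h3 with h4 | h4
        · exact Or.inl (Or.inl (sub_eq_zero.1 h4))
        · exact Or.inl (Or.inr (sub_eq_zero.1 h4))
      · exact Or.inr (sub_eq_zero.1 h3)
  have hinf2 := hinf.sdiff hbad
  obtain ⟨zz, yy, hinj, heq, hz0, hy0⟩ : ∃ zz yy : ℕ → K, (Function.Injective fun n => (zz n, yy n)) ∧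
      (∀ n, yy n ^ 2 = (zz n ^ 2 - (a : K)) * (zz n ^ 2 - b) * (zz n ^ 2 - c)) ∧ (∀ n, zz n ≠ 0) ∧ ∀ n, yy n ≠ 0 := by
    let p := hinf2.natEmbedding
    exact ⟨fun n => (p n).1.1, fun n => (p n).1.2, fun i j h => p.injective (Subtype.ext h), fun n => (p n).2.1,
      fun n h => (p n).2.2 ⟨(p n).2.1, Or.inl h⟩, fun n h => (p n).2.2 ⟨(p n).2.1, Or.inr h⟩⟩
  clear hinf2 hbad hinf
  have hT : Tendsto (fun n => logHeight₁ (zz n)) atTop atTop :=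
    heights_tendsto (fun z : K => {y : K | y ^ 2 = (z ^ 2 - (a : K)) * (z ^ 2 - b) * (z ^ 2 - c)}) (fun z => sq_finite _) (fun n => (zz n, yy n))
      hinj heq
  -- the polynomial
  set F : K[X] := (X ^ 2 - C (a : K)) * (X ^ 2 - C (b : K)) * (X ^ 2 - C (c : K)) with hF
  have hFe : ∀ z, F.eval z = (z ^ 2 - a) * (z ^ 2 - b) * (z ^ 2 - c) := by intro z; simp [hF]
  have hFd : F.natDegree ≤ 6 := by rw [hF]; compute_degree
  obtain ⟨CF, hCF⟩ := Bd_of_int F (by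
    intro k
    refine ⟨((X ^ 2 - C a) * (X ^ 2 - C b) * (X ^ 2 - C c) : (𝓞 K)[X]).coeff k, ?_⟩
    have : F = ((X ^ 2 - C a) * (X ^ 2 - C b) * (X ^ 2 - C c) : (𝓞 K)[X]).map (algebraMap (𝓞 K) K) := by
      simp [hF]
    rw [this, coeff_map])
  have he0 : e ≠ 0 := by rintro rfl; apply ha; rw [← he]; ring
  obtain ⟨H0, s0, hH0, hs0, hV⟩ := vojta (F := F) (F' := (X + C e) * (X ^ 2 - C (b : K)) * (X ^ 2 - C (c : K))) (r := e)
    (by rw [hF, ← he, C_pow]; ring) (by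
      simp only [eval_mul, eval_add, eval_sub, eval_X, eval_C, eval_pow, he]
      refine mul_ne_zero (mul_ne_zero ?_ (sub_ne_zero.2 hab)) (sub_ne_zero.2 hca.symm)
      rw [← two_mul]; exact mul_ne_zero two_ne_zero he0) hFd hCF
  obtain ⟨CM, hCM⟩ := M_lower (K := K) 1 (-(a + b + c)) (a * b + b * c + c * a) (-(a * b * c))
  push_cast at hCM
  set ρ : K := (a : K) * b * c with hρ
  have hρ0 : ρ ≠ 0 := mul_ne_zero (mul_ne_zero ha hb) hc
  -- elliptic curves
  have hab2 : -((b : K) * c) ≠ -(c * a) := by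
    intro h; exact hab (mul_left_cancel₀ hc (by linear_combination h))
  have hbc2 : -((c : K) * a) ≠ -(a * b) := by
    intro h; exact hbc (mul_left_cancel₀ ha (by linear_combination h))
  have hca2 : -((a : K) * b) ≠ -(b * c) := by
    intro h; exact hca (mul_left_cancel₀ hb (by linear_combination h))
  have fg1 := EC_fg hab hbc hca
  have fg2 := EC_fg hab2 hbc2 hca2
  obtain ⟨P1, hP1⟩ := nh_par hab hbc hca
  obtain ⟨P2, hP2⟩ := nh_par hab2 hbc2 hca2
  obtain ⟨q1, q1n, q1p, C1, hC1⟩ := canonical nh nh_nonneg P1 hP1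
  obtain ⟨q2, q2n, q2p, C2, hC2⟩ := canonical nh nh_nonneg P2 hP2
  have fg : AddGroup.FG ((EC (a : K) b c).Point × (EC (-((b : K) * c)) (-(c * a)) (-(a * b))).Point) := by
    have := Module.Finite.iff_addGroup_fg.2 fg1
    have := Module.Finite.iff_addGroup_fg.2 fg2
    exact Module.Finite.iff_addGroup_fg.1 inferInstance
  set q : (EC (a : K) b c).Point × (EC (-((b : K) * c)) (-(c * a)) (-(a * b))).Point → ℝ := fun P => q1 P.1 + q2 P.2 with hq
  have ns1 : ∀ n, (EC (a : K) b c).Nonsingular ((zz n) ^ 2) (yy n) := fun n => EC_ns hab hbc hca (heq n)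
  have ns2 : ∀ n, (EC (-((b : K) * c)) (-(c * a)) (-(a * b))).Nonsingular (-ρ / (zz n) ^ 2) (ρ * (yy n) / (zz n) ^ 3) := fun n =>
    EC_ns hab2 hbc2 hca2 (by
      have hz := hz0 n
      have := heq n
      rw [div_pow, mul_pow, this, hρ]; field_simp; ring)
  set u : ℕ → (EC (a : K) b c).Point × (EC (-((b : K) * c)) (-(c * a)) (-(a * b))).Point := fun n =>
    (Point.some _ _ (ns1 n), Point.some _ _ (ns2 n)) with hu
  set CC := C1 + C2 + logHeight₁ (-ρ) + |CM| with hCd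
  have C1n : 0 ≤ C1 := (abs_nonneg _).trans (hC1 0)
  have C2n : 0 ≤ C2 := (abs_nonneg _).trans (hC2 0)
  have hrn : 0 ≤ logHeight₁ (-ρ) := zero_le_logHeight₁ _
  have hCMn := abs_nonneg CM
  have hCMl := le_abs_self CM
  have hCn : 0 ≤ CC := by linarith
  have hqu : ∀ n, |q (u n) - 4 * logHeight₁ (zz n)| ≤ CC := by
    intro n
    have t1 := hC1 (u n).1
    have t2 := hC2 (u n).2
    simp only [hu, nh_some] at t1 t2
    rw [logHeight₁_pow] at t1
    have t3 := h1_bd (-ρ) (zz n) (neg_ne_zero.2 hρ0) (hz0 n)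
    simp only [hq, hu]
    push_cast at t1
    rw [abs_le] at *
    constructor <;> linarith
  have huT : Tendsto (fun n => q (u n)) atTop atTop := by
    have : Tendsto (fun n => 4 * logHeight₁ (zz n) - CC) atTop atTop :=
      tendsto_atTop_add_const_right _ _ (hT.const_mul_atTop (by norm_num))
    refine tendsto_atTop_mono (fun n => ?_) this
    have := (abs_le.1 (hqu n)).1
    linarith
  obtain ⟨i, j, g1, g2, g3⟩ := pigeon q (by
      intro x y
      have := q1p x.1 y.1
      have := q2p x.2 y.2
      simp only [hq, Prod.fst_add, Prod.snd_add, Prod.fst_sub, Prod.snd_sub]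
      linarith) (fun x => add_nonneg (q1n _) (q2n _)) fg u huT (1 / 100) (2 * s0 ^ 2 + 2) (4 * (H0 + 10000 * (CC + 1)) + CC) (by norm_num)
  set z1 := zz i with hz1
  set y1 := yy i with hy1
  set z2 := zz j with hz2
  set y2 := yy j with hy2
  set h1 := logHeight₁ z1 with hh1
  set h2 := logHeight₁ z2 with hh2
  have ai := hqu i
  have aj := hqu j
  have ai' := abs_le.1 ai
  have aj' := abs_le.1 aj
  have hh : H0 + 10000 * (CC + 1) ≤ h1 := by linarith
  have h1p : 0 < h1 := by linarith
  have hss : 1 ≤ s0 ^ 2 := one_le_pow₀ hs0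
  have hrat : (s0 ^ 2 + 1) * h1 ≤ h2 := by
    have e1 : (2 * s0 ^ 2 + 2) * (3 * h1) ≤ (2 * s0 ^ 2 + 2) * q (u i) := mul_le_mul_of_nonneg_left (by linarith) (by positivity)
    have e2 : (2 * s0 ^ 2 + 2) * (3 * h1) = 6 * (s0 ^ 2 * h1) + 6 * h1 := by ring
    have e3 : (s0 ^ 2 + 1) * h1 = s0 ^ 2 * h1 + h1 := by ring
    have e4 : 0 ≤ s0 ^ 2 * h1 := by positivity
    linarith
  have hlt : h1 < h2 := by
    have : 1 * h1 ≤ s0 ^ 2 * h1 := mul_le_mul_of_nonneg_right hss h1p.le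
    have e3 : (s0 ^ 2 + 1) * h1 = s0 ^ 2 * h1 + h1 := by ring
    linarith
  have hx : z1 ^ 2 ≠ z2 ^ 2 := by
    intro h
    have := congrArg logHeight₁ h
    rw [logHeight₁_pow, logHeight₁_pow] at this
    push_cast at this
    linarith
  have hzne : z1 ≠ z2 := fun h => hx (by rw [h])
  have z10 : z1 ≠ 0 := hz0 i
  have z20 : z2 ≠ 0 := hz0 j
  have E1 : y1 ^ 2 = (z1 ^ 2 - a) * (z1 ^ 2 - b) * (z1 ^ 2 - c) := heq i
  have E2 : y2 ^ 2 = (z2 ^ 2 - a) * (z2 ^ 2 - b) * (z2 ^ 2 - c) := heq j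
  set s := √(h2 / h1) with hs
  have hs2 : h2 = s ^ 2 * h1 := by
    rw [hs, Real.sq_sqrt (div_nonneg (by linarith) h1p.le)]; field_simp
  have hss0 : s0 ≤ s := by
    refine Real.le_sqrt_of_sq_le ?_
    rw [le_div_iff₀ h1p]
    have e3 : (s0 ^ 2 + 1) * h1 = s0 ^ 2 * h1 + h1 := by ring
    linarith
  have V := hV z1 y1 z2 (-y2) (by rw [hFe]; exact E1) (by rw [hFe, neg_sq]; exact E2) (hy0 i) (neg_ne_zero.2 (hy0 j)) hzne (by linarith) s hss0 hs2
  have W := hCM z1 y1 z2 (-y2) (by rw [E1]; ring) (by rw [neg_sq, E2]; ring) hx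
  have hdx : z1 ^ 2 - z2 ^ 2 ≠ 0 := sub_ne_zero.2 hx
  have hDD : DD z1 z2 = (z1 ^ 2 - z2 ^ 2) ^ 2 := by rw [DD]; ring
  have add1 : nh (u i + u j).1 = logHeight₁ (NN (1 : K) (-(a + b + c)) (a * b + b * c + c * a) (-ρ) z1 y1 z2 (-y2) / DD z1 z2) := by
    have e0 : (u i + u j).1 = Point.some _ _ (ns1 i) + Point.some _ _ (ns1 j) := rfl
    rw [e0, Point.add_of_X_ne hx, nh_some, slope_of_X_ne hx]
    congr 1
    rw [hDD, eq_div_iff (pow_ne_zero 2 hdx)]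
    simp only [addX, EC, NN]
    have e1 : ((y1 - y2) / (z1 ^ 2 - z2 ^ 2)) ^ 2 * (z1 ^ 2 - z2 ^ 2) ^ 2 = (y1 - y2) ^ 2 := by
      rw [div_pow, div_mul_cancel₀ _ (pow_ne_zero 2 hdx)]
    linear_combination e1 + E1 + E2
  have hX2 : -ρ / z1 ^ 2 ≠ -ρ / z2 ^ 2 := by
    intro h
    rw [div_eq_div_iff (pow_ne_zero 2 z10) (pow_ne_zero 2 z20)] at h
    exact hx (mul_left_cancel₀ (neg_ne_zero.2 hρ0) h).symm
  have add2 : nh (u i + u j).2 = logHeight₁ (NM (1 : K) (-(a + b + c)) (a * b + b * c + c * a) (-ρ) z1 y1 z2 (-y2) / DD z1 z2) := by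
    have e0 : (u i + u j).2 = Point.some _ _ (ns2 i) + Point.some _ _ (ns2 j) := rfl
    rw [e0, Point.add_of_X_ne hX2, nh_some, slope_of_X_ne hX2]
    congr 1
    rw [hDD, eq_div_iff (pow_ne_zero 2 hdx)]
    have sl : (ρ * y1 / z1 ^ 3 - ρ * y2 / z2 ^ 3) / (-ρ / z1 ^ 2 - -ρ / z2 ^ 2) = (y1 * z2 ^ 3 - y2 * z1 ^ 3) / (z1 * z2 * (z1 ^ 2 - z2 ^ 2)) := by
      have : -ρ / z1 ^ 2 - -ρ / z2 ^ 2 = ρ * (z1 ^ 2 - z2 ^ 2) / (z1 ^ 2 * z2 ^ 2) := by field_simp; ring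
      rw [this]
      field_simp
    rw [sl]
    simp only [addX, EC, NM]
    have e1 : ((y1 * z2 ^ 3 - y2 * z1 ^ 3) / (z1 * z2 * (z1 ^ 2 - z2 ^ 2))) ^ 2 * (z1 ^ 2 - z2 ^ 2) ^ 2 = (y1 * z2 ^ 3 - y2 * z1 ^ 3) ^ 2 / (z1 ^ 2 * z2 ^ 2) := by
      field_simp
    have e2 : (y1 * z2 ^ 3 - y2 * z1 ^ 3) ^ 2 / (z1 ^ 2 * z2 ^ 2) = ((z1 ^ 2 - a) * (z1 ^ 2 - b) * (z1 ^ 2 - c) * z2 ^ 6 + (z2 ^ 2 - a) * (z2 ^ 2 - b) * (z2 ^ 2 - c) * z1 ^ 6) / (z1 ^ 2 * z2 ^ 2) - 2 * (z1 * z2) * (y1 * y2) := by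
      rw [← E1, ← E2]; field_simp; ring
    rw [e2] at e1
    have e3 : ∀ T : K, (T ^ 2 + 0 * T - -(-((b : K) * c) + -(c * a) + -(a * b)) - -ρ / z1 ^ 2 - -ρ / z2 ^ 2) * (z1 ^ 2 - z2 ^ 2) ^ 2 =
       T ^ 2 * (z1 ^ 2 - z2 ^ 2) ^ 2 + (-(b * c + c * a + a * b) + ρ / z1 ^ 2 + ρ / z2 ^ 2) * (z1 ^ 2 - z2 ^ 2) ^ 2 := by intro T; ring
    rw [e3, e1, hρ]
    field_simp
    ring
  have qs : q (u i + u j) ≤ (logHeight₁ (NN (1 : K) (-(a + b + c)) (a * b + b * c + c * a) (-ρ) z1 y1 z2 (-y2) / DD z1 z2) +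
      logHeight₁ (NM (1 : K) (-(a + b + c)) (a * b + b * c + c * a) (-ρ) z1 y1 z2 (-y2) / DD z1 z2)) + CC := by
    rw [← add1, ← add2]
    have t1 := (abs_le.1 (hC1 (u i + u j).1)).2
    have t2 := (abs_le.1 (hC2 (u i + u j).2)).2
    simp only [hq]
    linarith
  exact final_real hCn ai aj qs (by linarith) g3 hs2 (hs0.trans hss0) (by linarith) V
end
end
end Mord

set_option linter.unusedSectionVars false
set_option linter.style.longLine false

namespace Mord
open NumberField Polynomial IsDedekindDomain
open scoped Classical

noncomputable section

section
universe u
variable {L : Type u} [Field L] [NumberField L]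

lemma bielliptic_z (a : Fin 3 → L) (e : L) (he : e ^ 2 = a 0) (h0 : ∀ i, a i ≠ 0) (hinj : Function.Injective a) :
    {z : L | ∃ y, y ^ 2 = (z ^ 2 - a 0) * (z ^ 2 - a 1) * (z ^ 2 - a 2)}.Finite := by
  obtain ⟨⟨d, dm⟩, hd⟩ := IsLocalization.exist_integer_multiples_of_finite (nonZeroDivisors (𝓞 L)) a
  have hd0 : (d : L) ≠ 0 := by
    have := nonZeroDivisors.ne_zero dm
    exact_mod_cast this
  choose b hb using hd
  have hb' : ∀ i, ((d * b i : 𝓞 L) : L) = (d : L) ^ 2 * a i := by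
    intro i
    have this : algebraMap (𝓞 L) L (b i) = (d : L) * a i := (hb i).trans (Algebra.smul_def d (a i))
    have h2 : ((d * b i : 𝓞 L) : L) = (d : L) * algebraMap (𝓞 L) L (b i) := map_mul (algebraMap (𝓞 L) L) d (b i)
    rw [h2, this]; ring
  have hne : ∀ i j, i ≠ j → ((d * b i : 𝓞 L) : L) ≠ ((d * b j : 𝓞 L) : L) := by
    intro i j hij h
    rw [hb', hb'] at h
    exact hij (hinj (mul_left_cancel₀ (pow_ne_zero 2 hd0) h))
  have hnz : ∀ i, ((d * b i : 𝓞 L) : L) ≠ 0 := by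
    intro i
    rw [hb']
    exact mul_ne_zero (pow_ne_zero 2 hd0) (h0 i)
  have F := bielliptic_finite (d * b 0) (d * b 1) (d * b 2) (d * e) (by rw [hb', mul_pow, he]) (hnz 0) (hnz 1) (hnz 2)
    (hne 0 1 (by decide)) (hne 1 2 (by decide)) (hne 2 0 (by decide))
  have F1 := F.image Prod.fst
  refine (F1.preimage (f := fun z : L => (d : L) * z) (mul_right_injective₀ hd0).injOn).subset ?_
  rintro z ⟨y, hy⟩
  refine ⟨((d : L) * z, (d : L) ^ 3 * y), ?_, rfl⟩
  simp only [Set.mem_ofPred_eq, hb']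
  rw [mul_pow, hy]; ring

lemma sqrt_ext (s : Finset L) : ∃ (M : Type u) (_ : Field M) (_ : NumberField M) (_ : Algebra L M), ∀ t ∈ s, ∃ r : M, r ^ 2 = algebraMap L M t := by
  let P : L[X] := ∏ t ∈ s, (X ^ 2 - C t)
  refine ⟨P.SplittingField, inferInstance, NumberField.of_module_finite L _, inferInstance, fun t ht => ?_⟩
  have hP : P ≠ 0 := Finset.prod_ne_zero_iff.2 fun t _ => (monic_X_pow_sub_C t two_ne_zero).ne_zero
  have hs : ((X ^ 2 - C t : L[X]).map (algebraMap L P.SplittingField)).Splits :=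
    (SplittingField.splits P).of_dvd (by simpa using hP) (Polynomial.map_dvd _ (Finset.dvd_prod_of_mem _ ht))
  have hdeg : ((X ^ 2 - C t : L[X]).map (algebraMap L P.SplittingField)).degree ≠ 0 := by
    rw [degree_map, degree_X_pow_sub_C (by norm_num)]; norm_num
  obtain ⟨r, hr⟩ := hs.exists_eval_eq_zero hdeg
  refine ⟨r, ?_⟩
  simpa [sub_eq_zero] using hr

lemma squares_finite (γ : Fin 4 → L) (hγ : Function.Injective γ) (d : Fin 4 → L) :
    {X : L | ∀ i, ∃ w, X - γ i = d i * w ^ 2}.Finite := by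
  obtain ⟨M, _, _, _, hM⟩ := sqrt_ext (insert (γ 0 - γ 3) (Finset.univ.image d))
  obtain ⟨e, he⟩ := hM _ (Finset.mem_insert_self _ _)
  have hd : ∀ i, ∃ r : M, r ^ 2 = algebraMap L M (d i) := fun i =>
    hM _ (Finset.mem_insert_of_mem (Finset.mem_image_of_mem _ (Finset.mem_univ i)))
  choose r hr using hd
  have F := bielliptic_z (fun i : Fin 3 => algebraMap L M (γ (i.castSucc) - γ 3)) e (by simpa using he) (by
      intro i
      rw [Ne, map_eq_zero, sub_eq_zero]
      intro h
      exact Fin.castSucc_ne_last i (hγ h)) (by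
      intro i j h
      have := (algebraMap L M).injective h
      exact Fin.castSucc_injective _ (hγ (sub_left_injective this)))
  have F1 := F.image (fun z => z ^ 2 + algebraMap L M (γ 3))
  refine (F1.preimage (f := algebraMap L M) (algebraMap L M).injective.injOn).subset ?_
  intro X hX
  choose w hw using hX
  have key : ∀ i, (r i * algebraMap L M (w i)) ^ 2 = algebraMap L M X - algebraMap L M (γ i) := by
    intro i
    rw [mul_pow, hr, ← map_pow, ← map_mul, ← hw, map_sub]
  refine ⟨r 3 * algebraMap L M (w 3), ⟨(r 0 * algebraMap L M (w 0)) * (r 1 * algebraMap L M (w 1)) * (r 2 * algebraMap L M (w 2)), ?_⟩, ?_⟩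
  · rw [mul_pow, mul_pow, key, key, key, key]
    simp only [map_sub]
    have e0 : (Fin.castSucc (0 : Fin 3)) = (0 : Fin 4) := rfl
    have e1 : (Fin.castSucc (1 : Fin 3)) = (1 : Fin 4) := rfl
    have e2 : (Fin.castSucc (2 : Fin 3)) = (2 : Fin 4) := rfl
    rw [e0, e1, e2]
    ring
  · simp only [key]; ring

lemma split_finite {ι : Type*} [Fintype ι] (α : ι → L) (hα : Function.Injective α) (c : L) (hc : c ≠ 0) (κ : Fin 4 → ι) (hκ : Function.Injective κ)
    (o : ι) (ho : ∀ i, κ i ≠ o) : {x : L | ∃ y, y ^ 2 = c * ∏ i, (x - α i)}.Finite := by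
  obtain ⟨N, hN, h⟩ := exists_N_roots α hα c hc
  obtain ⟨T, hT, hT0, hA⟩ := finMod_S L N hN
  have hαo : ∀ i, α o - α (κ i) ≠ 0 := fun i => sub_ne_zero.2 fun h => ho i (hα h).symm
  have big : (⋃ t ∈ Set.pi Set.univ (fun _ : Fin 4 => T), {X : L | ∀ i, ∃ w, X - 1 / (α (κ i) - α o) = (t i / (α o - α (κ i))) * w ^ 2}).Finite := by
    refine Set.Finite.biUnion (Set.Finite.pi fun _ => hT) fun t _ => squares_finite _ ?_ _
    intro i j hij
    simp only [one_div] at hij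
    exact hκ (hα (sub_left_injective (inv_injective hij)))
  have badf : (Set.range α).Finite := Set.finite_range α
  have big2 := big.preimage (f := fun x : L => 1 / (x - α o)) (by
    intro x _ y _ hxy
    simp only [one_div] at hxy
    exact sub_left_injective (inv_injective hxy))
  refine (big2.union badf).subset ?_
  rintro x ⟨y, hy⟩
  by_cases hx : x ∈ Set.range α
  · exact Or.inr hx
  left
  have hx0 : ∀ i, x - α i ≠ 0 := fun i h => hx ⟨i, (sub_eq_zero.1 h).symm⟩
  have hcl : ∀ i : Fin 4, ∃ t ∈ T, ∃ z, z ≠ 0 ∧ (x - α (κ i)) * (x - α o) = t * z ^ 2 := by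
    intro i
    refine hA _ ⟨mul_ne_zero (hx0 _) (hx0 _), fun v hv => ?_⟩
    obtain ⟨g1, g2, g3⟩ := h v hv
    have hev := val_even (v.valuation L) α g1 g2 g3 hy
    by_cases hvx : 1 < v.valuation L x
    · refine ⟨v.valuation L x, ?_⟩
      have hall : ∀ j, v.valuation L (x - α j) = v.valuation L x := fun j =>
        Valuation.map_sub_eq_of_lt_left _ (lt_of_le_of_lt (g1 j) hvx)
      rw [map_mul, hall, hall, sq]
    · obtain ⟨w1, h1⟩ := (hev (κ i)).resolve_left fun h => hvx h.1
      obtain ⟨w2, h2⟩ := (hev o).resolve_left fun h => hvx h.1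
      exact ⟨w1 * w2, by rw [map_mul, h1, h2, mul_pow]⟩
  choose t ht z hz htz using hcl
  simp only [Set.mem_preimage, Set.mem_iUnion]
  refine ⟨t, fun i _ => ht i, fun i => ⟨z i / (x - α o), ?_⟩⟩
  have n1 := hαo i
  have n2 : α (κ i) - α o ≠ 0 := by rw [← neg_sub]; exact neg_ne_zero.2 n1
  have n3 := hx0 o
  have e1 : t i / (α o - α (κ i)) * (z i / (x - α o)) ^ 2 = (t i * z i ^ 2) / ((α o - α (κ i)) * (x - α o) ^ 2) := by
    field_simp
  rw [e1, ← htz, div_sub_div _ _ n3 n2, div_eq_div_iff (mul_ne_zero n3 n2) (mul_ne_zero n1 (pow_ne_zero 2 n3))]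
  ring
end

theorem main {K : Type*} [Field K] [NumberField K] (f : Polynomial K) (hf : Squarefree f) (hdeg : 5 ≤ f.natDegree) :
    {p : K × K | p.2 ^ 2 = f.eval p.1}.Finite := by
  let L := f.SplittingField
  have : NumberField L := NumberField.of_module_finite K L
  set g := f.map (algebraMap K L) with hg
  have hs : g.Splits := SplittingField.splits f
  have hsep : g.Separable := (PerfectField.separable_iff_squarefree.2 hf).map
  have hnd : g.roots.Nodup := nodup_roots hsep
  have hgd : g.natDegree = f.natDegree := natDegree_map _
  have hcard : g.roots.toFinset.card = f.natDegree := by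
    rw [Multiset.toFinset_card_of_nodup hnd, ← hs.natDegree_eq_card_roots, hgd]
  have hg0 : g.leadingCoeff ≠ 0 := by
    rw [Ne, leadingCoeff_eq_zero]; rintro h; rw [h, natDegree_zero] at hgd; omega
  have hev : ∀ x, g.eval x = g.leadingCoeff * ∏ i : g.roots.toFinset, (x - i.1) := by
    intro x
    rw [hs.eval_eq_prod_roots, Finset.prod_coe_sort g.roots.toFinset (fun i => x - i), Finset.prod, Multiset.toFinset_val, Multiset.dedup_eq_self.2 hnd]
  obtain ⟨k⟩ : Nonempty (Fin 5 ↪ g.roots.toFinset) := by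
    rw [Function.Embedding.nonempty_iff_card_le]
    simp only [Fintype.card_fin, Fintype.card_coe]
    omega
  have F := split_finite (L := L) (fun i : g.roots.toFinset => i.1) Subtype.val_injective g.leadingCoeff hg0 (fun i => k i.castSucc)
    (fun i j h => Fin.castSucc_injective _ (k.injective h)) (k (Fin.last 4)) (fun i h => Fin.castSucc_ne_last i (k.injective h))
  have F1 := F.preimage (f := algebraMap K L) (algebraMap K L).injective.injOn
  have F2 : (⋃ x ∈ (algebraMap K L ⁻¹' {x : L | ∃ y, y ^ 2 = g.leadingCoeff * ∏ i : g.roots.toFinset, (x - i.1)}),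
      ({x} ×ˢ {y : K | y ^ 2 = f.eval x} : Set (K × K))).Finite :=
    Set.Finite.biUnion F1 fun x _ => (Set.finite_singleton x).prod (sq_finite _)
  refine F2.subset ?_
  rintro ⟨x, y⟩ h
  simp only [Set.mem_iUnion]
  refine ⟨x, ⟨algebraMap K L y, ?_⟩, rfl, h⟩
  have h' : y ^ 2 = f.eval x := h
  rw [← hev, ← map_pow, h', hg, eval_map_algebraMap, aeval_algebraMap_apply, coe_aeval_eq_eval]
end
end Mord

/-- The Mordell conjecture (Faltings's theorem) for hyperelliptic curves: for a number field
`K` and a squarefree polynomial `f` over `K` of degree at least 5, the set of pairs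
`(x, y) ∈ K × K` with `y² = f(x)` is finite. -/
theorem mordell_conjecture_hyperelliptic (K : Type*) [Field K] [NumberField K]
    (f : Polynomial K) (hf : Squarefree f) (hdeg : 5 ≤ f.natDegree) :
    {p : K × K | p.2 ^ 2 = f.eval p.1}.Finite := by
  exact Mord.main f hf hdeg
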